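/- arXiv:2310.19048 — 3 statements merged into one kernel-verified Lean document; each statement's English description precedes it below -/
import Mathlib

section
/- For all integers ℓ ≥ 1 and k ≥ 1, there exists n₀ such that for all n ≥ n₀, the maximum number of triangles in an n-vertex graph containing no ℓ+1 pairwise vertex-disjoint copies of the cycle C_{2k+1} equals ℓ·⌊(n−ℓ)²/4⌋ + (n−ℓ)·C(ℓ,2) + C(ℓ,3). -/
open SimpleGraph

/-- The number of triangles (copies of `K_3`) in `G`. -/
noncomputable def triangleCount {V : Type*} (G : SimpleGraph V) : ℕ :=
  (G.cliqueSet 3).ncard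

/-- The number of edges of `G`. -/
noncomputable def edgeCount {V : Type*} (G : SimpleGraph V) : ℕ :=
  G.edgeSet.ncard

/-- `G` contains a copy of `H` as a (not necessarily induced) subgraph. -/
def Contains {V W : Type*} (G : SimpleGraph V) (H : SimpleGraph W) : Prop :=
  ∃ f : W → V, Function.Injective f ∧ ∀ ⦃i j⦄, H.Adj i j → G.Adj (f i) (f j)

/-- `G` contains `c` pairwise vertex-disjoint copies of the cycle `C_m`. -/
def HasDisjointCycles {V : Type*} (G : SimpleGraph V) (c m : ℕ) : Prop :=
  ∃ f : Fin c → Fin m → V,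
    (∀ j, Function.Injective (f j)) ∧
    (∀ j, ∀ ⦃i i'⦄, (cycleGraph m).Adj i i' → G.Adj (f j i) (f j i')) ∧
    Pairwise fun j j' => Disjoint (Set.range (f j)) (Set.range (f j'))

/-- The join `G ⋈ H`: disjoint union plus all edges between the two sides. -/
def joinGraph {α β : Type*} (G : SimpleGraph α) (H : SimpleGraph β) : SimpleGraph (α ⊕ β) :=
  SimpleGraph.fromRel (fun x y =>
    (∃ a a', x = Sum.inl a ∧ y = Sum.inl a' ∧ G.Adj a a') ∨
    (∃ b b', x = Sum.inr b ∧ y = Sum.inr b' ∧ H.Adj b b') ∨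
    (x.isLeft ∧ y.isRight))

/-- The graph `K_ℓ ⋈ T_2(m)`: the join of a complete graph on `ℓ` vertices with the
complete balanced bipartite (Turán) graph on `m` vertices. -/
noncomputable def extremalJoin (ℓ m : ℕ) : SimpleGraph (Fin ℓ ⊕ Fin m) :=
  joinGraph (completeGraph (Fin ℓ)) (turanGraph m 2)

/-- `heavySet G k A B` is the set `L` of vertices of `A` having at least
`(1 - 1/(10k))·|B|` neighbours in `B`. -/
noncomputable def heavySet {V : Type*} (G : SimpleGraph V) (k : ℕ) (A B : Set V) : Set V :=
  {v ∈ A | ((1 : ℝ) - 1 / (10 * k)) * B.ncard ≤ ((G.neighborSet v ∩ B).ncard : ℝ)}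

namespace OddCyclePacking

open Finset
open scoped Classical

variable {V : Type} {G : SimpleGraph V}

/-- `f` traces a copy of the cycle `C_m` in `G`. -/
def IsCycleCopy (G : SimpleGraph V) (m : ℕ) (f : Fin m → V) : Prop :=
  Function.Injective f ∧ ∀ ⦃i j⦄, (cycleGraph m).Adj i j → G.Adj (f i) (f j)

/-- `G` has a copy of `C_m` disjoint from `X`. -/
def HasCycleAvoiding (G : SimpleGraph V) (m : ℕ) (X : Finset V) : Prop :=
  ∃ f : Fin m → V, IsCycleCopy G m f ∧ ∀ i, f i ∉ X

theorem IsCycleCopy.mono {H : SimpleGraph V} (h : G ≤ H) {m : ℕ} {f : Fin m → V}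
    (hf : IsCycleCopy G m f) : IsCycleCopy H m f :=
  ⟨hf.1, fun _ _ hij => h (hf.2 hij)⟩

theorem HasCycleAvoiding.mono {H : SimpleGraph V} (h : G ≤ H) {m : ℕ} {X Y : Finset V}
    (hXY : Y ⊆ X) (hc : HasCycleAvoiding G m X) : HasCycleAvoiding H m Y := by
  obtain ⟨f, hf, hX⟩ := hc
  exact ⟨f, hf.mono h, fun i hi => hX i (hXY hi)⟩

theorem hasCycleAvoiding_of_isPath {a b : V} (p : G.Walk a b) (hp : p.IsPath) (hab : G.Adj b a)
    {X : Finset V} (hX : ∀ v ∈ p.support, v ∉ X) :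
    HasCycleAvoiding G (p.length + 1) X := by
  have step : ∀ u v : Fin (p.length + 1), (u - v).val = 1 →
      G.Adj (p.getVert v) (p.getVert u) := by
    intro u v h
    rw [Fin.val_sub] at h
    have hu := u.isLt
    have hv := v.isLt
    rcases Nat.lt_or_ge u.val v.val with hlt | hge
    · rw [Nat.mod_eq_of_lt (by omega)] at h
      have h1 : v.val = p.length := by omega
      have h2 : u.val = 0 := by omega
      rw [h1, h2, SimpleGraph.Walk.getVert_length, SimpleGraph.Walk.getVert_zero]
      exact hab
    · rw [Nat.mod_eq_sub_mod (by omega), Nat.mod_eq_of_lt (by omega)] at h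
      have h1 : u.val = v.val + 1 := by omega
      rw [h1]
      exact p.adj_getVert_succ (by omega)
  refine ⟨fun i => p.getVert i, ⟨?_, ?_⟩, fun i => hX _ (p.getVert_mem_support _)⟩
  · intro i j hij
    exact Fin.ext (hp.getVert_injOn (by simpa using Nat.lt_succ_iff.mp i.isLt)
      (by simpa using Nat.lt_succ_iff.mp j.isLt) hij)
  · intro i j hij
    rcases cycleGraph_adj'.mp hij with h | h
    · exact (step i j h).symm
    · exact step j i h

/-- Recursive form of a packing of `c` disjoint copies of `C_m` outside `X`. -/
def Packing (G : SimpleGraph V) (m : ℕ) : ℕ → Finset V → Prop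
  | 0, _ => True
  | c + 1, X => ∃ f : Fin m → V, IsCycleCopy G m f ∧ (∀ i, f i ∉ X) ∧
      Packing G m c (X ∪ univ.image f)

theorem Packing.exists_family {m : ℕ} : ∀ {c : ℕ} {X : Finset V}, Packing G m c X →
    ∃ f : Fin c → Fin m → V, (∀ j, IsCycleCopy G m (f j)) ∧ (∀ j i, f j i ∉ X) ∧
      Pairwise fun j j' => Disjoint (Set.range (f j)) (Set.range (f j'))
  | 0, _, _ => ⟨fun j => j.elim0, fun j => j.elim0, fun j => j.elim0, fun j => j.elim0⟩
  | c + 1, X, h => by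
    obtain ⟨f, hf, hX, hP⟩ := h
    obtain ⟨g, hg, hgX, hgd⟩ := hP.exists_family
    have hdis : ∀ j, Disjoint (Set.range f) (Set.range (g j)) := by
      intro j
      rw [Set.disjoint_left]
      rintro _ ⟨i, rfl⟩ ⟨i', hi'⟩
      exact hgX j i' (by simp [hi'])
    refine ⟨Fin.cons f g, ?_, ?_, ?_⟩
    · intro j
      refine Fin.cases ?_ (fun j => ?_) j
      · simpa using hf
      · simpa using hg j
    · intro j
      refine Fin.cases ?_ (fun j => ?_) j
      · simpa using hX
      · intro i hi
        exact hgX j i (by simp only [Fin.cons_succ] at hi; simp [hi])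
    · intro j j'
      refine Fin.cases ?_ (fun j => ?_) j <;> refine Fin.cases ?_ (fun j' => ?_) j'
      · simp
      · intro _
        simpa using hdis j'
      · intro _
        simpa using (hdis j).symm
      · intro hne
        simpa using hgd (fun h => hne (by rw [h]))

theorem Packing.hasDisjointCycles {m c : ℕ} (h : Packing G m c ∅) : HasDisjointCycles G c m := by
  obtain ⟨f, hf, -, hd⟩ := h.exists_family
  exact ⟨f, fun j => (hf j).1, fun j => (hf j).2, hd⟩

theorem exists_hitting_set {m : ℕ} : ∀ {c : ℕ} {X : Finset V}, ¬ Packing G m (c + 1) X →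
    ∃ S : Finset V, X ⊆ S ∧ S.card ≤ X.card + c * m ∧ ¬ HasCycleAvoiding G m S
  | 0, X, h => ⟨X, Subset.rfl, by simp, fun ⟨f, hf, hX⟩ => h ⟨f, hf, hX, trivial⟩⟩
  | c + 1, X, h => by
    by_cases hX : HasCycleAvoiding G m X
    · obtain ⟨f, hf, hfX⟩ := hX
      obtain ⟨S, hS, hcard, hno⟩ := exists_hitting_set (fun hP => h ⟨f, hf, hfX, hP⟩)
      refine ⟨S, subset_union_left.trans hS, hcard.trans ?_, hno⟩
      have h1 := card_union_le X (univ.image f)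
      have h2 : (univ.image f).card ≤ m := card_image_le.trans (by simp)
      linarith [add_mul c 1 m]
    · exact ⟨X, Subset.rfl, by simp, hX⟩

/-- A path of length `d` inside `W` exists once every vertex of `W` has more than `d` neighbours
in `W`. -/
theorem exists_isPath_of_lt_degree {W : Finset V} {d : ℕ} (hne : W.Nonempty)
    (hd : ∀ v ∈ W, d < (W.filter (G.Adj v)).card) {j : ℕ} (hj : j ≤ d) :
    ∃ (a b : V) (p : G.Walk a b), p.IsPath ∧ p.length = j ∧ ∀ v ∈ p.support, v ∈ W := by
  induction j with
  | zero =>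
    obtain ⟨a, ha⟩ := hne
    exact ⟨a, a, .nil, by simp, by simp, by simpa using ha⟩
  | succ j ih =>
    obtain ⟨a, b, p, hp, hl, hs⟩ := ih (by omega)
    have hlt : p.support.toFinset.card < (W.filter (G.Adj a)).card := by
      refine lt_of_le_of_lt (List.toFinset_card_le _) ?_
      rw [SimpleGraph.Walk.length_support, hl]
      exact lt_of_le_of_lt hj (hd a (hs a p.start_mem_support))
    obtain ⟨c, hc, hcp⟩ := exists_mem_notMem_of_card_lt_card hlt
    rw [mem_filter] at hc
    refine ⟨c, b, .cons hc.2.symm p, ?_, by simp [hl], ?_⟩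
    · rw [SimpleGraph.Walk.cons_isPath_iff]
      exact ⟨hp, by simpa using hcp⟩
    · intro v hv
      rw [SimpleGraph.Walk.support_cons, List.mem_cons] at hv
      rcases hv with rfl | hv
      · exact hc.1
      · exact hs v hv

/-- The number of ordered adjacent pairs inside `W`. -/
noncomputable def adjPairs (G : SimpleGraph V) (W : Finset V) : ℕ :=
  ∑ v ∈ W, (W.filter (G.Adj v)).card

theorem adjPairs_le_erase_add (W : Finset V) (v : V) :
    adjPairs G W ≤ adjPairs G (W.erase v) + 2 * (W.filter (G.Adj v)).card := by
  by_cases hv : v ∈ W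
  · have h1 : ∀ x ∈ W.erase v, (W.filter (G.Adj x)).card ≤
        ((W.erase v).filter (G.Adj x)).card + if G.Adj v x then 1 else 0 := by
      intro x _
      rw [filter_erase]
      split_ifs with h
      · have := pred_card_le_card_erase (s := W.filter (G.Adj x)) (a := v)
        omega
      · rw [erase_eq_of_notMem]
        · simp
        · simp [h, SimpleGraph.adj_comm]
    have h2 : (∑ x ∈ W.erase v, if G.Adj v x then 1 else 0) ≤ (W.filter (G.Adj v)).card := by
      rw [← card_filter]
      exact card_le_card (filter_subset_filter _ (erase_subset _ _))
    unfold adjPairs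
    rw [← add_sum_erase W _ hv]
    have h3 := sum_le_sum h1
    rw [sum_add_distrib] at h3
    omega
  · rw [erase_eq_of_notMem hv]
    omega

/-- A weak form of the Erdős–Gallai theorem on paths. -/
theorem exists_isPath_of_lt_adjPairs (d : ℕ) (W : Finset V) (h : 2 * d * W.card < adjPairs G W) :
    ∃ (a b : V) (p : G.Walk a b), p.IsPath ∧ p.length = d ∧ ∀ v ∈ p.support, v ∈ W := by
  induction hn : W.card generalizing W with
  | zero =>
    rw [card_eq_zero] at hn
    subst hn
    simp [adjPairs] at h
  | succ n ih =>
    by_cases hd : ∀ v ∈ W, d < (W.filter (G.Adj v)).card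
    · exact exists_isPath_of_lt_degree (card_pos.mp (by omega)) hd le_rfl
    · push Not at hd
      obtain ⟨v, hv, hvd⟩ := hd
      have hc : (W.erase v).card = n := by rw [card_erase_of_mem hv]; omega
      have h1 := adjPairs_le_erase_add (G := G) W v
      obtain ⟨a, b, p, hp, hl, hs⟩ := ih (W.erase v) (by rw [hc]; rw [hn] at h; nlinarith) hc
      exact ⟨a, b, p, hp, hl, fun x hx => mem_of_mem_erase (hs x hx)⟩

theorem hasCycleAvoiding_of_adjPairs {k : ℕ} (hk : 1 ≤ k) {v : V} {W X : Finset V}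
    (hvW : ∀ x ∈ W, G.Adj v x) (hvX : v ∉ X) (hWX : Disjoint W X)
    (h : 4 * k * W.card < adjPairs G W) : HasCycleAvoiding G (2 * k + 1) X := by
  obtain ⟨a, b, p, hp, hl, hs⟩ := exists_isPath_of_lt_adjPairs (G := G) (2 * k - 1) W (by
    refine lt_of_le_of_lt (Nat.mul_le_mul_right _ ?_) h
    omega)
  have hva := hvW a (hs a p.start_mem_support)
  have hvb := hvW b (hs b p.end_mem_support)
  have := hasCycleAvoiding_of_isPath (X := X) (.cons hva p) (by
    rw [SimpleGraph.Walk.cons_isPath_iff]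
    exact ⟨hp, fun hv => (hvW v (hs v hv)).ne rfl⟩) hvb.symm (by
    intro x hx
    rw [SimpleGraph.Walk.support_cons, List.mem_cons] at hx
    rcases hx with rfl | hx
    · exact hvX
    · exact disjoint_left.mp hWX (hs x hx))
  rw [SimpleGraph.Walk.length_cons, hl] at this
  convert this using 1
  omega

/-- A dense bipartite pair: any two vertices on one side have at least `M` common neighbours on
the other side. -/
structure DensePair (G : SimpleGraph V) (A B : Finset V) (M : ℕ) : Prop where
  disjoint : Disjoint A B
  left : ∀ a ∈ A, ∀ a' ∈ A, M ≤ (B.filter fun b => G.Adj a b ∧ G.Adj a' b).card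
  right : ∀ b ∈ B, ∀ b' ∈ B, M ≤ (A.filter fun a => G.Adj b a ∧ G.Adj b' a).card

theorem DensePair.symm {A B : Finset V} {M : ℕ} (h : DensePair G A B M) : DensePair G B A M :=
  ⟨h.disjoint.symm, h.right, h.left⟩

theorem DensePair.mono {A B : Finset V} {M : ℕ} {H : SimpleGraph V} (hGH : G ≤ H)
    (h : DensePair G A B M) : DensePair H A B M where
  disjoint := h.disjoint
  left a ha a' ha' := (h.left a ha a' ha').trans
    (card_le_card (monotone_filter_right _ fun _ _ hb => ⟨hGH hb.1, hGH hb.2⟩))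
  right b hb b' hb' := (h.right b hb b' hb').trans
    (card_le_card (monotone_filter_right _ fun _ _ ha => ⟨hGH ha.1, hGH ha.2⟩))

theorem DensePair.exists_left {A B : Finset V} {M : ℕ} (h : DensePair G A B M) {a a' : V}
    (ha : a ∈ A) (ha' : a' ∈ A) {X : Finset V} (hX : X.card < M) :
    ∃ b ∈ B, G.Adj a b ∧ G.Adj a' b ∧ b ∉ X := by
  obtain ⟨b, hb, hbX⟩ := exists_mem_notMem_of_card_lt_card (hX.trans_le (h.left a ha a' ha'))
  rw [mem_filter] at hb
  exact ⟨b, hb.1, hb.2.1, hb.2.2, hbX⟩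

theorem DensePair.exists_isPath {A B : Finset V} {M : ℕ} (h : DensePair G A B M) {j : ℕ}
    (hj : 1 ≤ j) {a a' : V} (ha : a ∈ A) (ha' : a' ∈ A) (hne : a ≠ a') {X : Finset V}
    (hM : X.card + 2 * j < M) (haX : a ∉ X) (haX' : a' ∉ X) :
    ∃ p : G.Walk a a', p.IsPath ∧ p.length = 2 * j ∧ ∀ v ∈ p.support, v ∉ X := by
  induction j, hj using Nat.le_induction generalizing a X with
  | base =>
    obtain ⟨b, hb, hab, hab', hbX⟩ := h.exists_left ha ha' (X := X) (by omega)
    refine ⟨.cons hab (.cons hab'.symm .nil), ?_, by simp, ?_⟩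
    · simp [SimpleGraph.Walk.cons_isPath_iff, hab.ne, hab'.ne', hne]
    · simp [haX, haX', hbX]
  | succ j hj ih =>
    obtain ⟨b, hb, hab, -, hbX⟩ := h.exists_left ha ha (X := X) (by omega)
    have hc : (insert a (insert a' X)).card ≤ X.card + 2 :=
      (card_insert_le _ _).trans (Nat.succ_le_succ (card_insert_le _ _))
    obtain ⟨c, hcA, hbc, -, hcX⟩ := h.symm.exists_left hb hb (X := insert a (insert a' X))
      (by omega)
    simp only [mem_insert, not_or] at hcX
    have hba' : a' ≠ b := fun hh => disjoint_left.mp h.disjoint ha' (hh ▸ hb)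
    have hc' : (insert a (insert b X)).card ≤ X.card + 2 :=
      (card_insert_le _ _).trans (Nat.succ_le_succ (card_insert_le _ _))
    obtain ⟨p, hp, hl, hs⟩ := ih hcA hcX.2.1 (X := insert a (insert b X)) (by omega)
      (by simp [hcX, hbc.ne']) (by simp [hne.symm, hba', haX'])
    simp only [mem_insert, not_or] at hs
    refine ⟨.cons hab (.cons hbc p), ?_, by simp [hl]; ring, ?_⟩
    · simp only [SimpleGraph.Walk.cons_isPath_iff, SimpleGraph.Walk.support_cons, List.mem_cons,
        not_or]
      exact ⟨⟨hp, fun hb => (hs b hb).2.1 rfl⟩, hab.ne, fun ha => (hs a ha).1 rfl⟩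
    · simp only [SimpleGraph.Walk.support_cons, List.mem_cons]
      rintro v (rfl | rfl | hv)
      · exact haX
      · exact hbX
      · exact (hs v hv).2.2

theorem DensePair.hasCycle_of_adj_both {A B : Finset V} {M k : ℕ} (h : DensePair G A B M)
    (hk : 2 ≤ k) (hM : 2 * k < M) {v a b : V} (ha : a ∈ A) (hb : b ∈ B) (hva : G.Adj v a)
    (hvb : G.Adj v b) : HasCycleAvoiding G (2 * k + 1) ∅ := by
  have hab : a ≠ b := fun hh => disjoint_left.mp h.disjoint ha (hh ▸ hb)
  obtain ⟨a', ha', hba', -, haX'⟩ := h.symm.exists_left hb hb (X := {a, v})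
    (card_le_two.trans_lt (by omega))
  simp only [mem_insert, mem_singleton, not_or] at haX'
  obtain ⟨p, hp, hl, hs⟩ := h.exists_isPath (j := k - 1) (by omega) ha ha' (Ne.symm haX'.1)
    (X := {v, b}) ((Nat.add_le_add_right card_le_two _).trans_lt (by omega))
    (by simp [hva.ne', hab]) (by simp [haX'.2, hba'.ne'])
  simp only [mem_insert, mem_singleton, not_or] at hs
  have := hasCycleAvoiding_of_isPath (X := ∅) (.cons hvb.symm (.cons hva p)) (by
    simp only [SimpleGraph.Walk.cons_isPath_iff, SimpleGraph.Walk.support_cons, List.mem_cons,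
      not_or]
    exact ⟨⟨hp, fun hv => (hs v hv).1 rfl⟩, hvb.ne', fun hb => (hs b hb).2 rfl⟩) hba'.symm (by simp)
  simp only [SimpleGraph.Walk.length_cons, hl] at this
  convert this using 1
  omega

theorem DensePair.hasCycle_of_adj {A B : Finset V} {M k : ℕ} (h : DensePair G A B M)
    (hk : 2 ≤ k) (hM : 2 * k < M) {v v' b b' : V} (hvB : v ∉ B) (hvB' : v' ∉ B) (hb : b ∈ B)
    (hb' : b' ∈ B) (hbb' : b ≠ b') (hvv' : G.Adj v v') (hvb : G.Adj v b) (hvb' : G.Adj v' b') :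
    HasCycleAvoiding G (2 * k + 1) ∅ := by
  have hnv : ∀ x ∈ B, x ≠ v ∧ x ≠ v' := fun x hx =>
    ⟨fun hh => hvB (hh ▸ hx), fun hh => hvB' (hh ▸ hx)⟩
  obtain ⟨p, hp, hl, hs⟩ := h.symm.exists_isPath (j := k - 1) (by omega) hb hb' hbb'
    (X := {v, v'}) ((Nat.add_le_add_right card_le_two _).trans_lt (by omega))
    (by simp [hnv b hb]) (by simp [hnv b' hb'])
  simp only [mem_insert, mem_singleton, not_or] at hs
  have := hasCycleAvoiding_of_isPath (X := ∅) (.cons hvv'.symm (.cons hvb p)) (by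
    simp only [SimpleGraph.Walk.cons_isPath_iff, SimpleGraph.Walk.support_cons, List.mem_cons,
      not_or]
    exact ⟨⟨hp, fun hv => (hs v hv).1 rfl⟩, hvv'.ne', fun hv => (hs v' hv).2 rfl⟩)
    hvb'.symm (by simp)
  simp only [SimpleGraph.Walk.length_cons, hl] at this
  convert this using 1
  omega

section Counting

variable [Fintype V]

theorem sum_choose_degree (G : SimpleGraph V) (t : ℕ) :
    ∑ v, (univ.filter (G.Adj v)).card.choose t =
      ∑ A ∈ powersetCard t (univ : Finset V), (univ.filter fun v => ∀ a ∈ A, G.Adj v a).card := by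
  have h := sum_card_bipartiteAbove_eq_sum_card_bipartiteBelow (s := (univ : Finset V))
    (t := powersetCard t (univ : Finset V)) (fun v A => ∀ a ∈ A, G.Adj v a)
  refine Eq.trans (sum_congr rfl fun v _ => ?_) h
  rw [← card_powersetCard]
  congr 1
  ext A
  simp [bipartiteAbove, mem_powersetCard, subset_iff, and_comm]

/-- A weak form of the Kővári–Sós–Turán theorem. -/
theorem exists_complete_pair_of_dense (r : ℕ) {ε : ℝ} (hε : 0 < ε) :
    ∃ n₀ : ℕ, ∀ (V : Type) [Fintype V] (G : SimpleGraph V), n₀ ≤ Fintype.card V →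
      ε * (Fintype.card V : ℝ) ^ 2 ≤ adjPairs G univ →
      ∃ A B : Finset V, A.card = r + 1 ∧ r + 1 ≤ B.card ∧ ∀ a ∈ A, ∀ b ∈ B, G.Adj a b := by
  obtain ⟨n₀, hn₀⟩ := exists_nat_gt (max ((r + 1) / (ε / 2) ^ (r + 1)) (2 * (r + 1) / ε))
  refine ⟨n₀ + 1, fun V _ G hn hG => ?_⟩
  by_contra hcon
  push Not at hcon
  set n : ℝ := (Fintype.card V : ℝ) with hndef
  have hn1 : (n₀ : ℝ) + 1 ≤ n := by
    rw [hndef]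
    exact_mod_cast hn
  have hn1' : (n₀ : ℝ) < n := (lt_add_one _).trans_le hn1
  have hnpos : 0 < n := lt_of_lt_of_le (by positivity) hn1
  have hn2 : (r + 1) / (ε / 2) ^ (r + 1) < n := (le_max_left _ _).trans_lt (hn₀.trans hn1')
  have hn3 : 2 * (r + 1) / ε < n := (le_max_right _ _).trans_lt (hn₀.trans hn1')
  set d : V → ℕ := fun v => (univ.filter (G.Adj v)).card with hd
  have h1 : ∑ v, (d v).choose (r + 1) ≤ (r + 1) * (Fintype.card V).choose (r + 1) := by
    rw [hd, sum_choose_degree]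
    refine (sum_le_card_nsmul _ _ (r + 1) ?_).trans ?_
    · intro A hA
      have := hcon A (univ.filter fun v => ∀ a ∈ A, G.Adj v a) (mem_powersetCard.mp hA).2
      by_contra hlt
      obtain ⟨a, ha, b, hb, hab⟩ := this (by omega)
      exact hab ((mem_filter.mp hb).2 a ha).symm
    · rw [card_powersetCard, card_univ, smul_eq_mul, mul_comm]
  have h2 : ∑ v, ((d v + 1 - (r + 1) : ℕ) : ℝ) ^ (r + 1) ≤ (r + 1) * n ^ (r + 1) := by
    have hf : (0 : ℝ) < (r + 1).factorial := by exact_mod_cast Nat.factorial_pos _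
    have h3 : ∑ v, ((d v + 1 - (r + 1) : ℕ) : ℝ) ^ (r + 1) / (r + 1).factorial ≤
        (r + 1) * (n ^ (r + 1) / (r + 1).factorial) := by
      calc _ ≤ ∑ v, ((d v).choose (r + 1) : ℝ) := sum_le_sum fun v _ => Nat.pow_le_choose _ _
        _ ≤ (r + 1) * ((Fintype.card V).choose (r + 1) : ℝ) := by exact_mod_cast h1
        _ ≤ _ := by gcongr; exact Nat.choose_le_pow_div _ _
    rw [← sum_div, ← mul_div_assoc] at h3
    exact (div_le_div_iff_of_pos_right hf).mp h3
  have h4 : ε / 2 * n ^ 2 ≤ ∑ v, ((d v + 1 - (r + 1) : ℕ) : ℝ) := by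
    have h5 : ∑ v, ((d v : ℝ) - (r + 1)) ≤ ∑ v, ((d v + 1 - (r + 1) : ℕ) : ℝ) := by
      refine sum_le_sum fun v _ => ?_
      rw [sub_le_iff_le_add]
      exact_mod_cast (by omega : d v ≤ d v + 1 - (r + 1) + (r + 1))
    rw [sum_sub_distrib, sum_const, card_univ, nsmul_eq_mul] at h5
    have h6 : (adjPairs G univ : ℝ) = ∑ v, (d v : ℝ) := by
      simp [adjPairs, hd]
    have h7 : 2 * (r + 1) < n * ε := (div_lt_iff₀ hε).mp hn3
    rw [h6] at hG
    clear hn2 hn3 hn₀ h2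
    nlinarith
  have h5 := pow_sum_div_card_le_sum_pow (s := (univ : Finset V))
    (f := fun v => ((d v + 1 - (r + 1) : ℕ) : ℝ)) (fun _ _ => by positivity) r
  rw [card_univ] at h5
  have h6 : (ε / 2 * n ^ 2) ^ (r + 1) / n ^ r ≤ (r + 1) * n ^ (r + 1) := by
    refine le_trans ?_ (h5.trans h2)
    gcongr
  rw [div_le_iff₀ (by positivity)] at h6
  have h7 : (r + 1) < n * (ε / 2) ^ (r + 1) := (div_lt_iff₀ (by positivity)).mp hn2
  have h8 : (r + 1) * (n ^ (r + 1) * n ^ r) < n * (ε / 2) ^ (r + 1) * (n ^ (r + 1) * n ^ r) := by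
    gcongr
  have h9 : n * (ε / 2) ^ (r + 1) * (n ^ (r + 1) * n ^ r) = (ε / 2 * n ^ 2) ^ (r + 1) := by
    rw [mul_pow, ← pow_mul]; ring
  exact absurd h6 (not_le.mpr (by rw [← h9, mul_assoc]; exact h8))

theorem exists_densePair_of_dense (r : ℕ) {ε : ℝ} (hε : 0 < ε) :
    ∃ n₀ : ℕ, ∀ (V : Type) [Fintype V] (G : SimpleGraph V), n₀ ≤ Fintype.card V →
      ε * (Fintype.card V : ℝ) ^ 2 ≤ adjPairs G univ →
      ∃ A B : Finset V, DensePair G A B (r + 1) ∧ ∃ a ∈ A, ∃ b ∈ B, G.Adj a b := by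
  obtain ⟨n₀, h⟩ := exists_complete_pair_of_dense r hε
  refine ⟨n₀, fun V _ G hn hG => ?_⟩
  obtain ⟨A, B, hA, hB, hAB⟩ := h V G hn hG
  refine ⟨A, B, ⟨?_, ?_, ?_⟩, ?_⟩
  · rw [Finset.disjoint_left]
    exact fun v hv hv' => (hAB v hv v hv').ne rfl
  · intro a ha a' ha'
    rwa [filter_true_of_mem fun b hb => ⟨hAB a ha b hb, hAB a' ha' b hb⟩]
  · intro b hb b' hb'
    rw [filter_true_of_mem fun a ha => ⟨(hAB a ha b hb).symm, (hAB a ha b' hb').symm⟩, hA]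
  · obtain ⟨a, ha⟩ : A.Nonempty := card_pos.mp (by omega)
    obtain ⟨b, hb⟩ : B.Nonempty := card_pos.mp (by omega)
    exact ⟨a, ha, b, hb, hAB a ha b hb⟩

end Counting

/-- The graph formed by the edges of `G` that lie in a triangle. -/
def triangleEdges (G : SimpleGraph V) : SimpleGraph V where
  Adj x y := G.Adj x y ∧ ∃ z, G.Adj z x ∧ G.Adj z y
  symm := ⟨fun _ _ ⟨h, z, h1, h2⟩ => ⟨h.symm, z, h2, h1⟩⟩
  loopless := ⟨fun _ h => h.1.ne rfl⟩

theorem triangleEdges_le (G : SimpleGraph V) : triangleEdges G ≤ G := fun _ _ h => h.1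

theorem hasCycleAvoiding_three {a b c : V} (hab : G.Adj a b) (hac : G.Adj a c)
    (hbc : G.Adj b c) : HasCycleAvoiding G 3 ∅ :=
  hasCycleAvoiding_of_isPath (.cons hab (.cons hbc .nil))
    (by simp [SimpleGraph.Walk.cons_isPath_iff, hab.ne, hac.ne, hbc.ne]) hac.symm (by simp)

theorem cliqueFree_sdiff_triangleEdges (G : SimpleGraph V) :
    (G \ triangleEdges G).CliqueFree 3 := by
  intro T hT
  rw [SimpleGraph.is3Clique_iff] at hT
  obtain ⟨a, b, c, hab, hac, hbc, rfl⟩ := hT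
  exact hab.2 ⟨hab.1, c, hac.1.symm, hbc.1.symm⟩

theorem adjPairs_le_sdiff_add (G H : SimpleGraph V) (W : Finset V) :
    adjPairs G W ≤ adjPairs (G \ H) W + adjPairs H W := by
  unfold adjPairs
  rw [← sum_add_distrib]
  refine sum_le_sum fun v _ => ?_
  refine (card_le_card ?_).trans (card_union_le _ _)
  intro x hx
  by_cases h : H.Adj v x <;> simp_all

section Triangles

variable [Fintype V]

theorem card_triangles_through_le (G : SimpleGraph V) (v : V) :
    ((G.cliqueFinset 3).filter (v ∈ ·)).card ≤ adjPairs G (univ.filter (G.Adj v)) := by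
  have hsub : (G.cliqueFinset 3).filter (v ∈ ·) ⊆
      ((univ.filter (G.Adj v)).sigma fun x => (univ.filter (G.Adj v)).filter (G.Adj x)).image
        fun p => {v, p.1, p.2} := by
    intro T hT
    rw [mem_filter, SimpleGraph.mem_cliqueFinset_iff] at hT
    obtain ⟨hT, hv⟩ := hT
    have hc : (T.erase v).card = 2 := by rw [card_erase_of_mem hv, hT.2]
    obtain ⟨x, y, hxy, hTe⟩ := card_eq_two.mp hc
    have hT' : T = {v, x, y} := by rw [← insert_erase hv, hTe]
    rw [hT', SimpleGraph.is3Clique_triple_iff] at hT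
    rw [mem_image]
    exact ⟨⟨x, y⟩, by simp [hT.1, hT.2.1, hT.2.2], hT'.symm⟩
  refine (card_le_card hsub).trans (card_image_le.trans ?_)
  rw [card_sigma, adjPairs]

theorem card_edges_through_le (G : SimpleGraph V) (v : V) :
    ((G.cliqueFinset 2).filter (v ∈ ·)).card ≤ (univ.filter (G.Adj v)).card := by
  have hsub : (G.cliqueFinset 2).filter (v ∈ ·) ⊆ (univ.filter (G.Adj v)).image
      fun x => {v, x} := by
    intro T hT
    rw [mem_filter, SimpleGraph.mem_cliqueFinset_iff] at hT
    obtain ⟨hT, hv⟩ := hT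
    have hc : (T.erase v).card = 1 := by rw [card_erase_of_mem hv, hT.2]
    obtain ⟨x, hTe⟩ := card_eq_one.mp hc
    have hx : x ∈ T.erase v := by simp [hTe]
    rw [mem_image]
    exact ⟨x, by simpa using hT.1 hv (mem_of_mem_erase hx) (ne_of_mem_erase hx).symm,
      by rw [← insert_erase hv, hTe]⟩
  exact (card_le_card hsub).trans card_image_le

theorem sum_card_cliques_through (G : SimpleGraph V) (r : ℕ) :
    ∑ v, ((G.cliqueFinset r).filter (v ∈ ·)).card = r * (G.cliqueFinset r).card := by
  have h := sum_card_bipartiteAbove_eq_sum_card_bipartiteBelow (s := (univ : Finset V))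
    (t := G.cliqueFinset r) (fun v T => v ∈ T)
  refine h.trans ?_
  rw [mul_comm, ← smul_eq_mul, ← sum_const]
  refine sum_congr rfl fun T hT => ?_
  rw [← (SimpleGraph.mem_cliqueFinset_iff.mp hT).2]
  congr 1
  ext v
  simp [bipartiteBelow]

theorem two_mul_card_edges_le (G : SimpleGraph V) :
    2 * (G.cliqueFinset 2).card ≤ adjPairs G univ := by
  rw [← sum_card_cliques_through, adjPairs]
  exact sum_le_sum fun v _ => card_edges_through_le G v

theorem adjPairs_neighbors_le {k : ℕ} (hk : 1 ≤ k)
    (hG : ¬ HasCycleAvoiding G (2 * k + 1) ∅) (v : V) :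
    adjPairs G (univ.filter (G.Adj v)) ≤ 4 * k * (univ.filter (G.Adj v)).card := by
  by_contra h
  exact hG (hasCycleAvoiding_of_adjPairs (v := v) hk (fun x hx => (mem_filter.mp hx).2)
    (notMem_empty v) (disjoint_empty_right _) (not_le.mp h))

theorem card_triangles_le {k : ℕ} (hk : 1 ≤ k)
    (hG : ¬ HasCycleAvoiding G (2 * k + 1) ∅) :
    (G.cliqueFinset 3).card ≤ 4 * k * adjPairs (triangleEdges G) univ := by
  have hT : ¬ HasCycleAvoiding (triangleEdges G) (2 * k + 1) ∅ :=
    fun h => hG (h.mono (triangleEdges_le G) Subset.rfl)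
  have hsub : G.cliqueFinset 3 ⊆ (triangleEdges G).cliqueFinset 3 := by
    intro T hT
    rw [SimpleGraph.mem_cliqueFinset_iff, SimpleGraph.is3Clique_iff] at hT ⊢
    obtain ⟨a, b, c, hab, hac, hbc, rfl⟩ := hT
    exact ⟨a, b, c, ⟨hab, c, hac.symm, hbc.symm⟩, ⟨hac, b, hab.symm, hbc⟩,
      ⟨hbc, a, hab, hac⟩, rfl⟩
  have h1 := sum_card_cliques_through (triangleEdges G) 3
  have h2 : ∑ v, (((triangleEdges G).cliqueFinset 3).filter (v ∈ ·)).card ≤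
      4 * k * adjPairs (triangleEdges G) univ := by
    rw [adjPairs, mul_sum]
    exact sum_le_sum fun v _ =>
      (card_triangles_through_le _ v).trans (adjPairs_neighbors_le hk hT v)
  have h3 := card_le_card hsub
  omega

theorem triangleEdges_sparse {k : ℕ} (hk : 1 ≤ k) {ε : ℝ} (hε : 0 < ε) :
    ∃ n₀ : ℕ, ∀ (V : Type) [Fintype V] (G : SimpleGraph V), n₀ ≤ Fintype.card V →
      ¬ HasCycleAvoiding G (2 * k + 1) ∅ →
      (adjPairs (triangleEdges G) univ : ℝ) ≤ ε * (Fintype.card V : ℝ) ^ 2 := by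
  obtain ⟨n₀, h⟩ := exists_densePair_of_dense (2 * k) hε
  refine ⟨n₀, fun V _ G hn hG => ?_⟩
  by_contra hlt
  obtain ⟨A, B, hAB, a, ha, b, hb, hab, z, hza, hzb⟩ := h V (triangleEdges G) hn (not_le.mp hlt).le
  rcases hk.eq_or_lt with rfl | hk
  · exact hG (hasCycleAvoiding_three hza hzb hab)
  · exact hG ((hAB.mono (triangleEdges_le G)).hasCycle_of_adj_both hk (Nat.lt_succ_self _)
      ha hb hza hzb)

theorem two_mul_adjPairs_le {D : ℕ}
    (hD : ∀ u v, G.Adj u v → (univ.filter (G.Adj u)).card + (univ.filter (G.Adj v)).card ≤ D) :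
    2 * adjPairs G univ ≤ Fintype.card V * D := by
  set d : V → ℕ := fun v => (univ.filter (G.Adj v)).card with hd
  have h1 : ∑ u, ∑ v ∈ univ.filter (G.Adj u), (d u + d v) ≤ D * adjPairs G univ := by
    rw [adjPairs, mul_sum]
    refine sum_le_sum fun u _ => ?_
    refine (sum_le_card_nsmul _ _ D fun v hv => hD u v (mem_filter.mp hv).2).trans ?_
    rw [smul_eq_mul, mul_comm]
  have h2 : ∑ u, ∑ v ∈ univ.filter (G.Adj u), d v = ∑ v, d v ^ 2 := by
    rw [sum_comm' (t' := univ) (s' := fun v => univ.filter (G.Adj v))]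
    · simp [hd, sq]
    · simp [SimpleGraph.adj_comm]
  have h3 : ∑ u, ∑ v ∈ univ.filter (G.Adj u), d u = ∑ v, d v ^ 2 := by
    simp [hd, sq]
  simp only [sum_add_distrib] at h1
  rw [h2, h3] at h1
  have h4 := sq_sum_le_card_mul_sum_sq (s := (univ : Finset V)) (f := d)
  have h5 : adjPairs G univ = ∑ v, d v := rfl
  rw [card_univ, ← h5] at h4
  rcases Nat.eq_zero_or_pos (adjPairs G univ) with h0 | hpos
  · simp [h0]
  · refine Nat.le_of_mul_le_mul_right ?_ hpos
    nlinarith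

theorem disjoint_neighbors (hG : G.CliqueFree 3) {u v : V} (huv : G.Adj u v) :
    Disjoint (univ.filter (G.Adj u)) (univ.filter (G.Adj v)) := by
  rw [Finset.disjoint_left]
  intro x hx hx'
  rw [mem_filter] at hx hx'
  exact hG {u, v, x} (SimpleGraph.is3Clique_triple_iff.mpr ⟨huv, hx.2, hx'.2⟩)

/-- Mantel's theorem. -/
theorem mantel (hG : G.CliqueFree 3) : 2 * adjPairs G univ ≤ Fintype.card V ^ 2 := by
  rw [sq]
  refine two_mul_adjPairs_le fun u v huv => ?_
  rw [← card_union_of_disjoint (disjoint_neighbors hG huv)]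
  exact card_le_univ _

theorem adjPairs_le_of_no_cycle {k : ℕ} (hk : 1 ≤ k) {ε : ℝ} (hε : 0 < ε) :
    ∃ n₀ : ℕ, ∀ (V : Type) [Fintype V] (G : SimpleGraph V), n₀ ≤ Fintype.card V →
      ¬ HasCycleAvoiding G (2 * k + 1) ∅ →
      (adjPairs G univ : ℝ) ≤ (1 / 2 + ε) * (Fintype.card V : ℝ) ^ 2 := by
  obtain ⟨n₀, h⟩ := triangleEdges_sparse hk hε
  refine ⟨n₀, fun V _ G hn hG => ?_⟩
  have h1 := h V G hn hG
  have h2 : (2 * adjPairs (G \ triangleEdges G) univ : ℝ) ≤ (Fintype.card V : ℝ) ^ 2 := by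
    exact_mod_cast mantel (cliqueFree_sdiff_triangleEdges G)
  have h3 : (adjPairs G univ : ℝ) ≤
      adjPairs (G \ triangleEdges G) univ + adjPairs (triangleEdges G) univ := by
    exact_mod_cast adjPairs_le_sdiff_add G (triangleEdges G) univ
  linarith

end Triangles

theorem card_filter_lt_le (s : Finset V) (f : V → ℕ) {c : ℝ} (hc : 0 < c)
    (hf : ((∑ v ∈ s, f v : ℕ) : ℝ) ≤ c ^ 2) : ((s.filter fun v => c < f v).card : ℝ) ≤ c := by
  refine le_of_mul_le_mul_right ?_ hc
  rw [← nsmul_eq_mul, ← sq]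
  refine (card_nsmul_le_sum _ (fun v => (f v : ℝ)) c fun v hv => (mem_filter.mp hv).2.le).trans ?_
  rw [Nat.cast_sum] at hf
  exact (sum_le_sum_of_subset_of_nonneg (filter_subset _ _) fun _ _ _ => Nat.cast_nonneg _).trans hf

theorem le_of_le_mul_of_add_le {n γ x y : ℝ} (hγn : 0 < γ * n) (hy : 0 ≤ y)
    (hxy : x + y ≤ n) (hp : (1 / 4 - γ ^ 2 / 2) * n ^ 2 ≤ x * y) : n / 2 - γ * n ≤ y := by
  by_contra hlt
  push Not at hlt
  have h1 : x * y ≤ (n - y) * y := mul_le_mul_of_nonneg_right (by linarith) hy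
  nlinarith

theorem le_card_common_neighbors {B B₀ : Finset V} (hB : B ⊆ B₀) {a a' : V} {c : ℝ}
    (ha : ((B₀.filter fun b => ¬ G.Adj a b).card : ℝ) ≤ c)
    (ha' : ((B₀.filter fun b => ¬ G.Adj a' b).card : ℝ) ≤ c) :
    (B.card : ℝ) - 2 * c ≤ (B.filter fun b => G.Adj a b ∧ G.Adj a' b).card := by
  have hsub : B ⊆ (B.filter fun b => G.Adj a b ∧ G.Adj a' b) ∪
      ((B₀.filter fun b => ¬ G.Adj a b) ∪ (B₀.filter fun b => ¬ G.Adj a' b)) := by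
    intro b hb
    have := hB hb
    by_cases h1 : G.Adj a b <;> by_cases h2 : G.Adj a' b <;> simp_all
  have h1 := (card_le_card hsub).trans ((card_union_le _ _).trans
    (Nat.add_le_add_left (card_union_le _ _) _))
  have h2 : (B.card : ℝ) ≤ (B.filter fun b => G.Adj a b ∧ G.Adj a' b).card +
      ((B₀.filter fun b => ¬ G.Adj a b).card + (B₀.filter fun b => ¬ G.Adj a' b).card) := by
    exact_mod_cast h1
  linarith

section Stability

variable [Fintype V]

theorem exists_adj_degree_sum (G : SimpleGraph V) {η : ℝ} (hη : η ≤ 1 / 2)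
    (h : (1 / 2 - η) * (Fintype.card V : ℝ) ^ 2 < adjPairs G univ) :
    ∃ u v, G.Adj u v ∧ (1 - 2 * η) * (Fintype.card V : ℝ) ≤
      ((univ.filter (G.Adj u)).card + (univ.filter (G.Adj v)).card : ℕ) := by
  by_contra hcon
  push Not at hcon
  have h1 := two_mul_adjPairs_le (G := G) (D := ⌊(1 - 2 * η) * (Fintype.card V : ℝ)⌋₊)
    fun u v huv => Nat.le_floor (hcon u v huv).le
  have h2 : (⌊(1 - 2 * η) * (Fintype.card V : ℝ)⌋₊ : ℝ) ≤ (1 - 2 * η) * (Fintype.card V : ℝ) :=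
    Nat.floor_le (mul_nonneg (by linarith) (Nat.cast_nonneg _))
  have h3 : (2 * adjPairs G univ : ℝ) ≤
      (Fintype.card V : ℝ) * (⌊(1 - 2 * η) * (Fintype.card V : ℝ)⌋₊ : ℝ) := by exact_mod_cast h1
  have h4 := mul_le_mul_of_nonneg_left h2 (Nat.cast_nonneg (α := ℝ) (Fintype.card V))
  nlinarith

theorem degree_add_nonneighbors_le (hG : G.CliqueFree 3) {u v a : V}
    (ha : G.Adj u a) :
    (univ.filter (G.Adj a)).card + ((univ.filter (G.Adj v)).filter fun b => ¬ G.Adj a b).card ≤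
      (univ.filter (G.Adj v)).card +
        ((univ.filter (G.Adj u)) ∪ (univ.filter (G.Adj v)))ᶜ.card := by
  have h1 : univ.filter (G.Adj a) ⊆ (univ.filter (G.Adj v)).filter (G.Adj a) ∪
      ((univ.filter (G.Adj u)) ∪ (univ.filter (G.Adj v)))ᶜ := by
    intro x hx
    have hxu : ¬ G.Adj u x := fun hux =>
      hG {u, a, x} (SimpleGraph.is3Clique_triple_iff.mpr ⟨ha, hux, (mem_filter.mp hx).2⟩)
    by_cases hxv : G.Adj v x <;> simp_all
  have h2 := (card_le_card h1).trans (card_union_le _ _)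
  have h3 := card_filter_add_card_filter_not (s := univ.filter (G.Adj v)) (G.Adj a)
  omega

/-- Stability for Mantel's theorem: a triangle-free graph with nearly `n² / 4` edges is a dense
bipartite pair up to few vertices. -/
theorem exists_densePair_of_triangleFree (hG : G.CliqueFree 3) {γ : ℝ} (hγ : 0 < γ)
    (hγ' : γ ≤ 1 / 16) (hV : 0 < Fintype.card V)
    (h : (1 / 2 - γ ^ 2 / 5) * (Fintype.card V : ℝ) ^ 2 < adjPairs G univ)
    {M : ℕ} (hM : 4 * M ≤ Fintype.card V) :
    ∃ A B : Finset V, DensePair G A B M ∧ ((A ∪ B)ᶜ.card : ℝ) ≤ 3 * γ * Fintype.card V := by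
  obtain ⟨u, v, huv, hdeg⟩ := exists_adj_degree_sum G (by nlinarith) h
  set n : ℝ := (Fintype.card V : ℝ) with hn
  have hn0 : 0 < n := by rw [hn]; exact_mod_cast hV
  have hMn : 4 * (M : ℝ) ≤ n := by rw [hn]; exact_mod_cast hM
  set A₀ := univ.filter (G.Adj u) with hA₀
  set B₀ := univ.filter (G.Adj v) with hB₀
  have hdis : Disjoint A₀ B₀ := disjoint_neighbors hG huv
  set R := (A₀ ∪ B₀)ᶜ with hR
  have hcard : A₀.card + B₀.card + R.card = Fintype.card V := by
    rw [← card_union_of_disjoint hdis, hR, card_add_card_compl]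
  have hcardR : (A₀.card : ℝ) + B₀.card + R.card = n := by rw [hn]; exact_mod_cast hcard
  push_cast at hdeg
  have hRle : (R.card : ℝ) ≤ 2 * (γ ^ 2 / 5) * n := by linarith
  set f : V → ℕ := fun a => (B₀.filter fun b => ¬ G.Adj a b).card with hf
  set g : V → ℕ := fun b => (A₀.filter fun a => ¬ G.Adj b a).card with hg
  have hsumA : ∑ a ∈ A₀, (univ.filter (G.Adj a)).card + ∑ a ∈ A₀, f a ≤
      A₀.card * (B₀.card + R.card) := by
    rw [← sum_add_distrib, ← smul_eq_mul]
    exact sum_le_card_nsmul _ _ _ fun a ha =>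
      degree_add_nonneighbors_le hG (mem_filter.mp ha).2
  have hsumB : ∑ b ∈ B₀, (univ.filter (G.Adj b)).card + ∑ b ∈ B₀, g b ≤
      B₀.card * (A₀.card + R.card) := by
    rw [← sum_add_distrib, ← smul_eq_mul]
    refine sum_le_card_nsmul _ _ _ fun b hb => ?_
    have := degree_add_nonneighbors_le hG (u := v) (v := u) (mem_filter.mp hb).2
    rwa [union_comm] at this
  have hsumR : ∑ r ∈ R, (univ.filter (G.Adj r)).card ≤ R.card * Fintype.card V := by
    rw [← smul_eq_mul]
    exact sum_le_card_nsmul _ _ _ fun r _ => card_le_univ _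
  have hsum : adjPairs G univ = ∑ a ∈ A₀, (univ.filter (G.Adj a)).card +
      ∑ b ∈ B₀, (univ.filter (G.Adj b)).card + ∑ r ∈ R, (univ.filter (G.Adj r)).card := by
    rw [← sum_union hdis, hR, sum_add_sum_compl, adjPairs]
  have hkey : (adjPairs G univ : ℝ) + (∑ a ∈ A₀, f a : ℕ) + (∑ b ∈ B₀, g b : ℕ) ≤
      2 * (A₀.card * B₀.card) + 2 * (R.card * n) := by
    have h1 : adjPairs G univ + ∑ a ∈ A₀, f a + ∑ b ∈ B₀, g b ≤
        A₀.card * (B₀.card + R.card) + B₀.card * (A₀.card + R.card) +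
          R.card * Fintype.card V := by omega
    have h2 : (adjPairs G univ : ℝ) + (∑ a ∈ A₀, f a : ℕ) + (∑ b ∈ B₀, g b : ℕ) ≤
        A₀.card * (B₀.card + R.card) + B₀.card * (A₀.card + R.card) + R.card * n := by
      rw [hn]; exact_mod_cast h1
    have h3 : (0 : ℝ) ≤ R.card := Nat.cast_nonneg _
    have h4 : (R.card : ℝ) * (A₀.card + B₀.card) ≤ R.card * n :=
      mul_le_mul_of_nonneg_left (by linarith) h3
    linarith
  have hRn : (R.card : ℝ) * n ≤ 2 * (γ ^ 2 / 5) * n * n := mul_le_mul_of_nonneg_right hRle hn0.le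
  have hAB : (A₀.card : ℝ) + B₀.card ≤ n := by
    have : (0 : ℝ) ≤ R.card := Nat.cast_nonneg _
    linarith
  have hA0 : (0 : ℝ) ≤ A₀.card := Nat.cast_nonneg _
  have hB0 : (0 : ℝ) ≤ B₀.card := Nat.cast_nonneg _
  have hf0 : (0 : ℝ) ≤ (∑ a ∈ A₀, f a : ℕ) := Nat.cast_nonneg _
  have hg0 : (0 : ℝ) ≤ (∑ b ∈ B₀, g b : ℕ) := Nat.cast_nonneg _
  have hprod : 4 * ((A₀.card : ℝ) * B₀.card) ≤ n ^ 2 := by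
    nlinarith [sq_nonneg ((A₀.card : ℝ) - B₀.card)]
  have hfle : ((∑ a ∈ A₀, f a : ℕ) : ℝ) ≤ γ ^ 2 * n ^ 2 := by linarith
  have hgle : ((∑ b ∈ B₀, g b : ℕ) : ℝ) ≤ γ ^ 2 * n ^ 2 := by linarith
  have hprod' : (1 / 4 - γ ^ 2 / 2) * n ^ 2 ≤ (A₀.card : ℝ) * B₀.card := by linarith
  have hγn : 0 < γ * n := mul_pos hγ hn0
  have hBbig := le_of_le_mul_of_add_le hγn hB0 hAB hprod'
  have hAbig := le_of_le_mul_of_add_le hγn hA0 (by rwa [add_comm]) (by rwa [mul_comm (B₀.card : ℝ)])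
  have hAbad : ((A₀.filter fun a => γ * n < f a).card : ℝ) ≤ γ * n :=
    card_filter_lt_le A₀ f hγn (by rwa [mul_pow])
  have hBbad : ((B₀.filter fun b => γ * n < g b).card : ℝ) ≤ γ * n :=
    card_filter_lt_le B₀ g hγn (by rwa [mul_pow])
  set A := A₀.filter fun a => ¬ γ * n < f a with hA
  set B := B₀.filter fun b => ¬ γ * n < g b with hB
  have hAc : (A.card : ℝ) = A₀.card - (A₀.filter fun a => γ * n < f a).card := by
    rw [eq_sub_iff_add_eq, add_comm]
    exact_mod_cast card_filter_add_card_filter_not (s := A₀) fun a => γ * n < f a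
  have hBc : (B.card : ℝ) = B₀.card - (B₀.filter fun b => γ * n < g b).card := by
    rw [eq_sub_iff_add_eq, add_comm]
    exact_mod_cast card_filter_add_card_filter_not (s := B₀) fun b => γ * n < g b
  have hABd : Disjoint A B := disjoint_of_subset_left (filter_subset _ _)
    (disjoint_of_subset_right (filter_subset _ _) hdis)
  have hγn' : γ * n ≤ 1 / 16 * n := mul_le_mul_of_nonneg_right hγ' hn0.le
  refine ⟨A, B, ⟨hABd, fun a ha a' ha' => ?_, fun b hb b' hb' => ?_⟩, ?_⟩
  · have := le_card_common_neighbors (G := G) (filter_subset _ _ : B ⊆ B₀)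
      (not_lt.mp (mem_filter.mp ha).2) (not_lt.mp (mem_filter.mp ha').2)
    have h2 : (M : ℝ) ≤ (B.filter fun b => G.Adj a b ∧ G.Adj a' b).card := by linarith
    exact_mod_cast h2
  · have := le_card_common_neighbors (G := G) (filter_subset _ _ : A ⊆ A₀)
      (not_lt.mp (mem_filter.mp hb).2) (not_lt.mp (mem_filter.mp hb').2)
    have h2 : (M : ℝ) ≤ (A.filter fun a => G.Adj b a ∧ G.Adj b' a).card := by linarith
    exact_mod_cast h2
  · have h1 : ((A ∪ B)ᶜ.card : ℝ) = n - (A.card + B.card) := by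
      rw [eq_sub_iff_add_eq, add_comm, hn]
      have := card_add_card_compl (A ∪ B)
      rw [card_union_of_disjoint hABd] at this
      exact_mod_cast this
    have h2 : γ ^ 2 * n ≤ γ * n := mul_le_mul_of_nonneg_right (by nlinarith) hn0.le
    rw [h1, hAc, hBc]
    linarith

end Stability

theorem DensePair.not_adj_of_two_le {A B : Finset V} {M k : ℕ} (h : DensePair G A B M)
    (hk : 2 ≤ k) (hM : 2 * k < M) (hG : ¬ HasCycleAvoiding G (2 * k + 1) ∅) {v v' : V}
    (hv : 2 ≤ (B.filter (G.Adj v)).card) (hv' : 2 ≤ (B.filter (G.Adj v')).card) :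
    ¬ G.Adj v v' := by
  intro hadj
  have hout : ∀ x, 2 ≤ (B.filter (G.Adj x)).card → x ∉ B := by
    intro x hx hxB
    obtain ⟨b, hb⟩ := card_pos.mp (show 0 < (B.filter (G.Adj x)).card by omega)
    obtain ⟨a, ha, hxa, -⟩ := h.symm.exists_left hxB hxB (X := ∅) (by rw [card_empty]; omega)
    rw [mem_filter] at hb
    exact hG (h.hasCycle_of_adj_both hk hM ha hb.1 hxa hb.2)
  obtain ⟨b, hb⟩ := card_pos.mp (show 0 < (B.filter (G.Adj v)).card by omega)
  obtain ⟨b', hb', hne⟩ := exists_mem_ne (show 1 < (B.filter (G.Adj v')).card by omega) b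
  rw [mem_filter] at hb hb'
  exact hG (h.hasCycle_of_adj hk hM (hout v hv) (hout v' hv') hb.1 hb'.1 hne.symm hadj hb.2 hb'.2)

section EdgesAndTriangles

variable [Fintype V]

theorem card_cliques_le_add (G : SimpleGraph V) (r : ℕ) (S : Finset V) :
    (G.cliqueFinset r).card ≤ ((G.cliqueFinset r).filter (Disjoint · S)).card +
      ∑ v ∈ S, ((G.cliqueFinset r).filter (v ∈ ·)).card := by
  have hsub : G.cliqueFinset r ⊆ (G.cliqueFinset r).filter (Disjoint · S) ∪
      S.biUnion fun v => (G.cliqueFinset r).filter (v ∈ ·) := by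
    intro T hT
    rw [mem_union, mem_filter, mem_biUnion]
    by_cases hd : Disjoint T S
    · exact Or.inl ⟨hT, hd⟩
    · obtain ⟨x, hx, hx'⟩ := not_disjoint_iff.mp hd
      exact Or.inr ⟨x, hx', mem_filter.mpr ⟨hT, hx⟩⟩
  exact (card_le_card hsub).trans ((card_union_le _ _).trans
    (Nat.add_le_add_left card_biUnion_le _))

theorem degree_le_card_compl_add (G : SimpleGraph V) (A B : Finset V) (r : V) :
    (univ.filter (G.Adj r)).card ≤
      (A ∪ B)ᶜ.card + ((B.filter (G.Adj r)).card + (A.filter (G.Adj r)).card) := by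
  have hsub : univ.filter (G.Adj r) ⊆
      (A ∪ B)ᶜ ∪ (B.filter (G.Adj r) ∪ A.filter (G.Adj r)) := by
    intro x hx
    have hadj := (mem_filter.mp hx).2
    by_cases hxA : x ∈ A <;> by_cases hxB : x ∈ B <;> simp [hadj, hxA, hxB]
  exact (card_le_card hsub).trans ((card_union_le _ _).trans
    (Nat.add_le_add_left (card_union_le _ _) _))

theorem DensePair.edges_add_triangles_le {A B : Finset V} {M k : ℕ} (h : DensePair G A B M)
    (hk : 2 ≤ k) (hM : 2 * k < M) (hG : ¬ HasCycleAvoiding G (2 * k + 1) ∅)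
    (hrest : 4 * ((4 * k + 1) * ((A ∪ B)ᶜ.card + 2)) ≤ Fintype.card V) :
    4 * ((G.cliqueFinset 2).card + (G.cliqueFinset 3).card) ≤ Fintype.card V ^ 2 := by
  set P := univ.filter fun v => 2 ≤ (B.filter (G.Adj v)).card with hP
  set Q := univ.filter fun v => 2 ≤ (A.filter (G.Adj v)).card with hQ
  have hPind : ∀ v ∈ P, ∀ v' ∈ P, ¬ G.Adj v v' := fun v hv v' hv' =>
    h.not_adj_of_two_le hk hM hG (mem_filter.mp hv).2 (mem_filter.mp hv').2
  have hQind : ∀ v ∈ Q, ∀ v' ∈ Q, ¬ G.Adj v v' := fun v hv v' hv' =>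
    h.symm.not_adj_of_two_le hk hM hG (mem_filter.mp hv).2 (mem_filter.mp hv').2
  have hPQ : Disjoint P Q := by
    rw [Finset.disjoint_left]
    intro v hv hv'
    obtain ⟨b, hb⟩ := card_pos.mp (zero_lt_two.trans_le (mem_filter.mp hv).2)
    obtain ⟨a, ha⟩ := card_pos.mp (zero_lt_two.trans_le (mem_filter.mp hv').2)
    rw [mem_filter] at ha hb
    exact hG (h.hasCycle_of_adj_both hk hM ha.1 hb.1 ha.2 hb.2)
  set R := (P ∪ Q)ᶜ with hR
  have hside : ∀ v, v ∉ R → v ∈ P ∨ v ∈ Q := by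
    intro v hv
    rwa [hR, mem_compl, not_not, mem_union] at hv
  have hcard : P.card + Q.card + R.card = Fintype.card V := by
    rw [← card_union_of_disjoint hPQ, hR, card_add_card_compl]
  have hdeg : ∀ r ∈ R, (univ.filter (G.Adj r)).card ≤ (A ∪ B)ᶜ.card + 2 := by
    intro r hr
    have hr' : (B.filter (G.Adj r)).card ≤ 1 ∧ (A.filter (G.Adj r)).card ≤ 1 := by
      rw [hR, mem_compl, mem_union, not_or, hP, hQ, mem_filter, mem_filter] at hr
      constructor
      · by_contra hlt
        exact hr.1 ⟨mem_univ _, by omega⟩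
      · by_contra hlt
        exact hr.2 ⟨mem_univ _, by omega⟩
    have := degree_le_card_compl_add G A B r
    omega
  have hedge : ((G.cliqueFinset 2).filter (Disjoint · R)).card ≤ P.card * Q.card := by
    rw [← card_product]
    refine le_trans (card_le_card ?_)
      (card_image_le (f := fun p : V × V => ({p.1, p.2} : Finset V)))
    intro T hT
    rw [mem_filter, SimpleGraph.mem_cliqueFinset_iff] at hT
    obtain ⟨⟨hclique, hT2⟩, hTR⟩ := hT
    obtain ⟨x, y, hxy, rfl⟩ := card_eq_two.mp hT2
    have hadj : G.Adj x y := hclique (by simp) (by simp) hxy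
    have hx := hside x (Finset.disjoint_left.mp hTR (by simp))
    have hy := hside y (Finset.disjoint_left.mp hTR (by simp))
    rw [mem_image]
    rcases hx with hx | hx <;> rcases hy with hy | hy
    · exact absurd hadj (hPind x hx y hy)
    · exact ⟨(x, y), mem_product.mpr ⟨hx, hy⟩, rfl⟩
    · exact ⟨(y, x), mem_product.mpr ⟨hy, hx⟩, pair_comm _ _⟩
    · exact absurd hadj (hQind x hx y hy)
  have htri : (G.cliqueFinset 3).filter (Disjoint · R) = ∅ := by
    rw [filter_eq_empty_iff]
    intro T hT hTR
    rw [SimpleGraph.mem_cliqueFinset_iff, SimpleGraph.is3Clique_iff] at hT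
    obtain ⟨x, y, z, hxy, hxz, hyz, rfl⟩ := hT
    have hx := hside x (Finset.disjoint_left.mp hTR (by simp))
    have hy := hside y (Finset.disjoint_left.mp hTR (by simp))
    have hz := hside z (Finset.disjoint_left.mp hTR (by simp))
    rcases hx with hx | hx <;> rcases hy with hy | hy <;> rcases hz with hz | hz
    · exact hPind x hx y hy hxy
    · exact hPind x hx y hy hxy
    · exact hPind x hx z hz hxz
    · exact hQind y hy z hz hyz
    · exact hPind y hy z hz hyz
    · exact hQind x hx z hz hxz
    · exact hQind x hx y hy hxy
    · exact hQind x hx y hy hxy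
  set c := (4 * k + 1) * ((A ∪ B)ᶜ.card + 2) with hc
  have hthrough : ∑ v ∈ R, ((G.cliqueFinset 2).filter (v ∈ ·)).card +
      ∑ v ∈ R, ((G.cliqueFinset 3).filter (v ∈ ·)).card ≤ R.card * c := by
    rw [← sum_add_distrib, ← smul_eq_mul]
    refine sum_le_card_nsmul _ _ _ fun v hv => ?_
    have h1 := card_edges_through_le G v
    have h2 := (card_triangles_through_le G v).trans (adjPairs_neighbors_le (by omega) hG v)
    calc _ ≤ (4 * k + 1) * (univ.filter (G.Adj v)).card := by linarith
      _ ≤ c := Nat.mul_le_mul_left _ (hdeg v hv)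
  have h2 := card_cliques_le_add G 2 R
  have h3 := card_cliques_le_add G 3 R
  rw [htri, card_empty] at h3
  have h4 : (G.cliqueFinset 2).card + (G.cliqueFinset 3).card ≤ P.card * Q.card + R.card * c := by
    omega
  have h5 : R.card * (4 * c) ≤ R.card * Fintype.card V := Nat.mul_le_mul_left _ hrest
  rw [← hcard] at h5 ⊢
  zify at h4 h5 ⊢
  have h6 : (0 : ℤ) ≤ P.card := Int.natCast_nonneg _
  have h7 : (0 : ℤ) ≤ Q.card := Int.natCast_nonneg _
  have h8 : (0 : ℤ) ≤ R.card := Int.natCast_nonneg _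
  nlinarith [sq_nonneg ((P.card : ℤ) - Q.card), mul_nonneg h6 h8, mul_nonneg h7 h8]

/-- A large graph on `n` vertices without `C_{2k+1}` has at most `⌊n² / 4⌋` edges and triangles
in total. -/
theorem edges_add_triangles_le {k : ℕ} (hk : 1 ≤ k) :
    ∃ n₀ : ℕ, ∀ (V : Type) [Fintype V] (G : SimpleGraph V), n₀ ≤ Fintype.card V →
      ¬ HasCycleAvoiding G (2 * k + 1) ∅ →
      4 * ((G.cliqueFinset 2).card + (G.cliqueFinset 3).card) ≤ Fintype.card V ^ 2 := by
  rcases hk.eq_or_lt with rfl | hk2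
  · refine ⟨0, fun V _ G _ hG => ?_⟩
    have hfree : G.CliqueFree 3 := by
      intro T hT
      rw [SimpleGraph.is3Clique_iff] at hT
      obtain ⟨a, b, c, hab, hac, hbc, -⟩ := hT
      exact hG (hasCycleAvoiding_three hab hac hbc)
    rw [SimpleGraph.cliqueFinset_eq_empty_iff.mpr hfree, card_empty]
    have := two_mul_card_edges_le G
    have := mantel hfree
    omega
  · have hkR : (2 : ℝ) ≤ k := by exact_mod_cast hk2
    obtain ⟨γ, hγdef⟩ : ∃ γ : ℝ, γ = 1 / (24 * (4 * k + 1)) := ⟨_, rfl⟩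
    have hγ : 0 < γ := by rw [hγdef]; positivity
    have hγk : 24 * (4 * (k : ℝ) + 1) * γ = 1 := by
      rw [hγdef, mul_one_div_cancel (by positivity)]
    have hγ' : γ ≤ 1 / 16 := by nlinarith
    obtain ⟨ε, hεdef⟩ : ∃ ε : ℝ, ε = γ ^ 2 / 5 / (8 * k + 1) := ⟨_, rfl⟩
    have hε : 0 < ε := by rw [hεdef]; positivity
    have hεk : (8 * (k : ℝ) + 1) * ε = γ ^ 2 / 5 := by
      rw [hεdef, mul_div_cancel₀ _ (by positivity)]
    obtain ⟨n₀, hn₀⟩ := triangleEdges_sparse hk hε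
    refine ⟨n₀ + 16 * (4 * k + 1), fun V _ G hn hG => ?_⟩
    by_contra hcon
    have h1 := hn₀ V G (by omega) hG
    have h2 := card_triangles_le hk hG
    have h3 := two_mul_card_edges_le G
    have h4 := adjPairs_le_sdiff_add G (triangleEdges G) univ
    have h5 : Fintype.card V ^ 2 < 2 * (adjPairs (G \ triangleEdges G) univ +
        (8 * k + 1) * adjPairs (triangleEdges G) univ) := by nlinarith
    have h6 : (Fintype.card V : ℝ) ^ 2 < 2 * (adjPairs (G \ triangleEdges G) univ +
        (8 * k + 1) * adjPairs (triangleEdges G) univ) := by exact_mod_cast h5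
    have h7 : (8 * (k : ℝ) + 1) * adjPairs (triangleEdges G) univ ≤
        γ ^ 2 / 5 * (Fintype.card V : ℝ) ^ 2 := by
      rw [← hεk, mul_assoc]
      exact mul_le_mul_of_nonneg_left h1 (by positivity)
    obtain ⟨A, B, hAB, hrest⟩ := exists_densePair_of_triangleFree
      (cliqueFree_sdiff_triangleEdges G) hγ hγ' (by omega) (by linarith)
      (M := 2 * k + 1) (by omega)
    have h8 : 16 * (4 * (k : ℝ) + 1) ≤ Fintype.card V := by
      exact_mod_cast le_trans (Nat.le_add_left _ _) hn
    have h9 : 4 * ((4 * (k : ℝ) + 1) * ((A ∪ B)ᶜ.card + 2)) ≤ Fintype.card V := by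
      have h10 : (4 * (k : ℝ) + 1) * (A ∪ B)ᶜ.card ≤
          (4 * (k : ℝ) + 1) * (3 * γ * Fintype.card V) :=
        mul_le_mul_of_nonneg_left hrest (by positivity)
      have h11 : (4 * (k : ℝ) + 1) * (3 * γ * Fintype.card V) = Fintype.card V / 8 := by
        linear_combination (Fintype.card V / 8 : ℝ) * hγk
      linarith
    exact hcon ((hAB.mono sdiff_le).edges_add_triangles_le hk2 (Nat.lt_succ_self _) hG
      (by exact_mod_cast h9))

end EdgesAndTriangles

theorem HasCycleAvoiding.of_induce {m : ℕ} {L : Finset V}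
    (h : HasCycleAvoiding (G.induce {v | v ∉ L}) m ∅) : HasCycleAvoiding G m L := by
  obtain ⟨f, hf, -⟩ := h
  exact ⟨fun i => f i, ⟨Subtype.val_injective.comp hf.1, fun i j hij => hf.2 hij⟩, fun i => (f i).2⟩

/-- Removing all edges meeting `S`. -/
def deleteVerts (G : SimpleGraph V) (S : Finset V) : SimpleGraph V where
  Adj x y := G.Adj x y ∧ x ∉ S ∧ y ∉ S
  symm := ⟨fun _ _ h => ⟨h.1.symm, h.2.2, h.2.1⟩⟩
  loopless := ⟨fun _ h => h.1.ne rfl⟩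

theorem not_hasCycleAvoiding_deleteVerts {m : ℕ} {S : Finset V} (hm : 3 ≤ m)
    (h : ¬ HasCycleAvoiding G m S) : ¬ HasCycleAvoiding (deleteVerts G S) m ∅ := by
  rintro ⟨f, hf, -⟩
  refine h ⟨f, ⟨hf.1, fun i j hij => (hf.2 hij).1⟩, fun i => ?_⟩
  obtain ⟨m, rfl⟩ : ∃ m', m = m' + 3 := ⟨m - 3, by omega⟩
  have hadj : (cycleGraph (m + 3)).Adj i (i + 1) := by
    rw [SimpleGraph.cycleGraph_adj]
    simp
  exact (hf.2 hadj).2.1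

section Decomposition

variable [Fintype V]

theorem card_cliques_inter_le (G : SimpleGraph V) (L : Finset V) (i r : ℕ) :
    ((G.cliqueFinset (i + r)).filter fun T => (T ∩ L).card = i).card ≤
      L.card.choose i * ((G.cliqueFinset r).filter (Disjoint · L)).card := by
  rw [← card_powersetCard, ← card_product]
  refine card_le_card_of_injOn (fun T => (T ∩ L, T \ L)) ?_ ?_
  · intro T hT
    rw [mem_coe, mem_filter, SimpleGraph.mem_cliqueFinset_iff] at hT
    obtain ⟨⟨hclique, hcard⟩, hi⟩ := hT
    rw [mem_coe, mem_product, mem_powersetCard, mem_filter, SimpleGraph.mem_cliqueFinset_iff]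
    refine ⟨⟨inter_subset_right, hi⟩, ⟨hclique.subset ?_, ?_⟩, sdiff_disjoint⟩
    · exact_mod_cast sdiff_subset
    · change (T \ L).card = r
      have := card_sdiff_add_card_inter T L
      omega
  · intro T _ T' _ h
    rw [Prod.mk.injEq] at h
    rw [← sdiff_union_inter T L, ← sdiff_union_inter T' L, h.1, h.2]

theorem card_singleton_cliques_le (G : SimpleGraph V) (L : Finset V) :
    ((G.cliqueFinset 1).filter (Disjoint · L)).card ≤ Fintype.card V - L.card := by
  rw [← card_compl, ← card_image_of_injective (f := fun x : V => ({x} : Finset V)) Lᶜ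
    singleton_injective]
  refine card_le_card fun T hT => ?_
  rw [mem_filter, SimpleGraph.mem_cliqueFinset_iff] at hT
  obtain ⟨x, rfl⟩ := card_eq_one.mp hT.1.2
  exact mem_image_of_mem _ (mem_compl.mpr (disjoint_singleton_left.mp hT.2))

theorem card_empty_cliques_le (G : SimpleGraph V) (L : Finset V) :
    ((G.cliqueFinset 0).filter (Disjoint · L)).card ≤ 1 := by
  rw [← card_singleton (∅ : Finset V)]
  refine card_le_card fun T hT => ?_
  rw [mem_filter, SimpleGraph.mem_cliqueFinset_iff] at hT
  rw [mem_singleton, card_eq_zero.mp hT.1.2]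

/-- Triangles classified by the size of their intersection with `L`. -/
theorem card_triangles_le_of_inter (G : SimpleGraph V) (L : Finset V) :
    (G.cliqueFinset 3).card ≤ ((G.cliqueFinset 3).filter (Disjoint · L)).card +
      L.card * ((G.cliqueFinset 2).filter (Disjoint · L)).card +
      (Fintype.card V - L.card) * L.card.choose 2 + L.card.choose 3 := by
  have hsplit : (G.cliqueFinset 3).card =
      ∑ i ∈ range 4, ((G.cliqueFinset 3).filter fun T => (T ∩ L).card = i).card := by
    refine card_eq_sum_card_fiberwise fun T hT => ?_
    rw [mem_coe, SimpleGraph.mem_cliqueFinset_iff] at hT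
    have := card_le_card (inter_subset_left (s₁ := T) (s₂ := L))
    rw [hT.2] at this
    rw [mem_coe, mem_range]
    omega
  have h0 := card_cliques_inter_le G L 0 3
  have h1 := card_cliques_inter_le G L 1 2
  have h2 := card_cliques_inter_le G L 2 1
  have h3 := card_cliques_inter_le G L 3 0
  have h2' := h2.trans (Nat.mul_le_mul_left _ (card_singleton_cliques_le G L))
  have h3' := h3.trans (Nat.mul_le_mul_left _ (card_empty_cliques_le G L))
  rw [mul_comm] at h2'
  rw [hsplit]
  simp only [sum_range_succ, range_zero, sum_empty, Nat.choose_zero_right, Nat.choose_one_right,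
    one_mul, mul_one, zero_add, Nat.reduceAdd, add_zero] at *
  omega

theorem card_cliques_disjoint_le (G : SimpleGraph V) (L : Finset V) (r : ℕ) :
    ((G.cliqueFinset r).filter (Disjoint · L)).card ≤
      ((G.induce {v | v ∉ L}).cliqueFinset r).card := by
  refine le_trans (card_le_card fun T hT => ?_) (card_image_le
    (f := fun S : Finset {v // v ∉ L} => S.map (Function.Embedding.subtype _)))
  rw [mem_filter, SimpleGraph.mem_cliqueFinset_iff] at hT
  obtain ⟨⟨hclique, hcard⟩, hTL⟩ := hT
  have hmap : (T.subtype (· ∉ L)).map (Function.Embedding.subtype _) = T :=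
    subtype_map_of_mem fun x hx => Finset.disjoint_left.mp hTL hx
  refine mem_image.mpr ⟨T.subtype (· ∉ L), ?_, hmap⟩
  rw [SimpleGraph.mem_cliqueFinset_iff]
  refine ⟨fun x hx y hy hxy => ?_, ?_⟩
  · exact hclique (mem_subtype.mp hx) (mem_subtype.mp hy) fun h => hxy (Subtype.ext h)
  · rw [← card_map, hmap, hcard]

theorem card_induce_compl (L : Finset V) :
    Fintype.card {v | v ∉ L} = Fintype.card V - L.card := by
  rw [← card_compl]
  exact Fintype.card_of_subtype _ fun x => mem_compl

theorem card_triangles_disjoint_le (G : SimpleGraph V) (S : Finset V) :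
    ((G.cliqueFinset 3).filter (Disjoint · S)).card ≤ ((deleteVerts G S).cliqueFinset 3).card := by
  refine card_le_card fun T hT => ?_
  rw [mem_filter, SimpleGraph.mem_cliqueFinset_iff] at hT
  rw [SimpleGraph.mem_cliqueFinset_iff]
  exact ⟨fun x hx y hy hxy => ⟨hT.1.1 hx hy hxy, Finset.disjoint_left.mp hT.2 hx,
    Finset.disjoint_left.mp hT.2 hy⟩, hT.1.2⟩

theorem adjPairs_le_sdiff_card (G : SimpleGraph V) (W S : Finset V) :
    adjPairs G W ≤ adjPairs G (W \ S) + 2 * (S.card * Fintype.card V) := by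
  induction S using Finset.induction_on with
  | empty => simp
  | insert a S ha ih =>
    have h := adjPairs_le_erase_add (G := G) (W \ S) a
    have h2 : ((W \ S).filter (G.Adj a)).card ≤ Fintype.card V := card_le_univ _
    rw [card_insert_of_notMem ha, sdiff_insert, add_mul, one_mul]
    omega

theorem adjPairs_sdiff_le_deleteVerts (G : SimpleGraph V) (S : Finset V) :
    adjPairs G (univ \ S) ≤ adjPairs (deleteVerts G S) univ := by
  unfold adjPairs
  refine (sum_le_sum fun v hv => card_le_card fun x hx => ?_).trans
    (sum_le_sum_of_subset (subset_univ _))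
  rw [mem_filter, mem_sdiff] at *
  exact ⟨mem_univ _, hx.2, hv.2, hx.1.2⟩

end Decomposition

section UpperBound

variable [Fintype V]

theorem packing_of_heavy {k : ℕ} (hk : 1 ≤ k) (j : ℕ) : ∀ L X : Finset V, L.card = j →
    Disjoint L X → (∀ v ∈ L, 4 * k * Fintype.card V +
      2 * ((X.card + (2 * k + 2) * j) * Fintype.card V) < adjPairs G (univ.filter (G.Adj v))) →
    Packing G (2 * k + 1) j X := by
  induction j with
  | zero => intro _ _ _ _ _; trivial
  | succ j ih =>
    intro L X hL hLX hheavy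
    obtain ⟨v, hv⟩ := card_pos.mp (show 0 < L.card by omega)
    have hcard : (L.erase v).card = j := by rw [card_erase_of_mem hv, hL, Nat.add_sub_cancel]
    set Y := X ∪ L.erase v with hY
    have hYcard : Y.card ≤ X.card + j := hcard ▸ card_union_le _ _
    have hvY : v ∉ Y := by
      rw [hY, mem_union, not_or]
      exact ⟨Finset.disjoint_left.mp hLX hv, notMem_erase v L⟩
    have hloss := adjPairs_le_sdiff_card G (univ.filter (G.Adj v)) Y
    have hY' : Y.card * Fintype.card V ≤ (X.card + (2 * k + 2) * (j + 1)) * Fintype.card V := by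
      refine Nat.mul_le_mul_right _ (hYcard.trans (Nat.add_le_add_left ?_ _))
      nlinarith
    have hW : 4 * k * (univ.filter (G.Adj v) \ Y).card ≤ 4 * k * Fintype.card V :=
      Nat.mul_le_mul_left _ (card_le_univ _)
    obtain ⟨f, hf, hfY⟩ := hasCycleAvoiding_of_adjPairs (G := G) (v := v) (X := Y)
      (W := univ.filter (G.Adj v) \ Y) hk (fun x hx => (mem_filter.mp (mem_sdiff.mp hx).1).2) hvY
      sdiff_disjoint (by have := hheavy v hv; omega)
    refine ⟨f, hf, fun i hi => hfY i (mem_union_left _ hi), ih (L.erase v) _ hcard ?_ ?_⟩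
    · rw [disjoint_union_right]
      refine ⟨disjoint_of_subset_left (erase_subset _ _) hLX, ?_⟩
      rw [Finset.disjoint_left]
      intro x hx hx'
      obtain ⟨i, -, rfl⟩ := mem_image.mp hx'
      exact hfY i (mem_union_right _ hx)
    · intro w hw
      refine lt_of_le_of_lt ?_ (hheavy w (mem_of_mem_erase hw))
      have h1 : (univ.image f).card ≤ 2 * k + 1 := card_image_le.trans (by simp)
      have h2 := card_union_le X (univ.image f)
      gcongr 4 * k * Fintype.card V + 2 * (?_ * _)
      nlinarith

theorem card_triangles_disjoint_le_add (G : SimpleGraph V) (L S : Finset V) :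
    ((G.cliqueFinset 3).filter (Disjoint · L)).card ≤
      ((G.cliqueFinset 3).filter (Disjoint · S)).card +
        ∑ v ∈ S \ L, ((G.cliqueFinset 3).filter (v ∈ ·)).card := by
  have hsub : (G.cliqueFinset 3).filter (Disjoint · L) ⊆ (G.cliqueFinset 3).filter (Disjoint · S) ∪
      (S \ L).biUnion fun v => (G.cliqueFinset 3).filter (v ∈ ·) := by
    intro T hT
    rw [mem_filter] at hT
    rw [mem_union, mem_filter, mem_biUnion]
    by_cases hd : Disjoint T S
    · exact Or.inl ⟨hT.1, hd⟩
    · obtain ⟨x, hx, hx'⟩ := not_disjoint_iff.mp hd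
      exact Or.inr ⟨x, mem_sdiff.mpr ⟨hx', Finset.disjoint_left.mp hT.2 hx⟩,
        mem_filter.mpr ⟨hT.1, hx⟩⟩
  exact (card_le_card hsub).trans ((card_union_le _ _).trans
    (Nat.add_le_add_left card_biUnion_le _))

theorem le_of_quadratic_margin {ℓ k s ε n t e a p q x : ℝ} (hℓ : 1 ≤ ℓ) (hk : 1 ≤ k) (hs : 0 ≤ s)
    (hε : 0 < ε) (hεk : 64 * (k * ℓ) * ε = 1) (hn : 8 * (ℓ * s + 2 * ℓ ^ 2 + ℓ ^ 3 + ℓ) ≤ n)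
    (ha : a ≤ ε * n ^ 2) (hp : p ≤ (1 / 2 + ε) * n ^ 2) (hx : x ≤ 1 / 32 * n ^ 2)
    (he : 2 * e ≤ p + 2 * (s * n)) (ht : t ≤ 4 * k * a + x + (ℓ - 1) * e + n * ℓ ^ 2 + ℓ ^ 3)
    (hq : (n - ℓ) ^ 2 < 4 * q + 4) : t ≤ ℓ * q := by
  have hn0 : 0 ≤ n := le_trans (by positivity) hn
  have h1 : 4 * k * a ≤ 1 / 16 * n ^ 2 := by
    have h2 : 4 * k * ε ≤ 1 / 16 := by
      nlinarith [mul_nonneg (mul_nonneg (zero_le_one.trans hk) hε.le) (sub_nonneg.mpr hℓ)]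
    calc 4 * k * a ≤ 4 * k * (ε * n ^ 2) := mul_le_mul_of_nonneg_left ha (by positivity)
      _ = (4 * k * ε) * n ^ 2 := by ring
      _ ≤ _ := mul_le_mul_of_nonneg_right h2 (by positivity)
  have h3 : (ℓ - 1) * e ≤ (ℓ - 1) * (n ^ 2 / 4) + 1 / 32 * n ^ 2 + ℓ * s * n := by
    have h4 : ℓ * ε ≤ 1 / 64 := by
      nlinarith [mul_nonneg (mul_nonneg (zero_le_one.trans hℓ) hε.le) (sub_nonneg.mpr hk)]
    have h5 : e ≤ n ^ 2 / 4 + ε / 2 * n ^ 2 + s * n := by linarith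
    have h6 := mul_le_mul_of_nonneg_left h5 (sub_nonneg.mpr hℓ)
    have h7 := mul_le_mul_of_nonneg_right h4 (sq_nonneg n)
    have h8 : 0 ≤ ε / 2 * n ^ 2 := by positivity
    have h9 : 0 ≤ s * n := by positivity
    linarith [sq_nonneg n]
  have h4 : ℓ * ((n - ℓ) ^ 2 / 4 - 1) ≤ ℓ * q :=
    mul_le_mul_of_nonneg_left (by linarith) (by positivity)
  have h5 := mul_le_mul_of_nonneg_right hn hn0
  have h6 : 1 ≤ n := by
    have : 0 ≤ ℓ * s + 2 * ℓ ^ 2 + ℓ ^ 3 := by positivity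
    linarith
  have h7 : ℓ ^ 3 + ℓ ≤ (ℓ ^ 3 + ℓ) * n := le_mul_of_one_le_right (by positivity) h6
  have h8 : 0 ≤ ℓ ^ 3 := by positivity
  have h9 : 0 ≤ ℓ ^ 2 * n := by positivity
  linarith

/-- If fewer than `ℓ` vertices have a dense neighbourhood, then the number of triangles is smaller
than the extremal value by a quadratic margin. -/
theorem card_triangles_le_of_few_heavy {ℓ k : ℕ} (hℓ : 1 ≤ ℓ) (hk : 1 ≤ k) :
    ∃ δ : ℝ, 0 < δ ∧ ∃ n₀ : ℕ, ∀ (V : Type) [Fintype V] (G : SimpleGraph V), n₀ ≤ Fintype.card V →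
      ¬ Packing G (2 * k + 1) (ℓ + 1) ∅ → ∀ L : Finset V, L.card < ℓ →
      (∀ v, v ∉ L → (adjPairs G (univ.filter (G.Adj v)) : ℝ) ≤ δ * (Fintype.card V : ℝ) ^ 2) →
      (G.cliqueFinset 3).card ≤ ℓ * ((Fintype.card V - ℓ) ^ 2 / 4) := by
  have hℓR : (1 : ℝ) ≤ ℓ := by exact_mod_cast hℓ
  have hkR : (1 : ℝ) ≤ k := by exact_mod_cast hk
  obtain ⟨s, hs⟩ : ∃ s, s = ℓ * (2 * k + 1) := ⟨_, rfl⟩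
  have hsR : (1 : ℝ) ≤ s := by
    rw [hs]; exact_mod_cast Nat.one_le_iff_ne_zero.mpr (by positivity)
  obtain ⟨δ, hδ, hδs⟩ : ∃ δ : ℝ, 0 < δ ∧ s * δ = 1 / 32 :=
    ⟨1 / 32 / s, by positivity, mul_div_cancel₀ _ (by positivity)⟩
  obtain ⟨ε, hε, hεk⟩ : ∃ ε : ℝ, 0 < ε ∧ (64 * (k * ℓ)) * ε = 1 :=
    ⟨1 / (64 * (k * ℓ)), by positivity, mul_div_cancel₀ _ (by positivity)⟩
  obtain ⟨n₁, hn₁⟩ := triangleEdges_sparse hk hε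
  obtain ⟨n₂, hn₂⟩ := adjPairs_le_of_no_cycle hk hε
  refine ⟨δ, hδ, n₁ + n₂ + 8 * (ℓ * s + 2 * ℓ ^ 2 + ℓ ^ 3 + ℓ), fun V _ G hn hG L hL hlight => ?_⟩
  obtain ⟨S, -, hScard, hS⟩ := exists_hitting_set hG
  rw [card_empty, zero_add, ← hs] at hScard
  have hfree := not_hasCycleAvoiding_deleteVerts (by omega) hS
  have htri := card_triangles_le_of_inter G L
  have hout := card_triangles_disjoint_le_add G L S
  have hout' := (card_triangles_disjoint_le G S).trans (card_triangles_le hk hfree)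
  have hpairs := (adjPairs_le_sdiff_card G univ S).trans
    (Nat.add_le_add_right (adjPairs_sdiff_le_deleteVerts G S) _)
  have hedge := (two_mul_card_edges_le G).trans hpairs
  have hsparse := hn₁ V (deleteVerts G S) (by omega) hfree
  have hdense := hn₂ V (deleteVerts G S) (by omega) hfree
  have hedge' : ((G.cliqueFinset 2).filter (Disjoint · L)).card ≤ (G.cliqueFinset 2).card :=
    card_le_card (filter_subset _ _)
  have hthrough : ((∑ v ∈ S \ L, ((G.cliqueFinset 3).filter (v ∈ ·)).card : ℕ) : ℝ) ≤
      1 / 32 * (Fintype.card V : ℝ) ^ 2 := by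
    push_cast
    refine (sum_le_card_nsmul _ _ (δ * (Fintype.card V : ℝ) ^ 2) fun v hv => ?_).trans ?_
    · exact le_trans (by exact_mod_cast card_triangles_through_le G v)
        (hlight v (mem_sdiff.mp hv).2)
    · rw [nsmul_eq_mul, ← hδs, mul_assoc]
      refine mul_le_mul_of_nonneg_right ?_ (by positivity)
      exact_mod_cast (card_le_card sdiff_subset).trans hScard
  have hc2 : (Fintype.card V - L.card) * L.card.choose 2 ≤ Fintype.card V * ℓ ^ 2 :=
    Nat.mul_le_mul (Nat.sub_le _ _) ((Nat.choose_le_pow _ _).trans (Nat.pow_le_pow_left hL.le _))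
  have hc3 : L.card.choose 3 ≤ ℓ ^ 3 :=
    (Nat.choose_le_pow _ _).trans (Nat.pow_le_pow_left hL.le _)
  have hLe : L.card * ((G.cliqueFinset 2).filter (Disjoint · L)).card ≤
      (ℓ - 1) * (G.cliqueFinset 2).card := Nat.mul_le_mul (by omega) hedge'
  have hSn : S.card * Fintype.card V ≤ s * Fintype.card V := Nat.mul_le_mul_right _ hScard
  have hdiv : (Fintype.card V - ℓ) ^ 2 < 4 * ((Fintype.card V - ℓ) ^ 2 / 4) + 4 := by omega
  have hnℓ : ℓ ≤ Fintype.card V := by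
    have : 8 * (ℓ * s + 2 * ℓ ^ 2 + ℓ ^ 3 + ℓ) ≤ Fintype.card V := by omega
    nlinarith
  have hn8 : 8 * ((ℓ : ℝ) * s + 2 * ℓ ^ 2 + ℓ ^ 3 + ℓ) ≤ Fintype.card V := by
    exact_mod_cast (by omega : 8 * (ℓ * s + 2 * ℓ ^ 2 + ℓ ^ 3 + ℓ) ≤ Fintype.card V)
  generalize (Fintype.card V - ℓ) ^ 2 / 4 = q at *
  rify [hnℓ] at hdiv
  have hLe' : ((L.card * ((G.cliqueFinset 2).filter (Disjoint · L)).card : ℕ) : ℝ) ≤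
      ((ℓ : ℝ) - 1) * (G.cliqueFinset 2).card := by
    refine le_trans (Nat.cast_le.mpr hLe) ?_
    push_cast [Nat.cast_sub hℓ]
    exact le_rfl
  have htriR : ((G.cliqueFinset 3).card : ℝ) ≤
      (4 * k * adjPairs (triangleEdges (deleteVerts G S)) univ : ℕ) +
      (∑ v ∈ S \ L, ((G.cliqueFinset 3).filter (v ∈ ·)).card : ℕ) +
      (L.card * ((G.cliqueFinset 2).filter (Disjoint · L)).card : ℕ) +
      (Fintype.card V * ℓ ^ 2 : ℕ) + (ℓ ^ 3 : ℕ) := by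
    exact_mod_cast (by omega)
  have hedgeR : 2 * ((G.cliqueFinset 2).card : ℝ) ≤ adjPairs (deleteVerts G S) univ +
      2 * (s * Fintype.card V) := by
    exact_mod_cast (by omega)
  push_cast at htriR hLe' hthrough
  have hkey : ((G.cliqueFinset 3).card : ℝ) ≤ ℓ * q :=
    le_of_quadratic_margin hℓR hkR (zero_le_one.trans hsR) hε hεk hn8 hsparse hdense
      hthrough hedgeR (by linarith) hdiv
  exact_mod_cast hkey

theorem card_triangles_le_extremal {ℓ k : ℕ} (hℓ : 1 ≤ ℓ) (hk : 1 ≤ k) :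
    ∃ n₀ : ℕ, ∀ (V : Type) [Fintype V] (G : SimpleGraph V), n₀ ≤ Fintype.card V →
      ¬ Packing G (2 * k + 1) (ℓ + 1) ∅ →
      (G.cliqueFinset 3).card ≤ ℓ * ((Fintype.card V - ℓ) ^ 2 / 4) +
        (Fintype.card V - ℓ) * ℓ.choose 2 + ℓ.choose 3 := by
  obtain ⟨δ, hδ, n₁, hfew⟩ := card_triangles_le_of_few_heavy hℓ hk
  obtain ⟨n₂, hfree⟩ := edges_add_triangles_le hk
  obtain ⟨D, hD⟩ : ∃ D, D = 4 * k + 2 * (2 * k + 1 + (2 * k + 2) * (ℓ + 1)) := ⟨_, rfl⟩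
  obtain ⟨n₃, hn₃⟩ := exists_nat_gt (D / δ : ℝ)
  refine ⟨n₁ + n₂ + n₃ + ℓ + 1, fun V _ G hn hG => ?_⟩
  set H := univ.filter fun v =>
    δ * (Fintype.card V : ℝ) ^ 2 < (adjPairs G (univ.filter (G.Adj v)) : ℝ) with hH
  have hheavy : ∀ v ∈ H, D * Fintype.card V < adjPairs G (univ.filter (G.Adj v)) := by
    intro v hv
    have h1 := (mem_filter.mp hv).2
    have h2 : (n₃ : ℝ) ≤ Fintype.card V := by exact_mod_cast (by omega)
    have h3 : (0 : ℝ) < Fintype.card V := by exact_mod_cast (by omega)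
    have h4 : (D : ℝ) < δ * Fintype.card V := by
      rw [div_lt_iff₀ hδ] at hn₃
      nlinarith
    have h5 : (D : ℝ) * Fintype.card V < adjPairs G (univ.filter (G.Adj v)) := by
      refine lt_trans ?_ h1
      rw [pow_two, ← mul_assoc]
      exact mul_lt_mul_of_pos_right h4 h3
    exact_mod_cast h5
  have hpack : ∀ L X : Finset V, L ⊆ H → L.card ≤ ℓ + 1 → X.card ≤ 2 * k + 1 → Disjoint L X →
      Packing G (2 * k + 1) L.card X := by
    intro L X hLH hL hX hLX
    refine packing_of_heavy hk _ L X rfl hLX fun v hv => lt_of_le_of_lt ?_ (hheavy v (hLH hv))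
    calc _ = (4 * k + 2 * (X.card + (2 * k + 2) * L.card)) * Fintype.card V := by ring
      _ ≤ D * Fintype.card V := by
        rw [hD]
        gcongr
  rcases lt_trichotomy H.card ℓ with hlt | heq | hgt
  · have := hfew V G (by omega) hG H hlt fun v hv => by
      rw [hH, mem_filter, not_and, not_lt] at hv
      exact hv (mem_univ v)
    omega
  · have hno : ¬ HasCycleAvoiding G (2 * k + 1) H := by
      rintro ⟨f, hf, hfH⟩
      refine hG ⟨f, hf, fun i => notMem_empty _, ?_⟩
      rw [empty_union, ← heq]
      refine hpack H _ subset_rfl (by omega) (card_image_le.trans (by simp)) ?_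
      rw [Finset.disjoint_right]
      intro x hx
      obtain ⟨i, -, rfl⟩ := mem_image.mp hx
      exact hfH i
    have hind := hfree {v | v ∉ H} (G.induce {v | v ∉ H})
      (by rw [card_induce_compl]; omega) fun h => hno h.of_induce
    rw [card_induce_compl, heq] at hind
    have hdec := card_triangles_le_of_inter G H
    have hle : 4 * (((G.cliqueFinset 2).filter (Disjoint · H)).card +
        ((G.cliqueFinset 3).filter (Disjoint · H)).card) ≤ (Fintype.card V - ℓ) ^ 2 := by
      refine Nat.le_trans (Nat.mul_le_mul_left 4 (Nat.add_le_add (card_cliques_disjoint_le G H 2)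
        (card_cliques_disjoint_le G H 3))) ?_
      convert hind
    rw [heq] at hdec
    have hq : ((G.cliqueFinset 2).filter (Disjoint · H)).card +
        ((G.cliqueFinset 3).filter (Disjoint · H)).card ≤ (Fintype.card V - ℓ) ^ 2 / 4 := by
      omega
    have hq' := Nat.mul_le_mul_left ℓ hq
    rw [mul_add] at hq'
    have := Nat.le_mul_of_pos_left ((G.cliqueFinset 3).filter (Disjoint · H)).card hℓ
    omega
  · obtain ⟨L, hLH, hL⟩ := exists_subset_card_eq (Nat.succ_le_of_lt hgt)
    have := hpack L ∅ hLH hL.le (by simp) (disjoint_empty_right _)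
    rw [hL] at this
    exact absurd this hG

end UpperBound

section LowerBound

/-- The vertices of `L` are joined to everything, the remaining vertices span the complete bipartite
graph between `A` and its complement. -/
def apexBipartite (L A : Finset V) : SimpleGraph V where
  Adj u v := u ≠ v ∧ (u ∈ L ∨ v ∈ L ∨ ¬ (u ∈ A ↔ v ∈ A))
  symm := ⟨fun _ _ h => ⟨h.1.symm, by tauto⟩⟩
  loopless := ⟨fun _ h => h.1 rfl⟩

theorem not_hasCycleAvoiding_apexBipartite {L A : Finset V} {k : ℕ} (hk : 1 ≤ k) :
    ¬ HasCycleAvoiding (apexBipartite L A) (2 * k + 1) L := by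
  rintro ⟨f, hf, hfL⟩
  have hcol : (cycleGraph (2 * k + 1)).Colorable 2 := by
    refine (Coloring.mk (fun i => decide (f i ∈ A)) fun {i j} hij heq => ?_).colorable
    rcases (hf.2 hij).2 with h | h | h
    · exact hfL i h
    · exact hfL j h
    · exact h (decide_eq_decide.mp heq)
  have h3 := chromaticNumber_cycleGraph_of_odd (2 * k + 1) (by omega) ⟨k, rfl⟩
  have := hcol.chromaticNumber_le
  rw [h3] at this
  exact absurd this (by decide)

theorem not_hasDisjointCycles_apexBipartite {L A : Finset V} {k : ℕ} (hk : 1 ≤ k) :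
    ¬ HasDisjointCycles (apexBipartite L A) (L.card + 1) (2 * k + 1) := by
  rintro ⟨f, hinj, hadj, hdisj⟩
  have hhit : ∀ j, ∃ i, f j i ∈ L := by
    intro j
    by_contra! hno
    exact not_hasCycleAvoiding_apexBipartite hk ⟨f j, ⟨hinj j, hadj j⟩, hno⟩
  choose g hg using hhit
  obtain ⟨j, -, j', -, hne, heq⟩ := exists_ne_map_eq_of_card_lt_of_maps_to
    (s := (univ : Finset (Fin (L.card + 1)))) (t := L) (f := fun j => f j (g j)) (by simp)
    fun j _ => hg j
  exact Set.disjoint_left.mp (hdisj hne) ⟨g j, rfl⟩ ⟨g j', heq.symm⟩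

variable [Fintype V]

theorem le_card_cliques_inter {L : Finset V} (hL : ∀ x ∈ L, ∀ y, x ≠ y → G.Adj x y) (i r : ℕ) :
    L.card.choose i * ((G.cliqueFinset r).filter (Disjoint · L)).card ≤
      ((G.cliqueFinset (i + r)).filter fun T => (T ∩ L).card = i).card := by
  rw [← card_powersetCard, ← card_product]
  have hinter : ∀ p ∈ L.powersetCard i ×ˢ (G.cliqueFinset r).filter (Disjoint · L),
      (p.1 ∪ p.2) ∩ L = p.1 ∧ (p.1 ∪ p.2) \ L = p.2 := by
    intro p hp
    rw [mem_product, mem_powersetCard, mem_filter] at hp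
    rw [union_inter_distrib_right, union_sdiff_distrib, inter_eq_left.mpr hp.1.1,
      disjoint_iff_inter_eq_empty.mp hp.2.2, sdiff_eq_empty_iff_subset.mpr hp.1.1,
      sdiff_eq_self_of_disjoint hp.2.2, union_empty, empty_union]
    exact ⟨rfl, rfl⟩
  refine card_le_card_of_injOn (fun p => p.1 ∪ p.2) ?_ ?_
  · intro p hp
    have hp' := hinter p hp
    rw [mem_coe, mem_product, mem_powersetCard, mem_filter, SimpleGraph.mem_cliqueFinset_iff] at hp
    obtain ⟨⟨hPL, hPcard⟩, ⟨hclique, hQcard⟩, hQL⟩ := hp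
    rw [mem_coe, mem_filter, SimpleGraph.mem_cliqueFinset_iff]
    refine ⟨⟨fun x hx y hy hxy => ?_, ?_⟩, by rw [hp'.1, hPcard]⟩
    · rw [mem_coe, mem_union] at hx hy
      rcases hx with hx | hx
      · exact hL x (hPL hx) y hxy
      · rcases hy with hy | hy
        · exact (hL y (hPL hy) x hxy.symm).symm
        · exact hclique hx hy hxy
    · change (p.1 ∪ p.2).card = i + r
      rw [card_union_of_disjoint (disjoint_of_subset_left hPL hQL.symm), hPcard, hQcard]
  · intro p hp q hq h
    have hp' := hinter p hp
    have hq' := hinter q hq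
    simp only at h
    rw [h] at hp'
    exact Prod.ext (hp'.1.symm.trans hq'.1) (hp'.2.symm.trans hq'.2)

theorem le_card_triangles_of_inter {L : Finset V} (hL : ∀ x ∈ L, ∀ y, x ≠ y → G.Adj x y) :
    L.card * ((G.cliqueFinset 2).filter (Disjoint · L)).card +
      (Fintype.card V - L.card) * L.card.choose 2 + L.card.choose 3 ≤ (G.cliqueFinset 3).card := by
  have hsplit : ∑ i ∈ range 4, ((G.cliqueFinset 3).filter fun T => (T ∩ L).card = i).card ≤
      (G.cliqueFinset 3).card := by
    rw [← card_biUnion]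
    · exact card_le_card (biUnion_subset.mpr fun i _ => filter_subset _ _)
    · intro i _ j _ hij
      rw [Function.onFun, Finset.disjoint_left]
      intro T hT hT'
      exact hij ((mem_filter.mp hT).2.symm.trans (mem_filter.mp hT').2)
  have hone : Fintype.card V - L.card ≤ ((G.cliqueFinset 1).filter (Disjoint · L)).card := by
    rw [← card_compl, ← card_image_of_injective (f := fun x : V => ({x} : Finset V)) Lᶜ
      singleton_injective]
    refine card_le_card fun T hT => ?_
    obtain ⟨x, hx, rfl⟩ := mem_image.mp hT
    rw [mem_filter, SimpleGraph.mem_cliqueFinset_iff]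
    exact ⟨⟨by simp, card_singleton x⟩, disjoint_singleton_left.mpr (mem_compl.mp hx)⟩
  have hzero : 1 ≤ ((G.cliqueFinset 0).filter (Disjoint · L)).card := by
    refine card_pos.mpr ⟨∅, ?_⟩
    rw [mem_filter, SimpleGraph.mem_cliqueFinset_iff]
    exact ⟨⟨by simp, card_empty⟩, disjoint_empty_left _⟩
  have h1 := le_card_cliques_inter hL 1 2
  have h2 := (Nat.mul_le_mul_left _ hone).trans (le_card_cliques_inter hL 2 1)
  have h3 := (Nat.mul_le_mul_left _ hzero).trans (le_card_cliques_inter hL 3 0)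
  rw [mul_comm] at h2
  simp only [sum_range_succ, range_zero, sum_empty, Nat.choose_one_right, mul_one, zero_add,
    Nat.reduceAdd, add_zero] at *
  omega

theorem le_card_triangles_apexBipartite {L A : Finset V} (hA : Disjoint A L) :
    L.card * (A.card * (Fintype.card V - L.card - A.card)) +
      (Fintype.card V - L.card) * L.card.choose 2 + L.card.choose 3 ≤
      ((apexBipartite L A).cliqueFinset 3).card := by
  refine le_trans ?_ (le_card_triangles_of_inter fun x hx y hxy => ⟨hxy, Or.inl hx⟩)
  gcongr
  have hB : Fintype.card V - L.card - A.card = (Lᶜ \ A).card := by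
    rw [card_sdiff_of_subset, card_compl]
    exact fun x hx => mem_compl.mpr (Finset.disjoint_left.mp hA hx)
  rw [hB, ← card_product]
  refine card_le_card_of_injOn (fun p => {p.1, p.2}) ?_ ?_
  · intro p hp
    rw [mem_coe, mem_product, mem_sdiff, mem_compl] at hp
    obtain ⟨h1, h2, h3⟩ := hp
    have hne : p.1 ≠ p.2 := fun h => h3 (h ▸ h1)
    rw [mem_coe, mem_filter, SimpleGraph.mem_cliqueFinset_iff]
    refine ⟨⟨?_, card_pair hne⟩, ?_⟩
    · have hadj : (apexBipartite L A).Adj p.1 p.2 := ⟨hne, Or.inr (Or.inr (by tauto))⟩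
      simp [SimpleGraph.isClique_iff, hadj]
    · simp [h2, Finset.disjoint_left.mp hA h1]
  · intro p hp q hq h
    rw [mem_coe, mem_product, mem_sdiff] at hp hq
    replace h : ({p.1, p.2} : Finset V) = {q.1, q.2} := h
    have h1 : p.1 ∈ ({q.1, q.2} : Finset V) := h ▸ mem_insert_self _ _
    have h2 : p.2 ∈ ({q.1, q.2} : Finset V) := h ▸ mem_insert_of_mem (mem_singleton_self _)
    rw [mem_insert, mem_singleton] at h1 h2
    refine Prod.ext (h1.resolve_right fun h' => hq.2.2 (h' ▸ hp.1))
      (h2.resolve_left fun h' => hp.2.2 (h' ▸ hq.1))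

theorem half_mul_sub_half (m : ℕ) : m / 2 * (m - m / 2) = m ^ 2 / 4 := by
  rcases Nat.even_or_odd' m with ⟨c, rfl | rfl⟩
  · rw [show 2 * c / 2 = c by omega, show 2 * c - c = c by omega,
      show (2 * c) ^ 2 = 4 * (c * c) by ring, Nat.mul_div_cancel_left _ (by norm_num)]
  · rw [show (2 * c + 1) / 2 = c by omega, show 2 * c + 1 - c = c + 1 by omega,
      show (2 * c + 1) ^ 2 = 1 + 4 * (c * (c + 1)) by ring,
      Nat.add_mul_div_left _ _ (by norm_num)]
    omega

theorem exists_extremal {ℓ k : ℕ} (hk : 1 ≤ k) (hn : ℓ ≤ Fintype.card V) :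
    ∃ G : SimpleGraph V, ¬ HasDisjointCycles G (ℓ + 1) (2 * k + 1) ∧
      ℓ * ((Fintype.card V - ℓ) ^ 2 / 4) + (Fintype.card V - ℓ) * ℓ.choose 2 + ℓ.choose 3 ≤
        (G.cliqueFinset 3).card := by
  obtain ⟨L, -, hL⟩ := exists_subset_card_eq (s := (univ : Finset V)) hn
  obtain ⟨A, hAL, hA⟩ := exists_subset_card_eq (s := Lᶜ) (n := (Fintype.card V - ℓ) / 2)
    (by rw [card_compl, hL]; omega)
  have hcount := le_card_triangles_apexBipartite (subset_compl_iff_disjoint_right.mp hAL)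
  rw [hL, hA, half_mul_sub_half] at hcount
  exact ⟨apexBipartite L A, hL ▸ not_hasDisjointCycles_apexBipartite hk, hcount⟩

theorem triangleCount_eq_card (G : SimpleGraph V) : triangleCount G = (G.cliqueFinset 3).card := by
  rw [triangleCount, ← SimpleGraph.coe_cliqueFinset, Set.ncard_coe_finset]

end LowerBound

end OddCyclePacking

/-- For all integers `ℓ ≥ 1`, `k ≥ 1`, for sufficiently large `n`, the maximum number of
triangles in an `n`-vertex graph with no `ℓ+1` pairwise vertex-disjoint copies of `C_{2k+1}`
equals `ℓ·⌊(n−ℓ)²/4⌋ + (n−ℓ)·C(ℓ,2) + C(ℓ,3)`. -/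
theorem stmt_0 (ℓ k : ℕ) (hℓ : 1 ≤ ℓ) (hk : 1 ≤ k) :
    ∃ n₀ : ℕ, ∀ n : ℕ, n₀ ≤ n →
      IsGreatest {t : ℕ | ∃ G : SimpleGraph (Fin n),
          ¬ HasDisjointCycles G (ℓ + 1) (2 * k + 1) ∧ triangleCount G = t}
        (ℓ * ((n - ℓ) ^ 2 / 4) + (n - ℓ) * Nat.choose ℓ 2 + Nat.choose ℓ 3) := by
  obtain ⟨n₀, hupper⟩ := OddCyclePacking.card_triangles_le_extremal hℓ hk
  have hle : ∀ n, n₀ + ℓ ≤ n → ∀ G : SimpleGraph (Fin n),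
      ¬ HasDisjointCycles G (ℓ + 1) (2 * k + 1) →
      triangleCount G ≤ ℓ * ((n - ℓ) ^ 2 / 4) + (n - ℓ) * Nat.choose ℓ 2 + Nat.choose ℓ 3 := by
    intro n hn G hG
    have h := hupper (Fin n) G (by rw [Fintype.card_fin]; omega) fun h => hG h.hasDisjointCycles
    rwa [← OddCyclePacking.triangleCount_eq_card, Fintype.card_fin] at h
  refine ⟨n₀ + ℓ, fun n hn => ⟨?_, ?_⟩⟩
  · obtain ⟨G, hG, hcount⟩ := OddCyclePacking.exists_extremal (V := Fin n) (ℓ := ℓ) hk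
      (by rw [Fintype.card_fin]; omega)
    rw [← OddCyclePacking.triangleCount_eq_card, Fintype.card_fin] at hcount
    exact ⟨G, hG, le_antisymm (hle n hn G hG) hcount⟩
  · rintro t ⟨G, hG, rfl⟩
    exact hle n hn G hG
end

section
/- For all integers ℓ ≥ 1 and k ≥ 1, there exists n₀ such that for all n ≥ n₀: if G is an n-vertex graph containing no ℓ+1 pairwise vertex-disjoint copies of C_{2k+1} and the number of triangles of G equals ℓ·⌊(n−ℓ)²/4⌋ + (n−ℓ)·C(ℓ,2) + C(ℓ,3), then G is isomorphic to the join K_ℓ ⋈ T_2(n−ℓ) of a complete graph on ℓ vertices with the complete balanced bipartite graph on n−ℓ vertices. -/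
open SimpleGraph

namespace OddCycleTriangles

open Finset
open scoped Classical

/-! ### Paths and cycles inside a vertex set -/

section Paths

variable {V : Type*} {G : SimpleGraph V}

/-- The first `r` terms of `p` are distinct and consecutive ones are adjacent. -/
def IsPathSeq (G : SimpleGraph V) (r : ℕ) (p : ℕ → V) : Prop :=
  (∀ i < r, ∀ j < r, p i = p j → i = j) ∧ ∀ i, i + 1 < r → G.Adj (p i) (p (i + 1))

/-- `G` has a cycle of length `m` all of whose vertices lie in `S`. -/
def HasCycleIn (G : SimpleGraph V) (m : ℕ) (S : Finset V) : Prop :=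
  ∃ f : Fin m → V, Function.Injective f ∧
    (∀ ⦃i i'⦄, (cycleGraph m).Adj i i' → G.Adj (f i) (f i')) ∧ ∀ i, f i ∈ S

lemma HasCycleIn.mono {m : ℕ} {S S' : Finset V} (h : HasCycleIn G m S) (hS : S ⊆ S') :
    HasCycleIn G m S' := by
  obtain ⟨f, h1, h2, h3⟩ := h
  exact ⟨f, h1, h2, fun i => hS (h3 i)⟩

lemma IsPathSeq.snoc {r : ℕ} {p : ℕ → V} (hp : IsPathSeq G r p) (v : V)
    (hv : ∀ i < r, p i ≠ v) (hadj : ∀ i, i + 1 = r → G.Adj (p i) v) :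
    IsPathSeq G (r + 1) (Function.update p r v) := by
  refine ⟨fun i hi j hj hij => ?_, fun i hi => ?_⟩
  · rcases Nat.lt_succ_iff_lt_or_eq.1 hi with hi | rfl <;>
      rcases Nat.lt_succ_iff_lt_or_eq.1 hj with hj | rfl
    · rw [Function.update_of_ne hi.ne, Function.update_of_ne hj.ne] at hij
      exact hp.1 i hi j hj hij
    · rw [Function.update_of_ne hi.ne, Function.update_self] at hij
      exact (hv i hi hij).elim
    · rw [Function.update_of_ne hj.ne, Function.update_self] at hij
      exact (hv j hj hij.symm).elim
    · rfl
  · rw [Function.update_of_ne (by omega : i ≠ r)]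
    rcases Nat.lt_succ_iff_lt_or_eq.1 hi with hi | hi
    · rw [Function.update_of_ne hi.ne]
      exact hp.2 i hi
    · rw [hi, Function.update_self]
      exact hadj i hi

lemma IsPathSeq.hasCycleIn {m : ℕ} {p : ℕ → V} {S : Finset V} (hp : IsPathSeq G (m + 1) p)
    (hclose : G.Adj (p m) (p 0)) (hS : ∀ i < m + 1, p i ∈ S) : HasCycleIn G (m + 1) S := by
  have key : ∀ u v : Fin (m + 1), (u - v).val = 1 → G.Adj (p v) (p u) := by
    intro u v h
    rw [Fin.val_sub] at h
    have hu := u.2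
    have hv := v.2
    by_cases hvu : v.val ≤ u.val
    · have : m + 1 - v.val + u.val = (u.val - v.val) + (m + 1) := by omega
      rw [this, Nat.add_mod_right, Nat.mod_eq_of_lt (by omega)] at h
      have h' : u.val = v.val + 1 := by omega
      rw [h']
      exact hp.2 _ (by omega)
    · rw [Nat.mod_eq_of_lt (by omega)] at h
      have h1 : v.val = m := by omega
      have h2 : u.val = 0 := by omega
      rw [h1, h2]
      exact hclose
  refine ⟨fun i => p i, fun i j h => Fin.ext (hp.1 _ i.2 _ j.2 h), fun i j h => ?_,
    fun i => hS _ i.2⟩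
  rcases cycleGraph_adj'.1 h with h | h
  · exact (key _ _ h).symm
  · exact key _ _ h

/-- Neighbours of `v` inside `S`. -/
noncomputable def nb (G : SimpleGraph V) (S : Finset V) (v : V) : Finset V :=
  S.filter (G.Adj v)

lemma mem_nb {S : Finset V} {v u : V} : u ∈ nb G S v ↔ u ∈ S ∧ G.Adj v u := by
  simp [nb]

lemma nb_subset (S : Finset V) (v : V) : nb G S v ⊆ S := filter_subset _ _

lemma nb_mono {S S' : Finset V} (h : S ⊆ S') (v : V) : nb G S v ⊆ nb G S' v :=
  filter_subset_filter _ h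

/-- Greedy embedding of a path through prescribed sets. -/
lemma exists_isPathSeq (F : Finset V) (T : ℕ → Finset V) (D r : ℕ)
    (hD : r + 1 + #F ≤ D) (h0 : D ≤ #(T 0))
    (hstep : ∀ i < r, ∀ u ∈ T i, D ≤ #(nb G (T (i + 1)) u)) :
    ∃ p, IsPathSeq G (r + 1) p ∧ ∀ i < r + 1, p i ∈ T i ∧ p i ∉ F := by
  induction r with
  | zero =>
    obtain ⟨v, hv, hvF⟩ : ∃ v ∈ T 0, v ∉ F := exists_mem_notMem_of_card_lt_card (by omega)
    refine ⟨fun _ => v, ⟨by omega, by omega⟩, ?_⟩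
    intro i hi
    obtain rfl : i = 0 := by omega
    exact ⟨hv, hvF⟩
  | succ r ih =>
    obtain ⟨p, hp, hpT⟩ := ih (by omega) fun i hi => hstep i (by omega)
    have hcard : #(F ∪ (range (r + 1)).image p) < #(nb G (T (r + 1)) (p r)) := by
      have h1 := hstep r (by omega) (p r) (hpT r (by omega)).1
      have h2 := card_union_le F ((range (r + 1)).image p)
      have h3 : #((range (r + 1)).image p) ≤ r + 1 := card_image_le.trans (by simp)
      omega
    obtain ⟨v, hv, hvF⟩ := exists_mem_notMem_of_card_lt_card hcard
    rw [mem_nb] at hv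
    simp only [mem_union, mem_image, mem_range, not_or, not_exists, not_and] at hvF
    refine ⟨_, hp.snoc v hvF.2 fun i hi => ?_, fun i hi => ?_⟩
    · obtain rfl : i = r := by omega
      exact hv.2
    · rcases Nat.lt_succ_iff_lt_or_eq.1 hi with hi | rfl
      · rw [Function.update_of_ne hi.ne]
        exact hpT i hi
      · rw [Function.update_self]
        exact ⟨hv.1, hvF.1⟩

/-- Closing a path inside the neighbourhood of `v`. -/
lemma IsPathSeq.hasCycleIn_one {r : ℕ} {p : ℕ → V} {S : Finset V} (hp : IsPathSeq G (r + 1) p)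
    {v : V} (hpS : ∀ i < r + 1, p i ∈ S) (hpv : ∀ i < r + 1, p i ≠ v) (hv : v ∈ S)
    (h0 : G.Adj v (p 0)) (h1 : G.Adj (p r) v) : HasCycleIn G (r + 2) S := by
  refine (hp.snoc v hpv fun i hi => ?_).hasCycleIn ?_ fun i hi => ?_
  · obtain rfl : i = r := by omega
    exact h1
  · rw [Function.update_self, Function.update_of_ne (by omega)]
    exact h0
  · rcases Nat.lt_succ_iff_lt_or_eq.1 hi with hi | rfl
    · rw [Function.update_of_ne hi.ne]
      exact hpS i hi
    · rw [Function.update_self]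
      exact hv

/-- Closing a path from a neighbour of `x` to a neighbour of `y` along the edge `y x`. -/
lemma IsPathSeq.hasCycleIn_two {r : ℕ} {p : ℕ → V} {S : Finset V} (hp : IsPathSeq G (r + 1) p)
    {x y : V} (hpS : ∀ i < r + 1, p i ∈ S) (hpF : ∀ i < r + 1, p i ∉ ({x, y} : Finset V))
    (hx : x ∈ S) (hy : y ∈ S) (hyx : G.Adj y x)
    (h0 : G.Adj x (p 0)) (h1 : G.Adj (p r) y) : HasCycleIn G (r + 3) S := by
  simp only [mem_insert, mem_singleton, not_or] at hpF
  have hs := hp.snoc y (fun i hi => (hpF i hi).2) fun i hi => by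
    obtain rfl : i = r := by omega
    exact h1
  refine hs.hasCycleIn_one (v := x) (fun i hi => ?_) (fun i hi => ?_) hx ?_ ?_
  · rcases Nat.lt_succ_iff_lt_or_eq.1 hi with hi | rfl
    · rw [Function.update_of_ne hi.ne]
      exact hpS i hi
    · rw [Function.update_self]
      exact hy
  · rcases Nat.lt_succ_iff_lt_or_eq.1 hi with hi | rfl
    · rw [Function.update_of_ne hi.ne]
      exact (hpF i hi).1
    · rw [Function.update_self]
      exact hyx.ne
  · rwa [Function.update_of_ne (by omega)]
  · rwa [Function.update_self]

/-- Closing a path from a neighbour of `x` to a neighbour of `y` along the path `y z x`. -/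
lemma IsPathSeq.hasCycleIn_three {r : ℕ} {p : ℕ → V} {S : Finset V}
    (hp : IsPathSeq G (r + 1) p) {x y z : V} (hpS : ∀ i < r + 1, p i ∈ S)
    (hpF : ∀ i < r + 1, p i ∉ ({x, y, z} : Finset V))
    (hx : x ∈ S) (hy : y ∈ S) (hz : z ∈ S) (hxy : x ≠ y) (hyz : G.Adj y z) (hzx : G.Adj z x)
    (h0 : G.Adj x (p 0)) (h1 : G.Adj (p r) y) : HasCycleIn G (r + 4) S := by
  simp only [mem_insert, mem_singleton, not_or] at hpF
  have hs := hp.snoc y (fun i hi => (hpF i hi).2.1) fun i hi => by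
    obtain rfl : i = r := by omega
    exact h1
  refine hs.hasCycleIn_two (x := x) (y := z) (fun i hi => ?_) (fun i hi => ?_) hx hz hzx ?_ ?_
  · rcases Nat.lt_succ_iff_lt_or_eq.1 hi with hi | rfl
    · rw [Function.update_of_ne hi.ne]
      exact hpS i hi
    · rw [Function.update_self]
      exact hy
  · rcases Nat.lt_succ_iff_lt_or_eq.1 hi with hi | rfl
    · rw [Function.update_of_ne hi.ne]
      simpa using ⟨(hpF i hi).1, (hpF i hi).2.2⟩
    · rw [Function.update_self]
      simpa using ⟨hxy.symm, hyz.ne⟩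
  · rwa [Function.update_of_ne (by omega)]
  · rwa [Function.update_self]

end Paths

/-! ### Counting edges and triangles inside vertex sets -/

section Counting

variable {V : Type*} {G : SimpleGraph V}

/-- The number of adjacent pairs in `A × B`. -/
noncomputable def ec (G : SimpleGraph V) (A B : Finset V) : ℕ := ∑ a ∈ A, #(nb G B a)

/-- The number of ordered triples of pairwise adjacent vertices of `S`. -/
noncomputable def tc (G : SimpleGraph V) (S : Finset V) : ℕ :=
  ∑ v ∈ S, ec G (nb G S v) (nb G S v)

lemma card_nb_eq_sum (S : Finset V) (v : V) :
    #(nb G S v) = ∑ u ∈ S, if G.Adj v u then 1 else 0 := by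
  rw [nb, card_filter]

lemma ec_comm (A B : Finset V) : ec G A B = ec G B A := by
  simp only [ec, card_nb_eq_sum]
  rw [sum_comm]
  simp only [G.adj_comm]

lemma ec_mono {A A' B B' : Finset V} (hA : A ⊆ A') (hB : B ⊆ B') : ec G A B ≤ ec G A' B' :=
  (sum_le_sum fun a _ => card_le_card (nb_mono hB a)).trans
    (sum_le_sum_of_subset (f := fun a => #(nb G B' a)) hA)

lemma ec_le_mul (A B : Finset V) : ec G A B ≤ #A * #B := by
  rw [ec, ← smul_eq_mul]
  exact sum_le_card_nsmul _ _ _ fun a _ => card_le_card (nb_subset B a)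

lemma ec_erase_left {A B : Finset V} {a : V} (ha : a ∈ A) :
    ec G A B = ec G (A.erase a) B + #(nb G B a) := (sum_erase_add _ _ ha).symm

lemma ec_erase_right {A B : Finset V} {b : V} (hb : b ∈ B) :
    ec G A B = ec G A (B.erase b) + #(nb G A b) := by
  rw [ec_comm, ec_erase_left hb, ec_comm]

/-- A dense pair contains a pair of large minimum degree. -/
lemma exists_min_degree_pair (D : ℕ) (A B : Finset V) (h : D * (#A + #B) < ec G A B) :
    ∃ A' ⊆ A, ∃ B' ⊆ B, A'.Nonempty ∧ (∀ a ∈ A', D < #(nb G B' a)) ∧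
      ∀ b ∈ B', D < #(nb G A' b) := by
  induction hn : #A + #B using Nat.strong_induction_on generalizing A B with
  | _ n ih =>
    subst hn
    by_cases hA : ∃ a ∈ A, #(nb G B a) ≤ D
    · obtain ⟨a, ha, had⟩ := hA
      have hc := card_erase_add_one ha
      have he := ec_erase_left (G := G) (B := B) ha
      have : D * (#(A.erase a) + #B) + D = D * (#A + #B) := by rw [← hc]; ring
      obtain ⟨A', hA', B', hB', h'⟩ := ih _ (by omega) (A.erase a) B (by omega) rfl
      exact ⟨A', hA'.trans (erase_subset _ _), B', hB', h'⟩
    by_cases hB : ∃ b ∈ B, #(nb G A b) ≤ D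
    · obtain ⟨b, hb, hbd⟩ := hB
      have hc := card_erase_add_one hb
      have he := ec_erase_right (G := G) (A := A) hb
      have : D * (#A + #(B.erase b)) + D = D * (#A + #B) := by rw [← hc]; ring
      obtain ⟨A', hA', B', hB', h'⟩ := ih _ (by omega) A (B.erase b) (by omega) rfl
      exact ⟨A', hA', B', hB'.trans (erase_subset _ _), h'⟩
    push Not at hA hB
    refine ⟨A, Subset.rfl, B, Subset.rfl, ?_, hA, hB⟩
    rw [nonempty_iff_ne_empty]
    rintro rfl
    simp [ec] at h

/-- A dense pair contains an alternating path avoiding a given small set. -/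
lemma exists_alternating_path (F A B : Finset V) (r : ℕ)
    (h : (r + 1 + #F) * (#A + #B) < ec G A B) :
    ∃ p, IsPathSeq G (r + 1) p ∧ ∀ i < r + 1, p i ∈ (if Even i then A else B) ∧ p i ∉ F := by
  obtain ⟨A', hA', B', hB', ⟨a, ha⟩, hdA, hdB⟩ := exists_min_degree_pair _ A B h
  obtain ⟨b, hb⟩ : (nb G B' a).Nonempty := card_pos.1 (by have := hdA a ha; omega)
  have h0 : r + 1 + #F ≤ #A' := (hdB b (nb_subset _ _ hb)).le.trans (card_le_card (nb_subset _ _))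
  have hstep : ∀ i < r, ∀ u ∈ (if Even i then A' else B'),
      r + 1 + #F ≤ #(nb G (if Even (i + 1) then A' else B') u) := by
    intro i _ u hu
    by_cases hi : Even i
    · have hi' : ¬ Even (i + 1) := by rwa [Nat.even_add_one, not_not]
      simp only [hi, hi', if_true, if_false] at hu ⊢
      exact (hdA u hu).le
    · have hi' : Even (i + 1) := by rwa [Nat.even_add_one]
      simp only [hi, hi', if_true, if_false] at hu ⊢
      exact (hdB u hu).le
  obtain ⟨p, hp, hpT⟩ := exists_isPathSeq (G := G) F (fun i => if Even i then A' else B')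
    (r + 1 + #F) r le_rfl (by simpa using h0) hstep
  refine ⟨p, hp, fun i hi => ⟨?_, (hpT i hi).2⟩⟩
  have := (hpT i hi).1
  split_ifs at this ⊢
  exacts [hA' this, hB' this]

/-- A vertex with many edges in its neighbourhood lies on a cycle of length `r + 2`
avoiding a given small set. -/
lemma hasCycleIn_of_dense_link {S F : Finset V} {v : V} (hv : v ∈ S) (hvF : v ∉ F) (r : ℕ)
    (h : (r + 1 + #F) * (2 * #(nb G S v)) < ec G (nb G S v) (nb G S v)) :
    HasCycleIn G (r + 2) (S \ F) := by
  obtain ⟨p, hp, hpT⟩ := exists_alternating_path F _ _ r (by rwa [← two_mul])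
  simp only [ite_self, mem_nb] at hpT
  exact hp.hasCycleIn_one (v := v) (fun i hi => mem_sdiff.2 ⟨(hpT i hi).1.1, (hpT i hi).2⟩)
    (fun i hi => (hpT i hi).1.2.ne') (mem_sdiff.2 ⟨hv, hvF⟩) (hpT 0 (by omega)).1.2
    (hpT r (by omega)).1.2.symm

/-- Neighbourhoods in an odd-cycle-free set span few edges. -/
lemma ec_nb_le {k : ℕ} (hk : 1 ≤ k) {S : Finset V} (hS : ¬ HasCycleIn G (2 * k + 1) S) {v : V}
    (hv : v ∈ S) : ec G (nb G S v) (nb G S v) ≤ 4 * k * #(nb G S v) := by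
  by_contra! h
  obtain ⟨r, rfl⟩ : ∃ r, k = r + 1 := ⟨k - 1, by omega⟩
  refine hS ?_
  have := hasCycleIn_of_dense_link (G := G) (F := ∅) hv (by simp) (2 * r + 1)
    (by rw [card_empty]; linarith)
  rwa [sdiff_empty] at this

end Counting

section Inequalities

variable {V : Type*} {G : SimpleGraph V}

lemma nb_nb_comm (S : Finset V) (u v : V) : nb G (nb G S u) v = nb G (nb G S v) u := by
  ext w
  simp only [mem_nb]
  tauto

lemma sq_ec_le (S : Finset V) : ec G S S ^ 2 ≤ #S * ∑ a ∈ S, #(nb G S a) ^ 2 :=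
  sq_sum_le_card_mul_sum_sq

lemma sum_nb_mul (S : Finset V) (v : V) (f : V → ℕ) :
    ∑ u ∈ nb G S v, f u = ∑ u ∈ S, (if G.Adj v u then 1 else 0) * f u := by
  rw [nb, sum_filter]
  simp

/-- Dense graphs have an edge whose end vertices have neighbourhoods spanning many edges. -/
lemma ec_pow_four_le (S : Finset V) (Q : ℕ)
    (h : ∀ a ∈ S, ∀ b ∈ S, G.Adj a b → ec G (nb G S a) (nb G S b) ≤ Q) :
    ec G S S ^ 4 ≤ Q * #S ^ 6 := by
  set α : V → V → ℕ := fun x y => if G.Adj x y then 1 else 0 with hα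
  have hsymm : ∀ x y, α x y = α y x := fun x y => by simp only [hα, G.adj_comm]
  have hec : ∀ a b, ec G (nb G S a) (nb G S b) = ∑ x ∈ S, ∑ y ∈ S, α a x * α b y * α x y := by
    intro a b
    rw [ec, sum_nb_mul]
    refine sum_congr rfl fun x _ => ?_
    rw [card_nb_eq_sum, sum_nb_mul, mul_sum]
    exact sum_congr rfl fun y _ => (mul_assoc _ _ _).symm
  have hH : ∑ a ∈ S, ∑ y ∈ S, (∑ x ∈ S, α a x * α x y) ^ 2 ≤ #S * (#S * Q) := by
    calc ∑ a ∈ S, ∑ y ∈ S, (∑ x ∈ S, α a x * α x y) ^ 2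
        = ∑ a ∈ S, ∑ b ∈ S, α a b * ec G (nb G S a) (nb G S b) := by
          refine sum_congr rfl fun a _ => ?_
          simp only [sq, sum_mul_sum, hec]
          simp only [mul_sum]
          rw [sum_comm]
          refine sum_congr rfl fun b _ => ?_
          rw [sum_comm]
          refine sum_congr rfl fun x _ => sum_congr rfl fun y _ => ?_
          ring
      _ ≤ ∑ a ∈ S, ∑ b ∈ S, Q := by
          refine sum_le_sum fun a ha => sum_le_sum fun b hb => ?_
          by_cases hab : G.Adj a b
          · simpa [hα, hab] using h a ha b hb hab
          · simp [hα, hab]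
      _ = #S * (#S * Q) := by simp
  have hsq : ∑ a ∈ S, #(nb G S a) ^ 2 = ∑ q ∈ S ×ˢ S, ∑ x ∈ S, α q.1 x * α x q.2 := by
    rw [sum_product]
    simp only [card_nb_eq_sum, sq, sum_mul_sum]
    rw [sum_comm' (t' := S) (s' := fun _ => S) (by simp)]
    refine (sum_congr rfl fun a _ => ?_).trans sum_comm
    rw [sum_comm]
    exact sum_congr rfl fun x _ => sum_congr rfl fun y _ => by
      rw [← hsymm y x, mul_comm]
  have h2 : (∑ a ∈ S, #(nb G S a) ^ 2) ^ 2 ≤ (#S * #S) * (#S * (#S * Q)) := by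
    rw [hsq]
    refine sq_sum_le_card_mul_sum_sq.trans ?_
    rw [card_product, sum_product]
    exact Nat.mul_le_mul_left _ hH
  calc ec G S S ^ 4 = (ec G S S ^ 2) ^ 2 := by ring
    _ ≤ (#S * ∑ a ∈ S, #(nb G S a) ^ 2) ^ 2 := Nat.pow_le_pow_left (sq_ec_le S) 2
    _ = #S ^ 2 * (∑ a ∈ S, #(nb G S a) ^ 2) ^ 2 := by ring
    _ ≤ #S ^ 2 * ((#S * #S) * (#S * (#S * Q))) := Nat.mul_le_mul_left _ h2
    _ = Q * #S ^ 6 := by ring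

/-- A Moon–Moser type inequality. -/
lemma two_mul_sq_ec_le (S : Finset V) (Q : ℝ)
    (h : ∀ a ∈ S, ∀ b ∈ S, G.Adj a b → (#(nb G S a ∪ nb G S b) : ℝ) ≤ Q) :
    2 * (ec G S S : ℝ) ^ 2 ≤ #S * (Q * ec G S S + tc G S) := by
  have h1 : ∑ a ∈ S, ∑ b ∈ nb G S a, (#(nb G S a ∪ nb G S b) : ℝ) ≤ Q * ec G S S := by
    calc ∑ a ∈ S, ∑ b ∈ nb G S a, (#(nb G S a ∪ nb G S b) : ℝ)
        ≤ ∑ a ∈ S, ∑ b ∈ nb G S a, Q := by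
          refine sum_le_sum fun a ha => sum_le_sum fun b hb => ?_
          rw [mem_nb] at hb
          exact h a ha b hb.1 hb.2
      _ = Q * ec G S S := by
          simp only [sum_const, nsmul_eq_mul, ec, Nat.cast_sum, mul_sum, mul_comm]
  have h2 : ∑ a ∈ S, ∑ b ∈ nb G S a, #(nb G S a ∪ nb G S b) + tc G S
      = 2 * ∑ a ∈ S, #(nb G S a) ^ 2 := by
    have h3 : ∑ a ∈ S, ∑ b ∈ nb G S a, #(nb G S b) = ∑ a ∈ S, #(nb G S a) ^ 2 := by
      simp only [sum_nb_mul]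
      rw [sum_comm]
      refine sum_congr rfl fun b _ => ?_
      rw [← sum_mul, sq, card_nb_eq_sum S b]
      simp only [G.adj_comm]
    have h4 : ∑ a ∈ S, ∑ b ∈ nb G S a, #(nb G S a) = ∑ a ∈ S, #(nb G S a) ^ 2 := by
      simp [sq]
    rw [two_mul]
    nth_rewrite 2 [← h3]
    rw [← h4, tc, ← sum_add_distrib, ← sum_add_distrib]
    refine sum_congr rfl fun a _ => ?_
    rw [ec, ← sum_add_distrib, ← sum_add_distrib]
    refine sum_congr rfl fun b _ => ?_
    rw [← card_union_add_card_inter (nb G S a) (nb G S b)]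
    congr 2
    ext w
    simp only [mem_nb, mem_inter]
    tauto
  have h5 := sq_ec_le (G := G) S
  have h2' : ∑ a ∈ S, ∑ b ∈ nb G S a, (#(nb G S a ∪ nb G S b) : ℝ) + tc G S
      = 2 * ∑ a ∈ S, (#(nb G S a) : ℝ) ^ 2 := by exact_mod_cast h2
  have h5' : (ec G S S : ℝ) ^ 2 ≤ #S * ∑ a ∈ S, (#(nb G S a) : ℝ) ^ 2 := by exact_mod_cast h5
  calc 2 * (ec G S S : ℝ) ^ 2 ≤ #S * (2 * ∑ a ∈ S, (#(nb G S a) : ℝ) ^ 2) := by linarith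
    _ ≤ #S * (Q * ec G S S + tc G S) := by
      rw [← h2']
      gcongr

lemma two_mul_sq_ec_le_card (S : Finset V) :
    2 * (ec G S S : ℝ) ^ 2 ≤ #S * (#S * ec G S S + tc G S) :=
  two_mul_sq_ec_le S _ fun a _ b _ _ => by
    exact_mod_cast card_le_card (union_subset (nb_subset S a) (nb_subset S b))

/-- Mantel's theorem. -/
lemma two_mul_ec_le {S : Finset V} (h : tc G S = 0) : 2 * ec G S S ≤ #S ^ 2 := by
  have := two_mul_sq_ec_le_card (G := G) S
  rw [h] at this
  rcases Nat.eq_zero_or_pos (ec G S S) with h0 | h0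
  · simp [h0]
  have h0' : (0 : ℝ) < ec G S S := by exact_mod_cast h0
  have : (2 * ec G S S : ℝ) ≤ #S ^ 2 := by
    refine le_of_mul_le_mul_right ?_ h0'
    push_cast at this
    nlinarith
  exact_mod_cast this

lemma nb_erase (S : Finset V) (u v : V) : nb G (S.erase v) u = (nb G S u).erase v := by
  ext w
  simp only [mem_nb, mem_erase]
  tauto

lemma ec_le_erase {S : Finset V} {v : V} (hv : v ∈ S) :
    ec G S S ≤ ec G (S.erase v) (S.erase v) + 2 * #(nb G S v) := by
  have h := card_le_card (nb_mono (G := G) (erase_subset v S) v)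
  rw [ec_erase_left hv, ec_erase_right hv]
  omega

lemma tc_le_erase {S : Finset V} {v : V} (hv : v ∈ S) :
    tc G S ≤ tc G (S.erase v) + 3 * ec G (nb G S v) (nb G S v) := by
  have h1 : ∀ u ∈ S.erase v, ec G (nb G S u) (nb G S u) ≤
      ec G (nb G (S.erase v) u) (nb G (S.erase v) u) +
        2 * ((if G.Adj v u then 1 else 0) * #(nb G (nb G S v) u)) := by
    intro u hu
    by_cases huv : G.Adj v u
    · have hmem : v ∈ nb G S u := mem_nb.2 ⟨hv, huv.symm⟩
      simpa [huv, nb_erase, nb_nb_comm S v u] using ec_le_erase (G := G) hmem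
    · have hmem : v ∉ nb G S u := fun h => huv (mem_nb.1 h).2.symm
      simp [nb_erase, erase_eq_of_notMem hmem]
  have h2 : ∑ u ∈ S.erase v, (if G.Adj v u then 1 else 0) * #(nb G (nb G S v) u)
      ≤ ec G (nb G S v) (nb G S v) := by
    rw [ec, sum_nb_mul]
    exact sum_le_sum_of_subset (erase_subset _ _)
  have h3 := sum_le_sum h1
  rw [sum_add_distrib, ← mul_sum] at h3
  have h4 : tc G S = ∑ u ∈ S.erase v, ec G (nb G S u) (nb G S u) +
    ec G (nb G S v) (nb G S v) := (sum_erase_add _ _ hv).symm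
  have h5 : tc G (S.erase v) =
    ∑ u ∈ S.erase v, ec G (nb G (S.erase v) u) (nb G (S.erase v) u) := rfl
  omega

lemma tc_eq_zero {S : Finset V}
    (h : ∀ x ∈ S, ∀ y ∈ S, ∀ z ∈ S, G.Adj x y → G.Adj y z → ¬ G.Adj z x) : tc G S = 0 := by
  refine sum_eq_zero fun x hx => sum_eq_zero fun y hy => ?_
  rw [card_eq_zero, eq_empty_iff_forall_notMem]
  intro z hz
  simp only [mem_nb] at hy hz
  exact h x hx y hy.1 z hz.1.1 hy.2 hz.2 hz.1.2.symm

lemma tc_eq_zero_of_not_hasCycleIn_three {S : Finset V} (hS : ¬ HasCycleIn G 3 S) :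
    tc G S = 0 := by
  refine tc_eq_zero fun x hx y hy z hz hxy hyz hzx => hS ?_
  have hp : IsPathSeq G 1 fun _ => x := ⟨by omega, by omega⟩
  exact hp.hasCycleIn_two (x := z) (y := y) (r := 0) (fun _ _ => hx)
    (fun _ _ => by simpa using ⟨hzx.ne', hxy.ne⟩) hz hy hyz hzx hxy

/-- The subgraph of edges lying in a triangle with third vertex in `S`. -/
def triangleEdges (G : SimpleGraph V) (S : Finset V) : SimpleGraph V where
  Adj x y := G.Adj x y ∧ ∃ w ∈ S, G.Adj x w ∧ G.Adj y w
  symm := ⟨fun _ _ ⟨h, w, hw, h1, h2⟩ => ⟨h.symm, w, hw, h2, h1⟩⟩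
  loopless := ⟨fun _ h => G.irrefl h.1⟩

lemma tc_le_tc_triangleEdges (S : Finset V) : tc G S ≤ tc (triangleEdges G S) S := by
  refine sum_le_sum fun v hv => ?_
  refine (sum_le_sum_of_ne_zero (t := nb (triangleEdges G S) S v) fun a ha hne => ?_).trans
    (sum_le_sum fun a ha => card_le_card fun u hu => ?_)
  · obtain ⟨u, hu⟩ := card_pos.1 (Nat.pos_of_ne_zero hne)
    simp only [mem_nb] at ha hu ⊢
    exact ⟨ha.1, ha.2, u, hu.1.1, hu.1.2, hu.2⟩
  · simp only [mem_nb] at ha hu ⊢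
    exact ⟨⟨hu.1.1, hu.1.2, a, ha.1, ha.2.1, hu.2.symm⟩, hu.2, v, hv, ha.2.1.symm, hu.1.2.symm⟩

lemma not_hasCycleIn_triangleEdges {m : ℕ} {S : Finset V} (hS : ¬ HasCycleIn G m S) :
    ¬ HasCycleIn (triangleEdges G S) m S := fun ⟨f, h1, h2, h3⟩ =>
  hS ⟨f, h1, fun _ _ h => (h2 h).1, h3⟩

lemma ec_nb_nb_triangleEdges_le {k : ℕ} (hk : 2 ≤ k) {S : Finset V}
    (hS : ¬ HasCycleIn G (2 * k + 1) S) {a b : V} (ha : a ∈ S) (hb : b ∈ S)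
    (hab : (triangleEdges G S).Adj a b) :
    ec (triangleEdges G S) (nb (triangleEdges G S) S a) (nb (triangleEdges G S) S b) ≤
      (2 * k + 1) * (2 * #S) := by
  by_contra! h
  obtain ⟨r, rfl⟩ : ∃ r, k = r + 2 := ⟨k - 2, by omega⟩
  refine not_hasCycleIn_triangleEdges hS ?_
  obtain ⟨hab', w, hw, haw, hbw⟩ := id hab
  have hF : #({a, b, w} : Finset V) ≤ 3 := card_le_three
  have hA := card_le_card (nb_subset (G := triangleEdges G S) S a)
  have hB := card_le_card (nb_subset (G := triangleEdges G S) S b)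
  obtain ⟨p, hp, hpT⟩ := exists_alternating_path {a, b, w} _ _ (2 * r + 1) (lt_of_le_of_lt
    (Nat.mul_le_mul (by omega) (by omega) :
      (2 * r + 1 + 1 + #({a, b, w} : Finset V)) * _ ≤ (2 * (r + 2) + 1) * (2 * #S)) h)
  have h0 := (hpT 0 (by omega)).1
  have h1 := (hpT (2 * r + 1) (by omega)).1
  rw [if_pos (by simp), mem_nb] at h0
  rw [if_neg (by simp), mem_nb] at h1
  refine hp.hasCycleIn_three (x := a) (y := b) (z := w) (fun i hi => ?_)
    (fun i hi => (hpT i hi).2) ha hb hw hab.ne ⟨hbw, a, ha, hab'.symm, haw.symm⟩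
    ⟨haw.symm, b, hb, hbw.symm, hab'⟩ h0.2 h1.2.symm
  have := (hpT i hi).1
  split_ifs at this
  exacts [nb_subset _ _ this, nb_subset _ _ this]

end Inequalities

/-- Sets without odd cycles of a fixed length span few triangles. -/
lemma exists_tc_le {k : ℕ} (hk : 1 ≤ k) {ε : ℝ} (hε : 0 < ε) :
    ∃ N : ℕ, ∀ n ≥ N, ∀ (V : Type) (G : SimpleGraph V) (S : Finset V), #S ≤ n →
      ¬ HasCycleIn G (2 * k + 1) S → (tc G S : ℝ) ≤ ε * n ^ 2 := by
  rcases hk.eq_or_lt with rfl | hk2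
  · refine ⟨0, fun n _ V G S _ hS => ?_⟩
    rw [tc_eq_zero_of_not_hasCycleIn_three hS, Nat.cast_zero]
    positivity
  have hk0 : (0 : ℝ) < k := by exact_mod_cast hk
  obtain ⟨N, hN⟩ := exists_nat_gt (2 * (2 * k + 1) * (4 * k / ε) ^ 4)
  refine ⟨N, fun n hn V G S hSn hS => ?_⟩
  have hn' : 2 * (2 * k + 1) * (4 * k / ε) ^ 4 < (n : ℝ) := hN.trans_le (by exact_mod_cast hn)
  have hn0 : (0 : ℝ) < n := lt_of_le_of_lt (by positivity) hn'
  set H := triangleEdges G S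
  have h1 : tc G S ≤ 4 * k * ec H S S := by
    refine (tc_le_tc_triangleEdges S).trans ?_
    rw [ec, mul_sum]
    exact sum_le_sum fun v hv => ec_nb_le hk (not_hasCycleIn_triangleEdges hS) hv
  have h2 := ec_pow_four_le (G := H) S _ fun a ha b hb hab =>
    ec_nb_nb_triangleEdges_le hk2 hS ha hb hab
  by_contra! h3
  have h4 : ε / (4 * k) * n ^ 2 < (ec H S S : ℝ) := by
    have : (tc G S : ℝ) ≤ 4 * k * ec H S S := by exact_mod_cast h1
    rw [div_mul_eq_mul_div, div_lt_iff₀ (by positivity)]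
    linarith
  have h5 : (ec H S S : ℝ) ^ 4 ≤ (2 * k + 1) * (2 * n) * n ^ 6 := by
    have h2' : (ec H S S : ℝ) ^ 4 ≤ (2 * k + 1) * (2 * #S) * #S ^ 6 := by exact_mod_cast h2
    have : (#S : ℝ) ≤ n := by exact_mod_cast hSn
    exact h2'.trans (by gcongr)
  have h6 : (ε / (4 * k) * n ^ 2) ^ 4 < (ec H S S : ℝ) ^ 4 := by
    gcongr
  have h7 : (ε / (4 * k)) ^ 4 * n < (2 * k + 1) * 2 := by
    refine lt_of_mul_lt_mul_right (a := (n : ℝ) ^ 7) ?_ (by positivity)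
    nlinarith
  have h8 : (4 * k / ε) ^ 4 * ((ε / (4 * k)) ^ 4 * n) = (n : ℝ) := by
    rw [← mul_assoc, ← mul_pow]
    field_simp
  have h9 : (4 * k / ε) ^ 4 * ((ε / (4 * k)) ^ 4 * n) < (4 * k / ε) ^ 4 * ((2 * k + 1) * 2) := by
    gcongr
  linarith

section Structure

variable {V : Type*} {G : SimpleGraph V}

lemma ec_union_left_le (A B C : Finset V) : ec G (A ∪ B) C ≤ ec G A C + ec G B C := by
  have := sum_union_inter (s₁ := A) (s₂ := B) (f := fun a => #(nb G C a))
  simp only [ec]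
  omega

lemma ec_union_right_le (A B C : Finset V) : ec G C (A ∪ B) ≤ ec G C A + ec G C B := by
  rw [ec_comm C, ec_comm C, ec_comm C]
  exact ec_union_left_le A B C

/-- Passing to a subset does not increase the number of non-neighbours. -/
lemma card_add_card_nb_le {B T : Finset V} (hT : T ⊆ B) (a : V) :
    #T + #(nb G B a) ≤ #(nb G T a) + #B := by
  have h1 := card_filter_add_card_filter_not (s := T) (G.Adj a)
  have h2 := card_filter_add_card_filter_not (s := B) (G.Adj a)
  have h3 := card_le_card (filter_subset_filter (fun u => ¬ G.Adj a u) hT)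
  simp only [nb]
  omega

lemma card_filter_deficit_le (A B : Finset V) {M K : ℝ} (hM : 0 < M)
    (h : (#A : ℝ) * #B - ec G A B ≤ M * K) :
    (#(A.filter fun a => ¬ (#B : ℝ) ≤ #(nb G B a) + M) : ℝ) ≤ K := by
  have h1 : ∑ a ∈ A, ((#B : ℝ) - #(nb G B a)) = (#A : ℝ) * #B - ec G A B := by
    simp [ec, sum_sub_distrib]
  have h2 : ∑ a ∈ A.filter (fun a => ¬ (#B : ℝ) ≤ #(nb G B a) + M), M ≤
      ∑ a ∈ A, ((#B : ℝ) - #(nb G B a)) := by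
    refine (sum_le_sum fun a ha => ?_).trans (sum_le_sum_of_subset_of_nonneg
      (f := fun a => (#B : ℝ) - #(nb G B a)) (filter_subset _ _) fun a _ _ => ?_)
    · have := (mem_filter.1 ha).2
      linarith
    · have : (#(nb G B a) : ℝ) ≤ #B := by exact_mod_cast card_le_card (nb_subset B a)
      linarith
  rw [sum_const, nsmul_eq_mul] at h2
  refine le_of_mul_le_mul_left ?_ hM
  linarith

/-- An alternating path with prescribed end sets between two sets that are almost completely
joined. -/
lemma exists_path_between {A B X Y F : Finset V} {M D r : ℕ} (hr : 1 ≤ r)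
    (hAB : ∀ a ∈ A, #B ≤ #(nb G B a) + M) (hBA : ∀ b ∈ B, #A ≤ #(nb G A b) + M)
    (hX : X ⊆ A) (hY : Y ⊆ if Even r then A else B) (hXc : M + D ≤ #X) (hYc : M + D ≤ #Y)
    (hAc : M + D ≤ #A) (hBc : M + D ≤ #B) (hD : r + 1 + #F ≤ D) :
    ∃ p, IsPathSeq G (r + 1) p ∧ p 0 ∈ X ∧ p r ∈ Y ∧ ∀ i < r + 1, p i ∈ A ∪ B ∧ p i ∉ F := by
  set T : ℕ → Finset V := fun i => if i = 0 then X else if i = r then Y else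
    if Even i then A else B with hT
  have hsub : ∀ i, T i ⊆ if Even i then A else B := by
    intro i
    simp only [hT]
    by_cases h0 : i = 0
    · simpa [h0] using hX
    by_cases h1 : i = r
    · simpa [h0, h1, show r ≠ 0 by omega] using hY
    simp [h0, h1]
  have hcard : ∀ i, M + D ≤ #(T i) := by
    intro i
    simp only [hT]
    split_ifs <;> assumption
  obtain ⟨p, hp, hpT⟩ := exists_isPathSeq (G := G) F T D r hD (by have := hcard 0; omega) (by
    intro i _ u hu
    have h1 := hcard (i + 1)
    have h2 := card_add_card_nb_le (G := G) (hsub (i + 1)) u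
    have h3 := hsub i hu
    by_cases hi : Even i
    · have hi' : ¬ Even (i + 1) := by rwa [Nat.even_add_one, not_not]
      rw [if_pos hi] at h3
      rw [if_neg hi'] at h2
      have := hAB u h3
      omega
    · have hi' : Even (i + 1) := by rwa [Nat.even_add_one]
      rw [if_neg hi] at h3
      rw [if_pos hi'] at h2
      have := hBA u h3
      omega)
  refine ⟨p, hp, ?_, ?_, fun i hi => ⟨?_, (hpT i hi).2⟩⟩
  · simpa [hT] using (hpT 0 (by omega)).1
  · simpa [hT, show r ≠ 0 by omega] using (hpT r (by omega)).1
  · have := hsub i (hpT i hi).1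
    rw [mem_union]
    split_ifs at this
    exacts [Or.inl this, Or.inr this]

/-- A triangle with two vertices of large degree yields an odd cycle through an almost complete
pair. -/
lemma hasCycleIn_of_triangle {k : ℕ} (hk : 2 ≤ k) {S A B : Finset V} {M : ℕ}
    (hA : A ⊆ S) (hB : B ⊆ S)
    (hAB : ∀ a ∈ A, #B ≤ #(nb G B a) + M) (hBA : ∀ b ∈ B, #A ≤ #(nb G A b) + M)
    (hAc : M + (2 * k + 1) ≤ #A) (hBc : M + (2 * k + 1) ≤ #B)
    {x y z : V} (hx : x ∈ S) (hy : y ∈ S) (hz : z ∈ S) (hxy : G.Adj x y) (hyz : G.Adj y z)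
    (hzx : G.Adj z x) (hX : M + (2 * k + 1) ≤ #(nb G A x))
    (hY : M + (2 * k + 1) ≤ #(nb G A y) ∨ M + (2 * k + 1) ≤ #(nb G B y)) :
    HasCycleIn G (2 * k + 1) S := by
  obtain ⟨r, rfl⟩ : ∃ r, k = r + 2 := ⟨k - 2, by omega⟩
  have hF2 : #({x, y} : Finset V) ≤ 2 := card_le_two
  have hF3 : #({x, y, z} : Finset V) ≤ 3 := card_le_three
  have hABS : ∀ u, u ∈ A ∪ B → u ∈ S := fun u hu => union_subset hA hB hu
  rcases hY with hY | hY
  · obtain ⟨p, hp, hp0, hpr, hpF⟩ := exists_path_between (G := G) (F := {x, y})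
      (r := 2 * r + 2) (Y := nb G A y) (by omega) hAB hBA (nb_subset A x)
      (by rw [if_pos (by simp [parity_simps])]; exact nb_subset A y) hX hY hAc hBc (by omega)
    rw [mem_nb] at hp0 hpr
    exact hp.hasCycleIn_two (x := x) (y := y) (fun i hi => hABS _ (hpF i hi).1)
      (fun i hi => (hpF i hi).2) hx hy hxy.symm hp0.2 hpr.2.symm
  · obtain ⟨p, hp, hp0, hpr, hpF⟩ := exists_path_between (G := G) (F := {x, y, z})
      (r := 2 * r + 1) (Y := nb G B y) (by omega) hAB hBA (nb_subset A x)
      (by rw [if_neg (by simp)]; exact nb_subset B y) hX hY hAc hBc (by omega)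
    rw [mem_nb] at hp0 hpr
    exact hp.hasCycleIn_three (x := x) (y := y) (z := z) (fun i hi => hABS _ (hpF i hi).1)
      (fun i hi => (hpF i hi).2) hx hy hz hxy.ne hyz hzx hp0.2 hpr.2.symm

/-- Two adjacent vertices whose neighbourhoods cover most of a dense set with sparse links give
an almost complete pair. -/
lemma exists_dense_pair {k : ℕ} (hk : 1 ≤ k) {S : Finset V}
    (hS : ¬ HasCycleIn G (2 * k + 1) S) {ε : ℝ} (hm : 8 * k ≤ ε * #S)
    (hE : (#S : ℝ) ^ 2 / 2 - 3 * ε * #S ^ 2 ≤ ec G S S) {a b : V} (ha : a ∈ S) (hb : b ∈ S)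
    (hab : (1 - 7 * ε) * #S ≤ #(nb G S a ∪ nb G S b)) :
    ∃ A ⊆ S, ∃ B ⊆ S, (#(S \ (A ∪ B)) : ℝ) ≤ 7 * ε * #S ∧
      (#S : ℝ) ^ 2 / 4 - 9 * ε * #S ^ 2 ≤ ec G A B ∧ (#A : ℝ) * #B - ec G A B ≤ 9 * ε * #S ^ 2 := by
  set A := nb G S b
  set B := nb G S a \ nb G S b
  have hAS : A ⊆ S := nb_subset S b
  have hBS : B ⊆ S := sdiff_subset.trans (nb_subset S a)
  have hun : A ∪ B = nb G S a ∪ nb G S b := by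
    rw [union_sdiff_self_eq_union, union_comm]
  have hABcard : #A + #B ≤ #S := by
    rw [← card_union_of_disjoint disjoint_sdiff]
    exact card_le_card (union_subset hAS hBS)
  have hC : (#(S \ (A ∪ B)) : ℝ) ≤ 7 * ε * #S := by
    rw [cast_card_sdiff (union_subset hAS hBS), hun]
    linarith
  have hEA : ec G A A ≤ 4 * k * #S :=
    (ec_nb_le hk hS hb).trans (Nat.mul_le_mul_left _ (card_le_card hAS))
  have hEB : ec G B B ≤ 4 * k * #S :=
    (ec_mono sdiff_subset sdiff_subset).trans ((ec_nb_le hk hS ha).trans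
      (Nat.mul_le_mul_left _ (card_le_card (nb_subset S a))))
  have hsplit : ec G S S ≤ 8 * k * #S + 2 * ec G A B + 2 * (#(S \ (A ∪ B)) * #S) := by
    set C := S \ (A ∪ B)
    have hSeq : S = (A ∪ B) ∪ C := (union_sdiff_of_subset (union_subset hAS hBS)).symm
    have h1 : ec G S S ≤ ec G (A ∪ B) S + ec G C S := by
      conv_lhs => rw [hSeq]
      exact (ec_mono Subset.rfl hSeq.symm.subset).trans (ec_union_left_le _ _ _)
    have h2 : ec G (A ∪ B) S ≤ ec G (A ∪ B) (A ∪ B) + ec G (A ∪ B) C := by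
      conv_lhs => rw [hSeq]
      rw [← hSeq]
      exact (ec_mono Subset.rfl hSeq.subset).trans (ec_union_right_le _ _ _)
    have h3 : ec G (A ∪ B) C ≤ #C * #S := by
      rw [ec_comm]
      exact (ec_le_mul _ _).trans (Nat.mul_le_mul_left _ (card_le_card (union_subset hAS hBS)))
    have h4 := ec_le_mul (G := G) C S
    have h5 := ec_union_left_le (G := G) A B (A ∪ B)
    have h6 := ec_union_right_le (G := G) A B A
    have h7 := ec_union_right_le (G := G) A B B
    have h8 := ec_comm (G := G) B A
    linarith
  have hsplit' : (ec G S S : ℝ) ≤ 8 * k * #S + 2 * ec G A B + 2 * (#(S \ (A ∪ B)) * #S) := by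
    exact_mod_cast hsplit
  have hm0 : (0 : ℝ) ≤ #S := by positivity
  have hkm : 8 * k * (#S : ℝ) ≤ ε * #S ^ 2 := by nlinarith
  have hCm : (#(S \ (A ∪ B)) * #S : ℝ) ≤ 7 * ε * #S ^ 2 := by nlinarith
  have hEAB : (#S : ℝ) ^ 2 / 4 - 9 * ε * #S ^ 2 ≤ ec G A B := by linarith
  refine ⟨A, hAS, B, hBS, hC, hEAB, ?_⟩
  have : (#A : ℝ) + #B ≤ #S := by exact_mod_cast hABcard
  have h4 : 4 * ((#A : ℝ) * #B) ≤ #S ^ 2 := by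
    nlinarith [sq_nonneg ((#A : ℝ) - #B), (by positivity : (0 : ℝ) ≤ #A + #B)]
  linarith

/-- Cleaning up an almost complete pair. -/
lemma exists_good_pair {S A B : Finset V} {θ : ℝ} (hθ : 0 < θ) (hθ' : θ ≤ 1 / 100)
    (hS : 0 < #S) (hA : A ⊆ S) (hB : B ⊆ S) (hC : (#(S \ (A ∪ B)) : ℝ) ≤ θ * #S)
    (hE : (#S : ℝ) ^ 2 / 5 ≤ ec G A B)
    (hdef : (#A : ℝ) * #B - ec G A B ≤ θ ^ 2 * #S ^ 2) :
    ∃ A' ⊆ S, ∃ B' ⊆ S, (#(S \ (A' ∪ B')) : ℝ) ≤ 3 * θ * #S ∧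
      2 * θ * #S ≤ #A' ∧ 2 * θ * #S ≤ #B' ∧
      (∀ a ∈ A', (#B' : ℝ) ≤ #(nb G B' a) + θ * #S) ∧
      ∀ b ∈ B', (#A' : ℝ) ≤ #(nb G A' b) + θ * #S := by
  have hm : (0 : ℝ) < #S := by exact_mod_cast hS
  have hM : 0 < θ * #S := by positivity
  set A' := A.filter fun a => (#B : ℝ) ≤ #(nb G B a) + θ * #S with hA'
  set B' := B.filter fun b => (#A : ℝ) ≤ #(nb G A b) + θ * #S with hB'
  have hbA := card_filter_deficit_le (G := G) A B hM (K := θ * #S) (by linarith)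
  have hbB := card_filter_deficit_le (G := G) B A hM (K := θ * #S)
    (by rw [ec_comm]; linarith)
  have hcA : (#A' : ℝ) + #(A.filter fun a => ¬ (#B : ℝ) ≤ #(nb G B a) + θ * #S) = #A := by
    exact_mod_cast card_filter_add_card_filter_not _
  have hcB : (#B' : ℝ) + #(B.filter fun b => ¬ (#A : ℝ) ≤ #(nb G A b) + θ * #S) = #B := by
    exact_mod_cast card_filter_add_card_filter_not _
  have hAm : (#A : ℝ) ≤ #S := by exact_mod_cast card_le_card hA
  have hBm : (#B : ℝ) ≤ #S := by exact_mod_cast card_le_card hB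
  have hprod : (ec G A B : ℝ) ≤ #A * #B := by exact_mod_cast ec_le_mul A B
  have hA5 : (#S : ℝ) / 5 ≤ #A := by
    refine le_of_mul_le_mul_right ?_ hm
    nlinarith [(by positivity : (0 : ℝ) ≤ #A)]
  have hB5 : (#S : ℝ) / 5 ≤ #B := by
    refine le_of_mul_le_mul_right ?_ hm
    nlinarith [(by positivity : (0 : ℝ) ≤ #B)]
  have hθm : θ * #S ≤ 1 / 100 * #S := by gcongr
  refine ⟨A', (filter_subset _ _).trans hA, B', (filter_subset _ _).trans hB, ?_, ?_, ?_, ?_, ?_⟩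
  · have hsub : S \ (A' ∪ B') ⊆ (S \ (A ∪ B)) ∪
        ((A.filter fun a => ¬ (#B : ℝ) ≤ #(nb G B a) + θ * #S) ∪
          (B.filter fun b => ¬ (#A : ℝ) ≤ #(nb G A b) + θ * #S)) := by
      intro u hu
      simp only [hA', hB', mem_sdiff, mem_union, mem_filter] at hu ⊢
      tauto
    have h1 := (card_le_card hsub).trans (card_union_le _ _)
    have h2 := card_union_le (A.filter fun a => ¬ (#B : ℝ) ≤ #(nb G B a) + θ * #S)
      (B.filter fun b => ¬ (#A : ℝ) ≤ #(nb G A b) + θ * #S)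
    have h3 : (#(S \ (A' ∪ B')) : ℝ) ≤ #(S \ (A ∪ B)) +
        (#(A.filter fun a => ¬ (#B : ℝ) ≤ #(nb G B a) + θ * #S) +
          #(B.filter fun b => ¬ (#A : ℝ) ≤ #(nb G A b) + θ * #S)) := by
      exact_mod_cast h1.trans (Nat.add_le_add_left h2 _)
    linarith
  · linarith
  · linarith
  · intro a ha
    have h1 := (mem_filter.1 ha).2
    have h2 : (#B' : ℝ) + #(nb G B a) ≤ #(nb G B' a) + #B := by
      exact_mod_cast card_add_card_nb_le (filter_subset _ _) a
    linarith
  · intro b hb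
    have h1 := (mem_filter.1 hb).2
    have h2 : (#A' : ℝ) + #(nb G A b) ≤ #(nb G A' b) + #A := by
      exact_mod_cast card_add_card_nb_le (filter_subset _ _) b
    linarith

/-- In an odd-cycle-free set with an almost complete pair and large minimum degree there is no
triangle. -/
lemma tc_eq_zero_of_good_pair {k : ℕ} (hk : 2 ≤ k) {S A B : Finset V}
    (hS : ¬ HasCycleIn G (2 * k + 1) S) {θ : ℝ} (hθ : 0 < θ) (hm : 2 * k + 1 ≤ θ * #S)
    (hA : A ⊆ S) (hB : B ⊆ S) (hC : (#(S \ (A ∪ B)) : ℝ) ≤ 3 * θ * #S)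
    (hAc : 2 * θ * #S ≤ #A) (hBc : 2 * θ * #S ≤ #B)
    (hAB : ∀ a ∈ A, (#B : ℝ) ≤ #(nb G B a) + θ * #S)
    (hBA : ∀ b ∈ B, (#A : ℝ) ≤ #(nb G A b) + θ * #S)
    (hdeg : ∀ v ∈ S, 7 * θ * #S ≤ #(nb G S v)) : tc G S = 0 := by
  set M := ⌊θ * #S⌋₊
  have hMle : (M : ℝ) ≤ θ * #S := Nat.floor_le (by positivity)
  have hto : ∀ s : ℕ, 2 * θ * #S ≤ s → M + (2 * k + 1) ≤ s := by
    intro s hs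
    have : ((M + (2 * k + 1) : ℕ) : ℝ) ≤ s := by push_cast; linarith
    exact_mod_cast this
  have hfl : ∀ s t : ℕ, (s : ℝ) ≤ t + θ * #S → s ≤ t + M := by
    intro s t h
    rcases le_total s t with hst | hst
    · omega
    · have : s - t ≤ M := Nat.le_floor (by rw [Nat.cast_sub hst]; linarith)
      omega
  have hside : ∀ v ∈ S, M + (2 * k + 1) ≤ #(nb G A v) ∨ M + (2 * k + 1) ≤ #(nb G B v) := by
    intro v hv
    have hsub : nb G S v ⊆ (S \ (A ∪ B)) ∪ (nb G A v ∪ nb G B v) := by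
      intro u hu
      simp only [mem_nb, mem_union, mem_sdiff] at hu ⊢
      tauto
    have h1 := (card_le_card hsub).trans (card_union_le _ _)
    have h2 := card_union_le (nb G A v) (nb G B v)
    have h3 : (#(nb G S v) : ℝ) ≤ #(S \ (A ∪ B)) + (#(nb G A v) + #(nb G B v)) := by
      exact_mod_cast h1.trans (Nat.add_le_add_left h2 _)
    have h4 := hdeg v hv
    rcases le_total (2 * θ * #S) (#(nb G A v) : ℝ) with h | h
    · exact Or.inl (hto _ h)
    · exact Or.inr (hto _ (by linarith))
  refine tc_eq_zero fun x hx y hy z hz hxy hyz hzx => hS ?_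
  have hAB' := fun a ha => hfl _ _ (hAB a ha)
  have hBA' := fun b hb => hfl _ _ (hBA b hb)
  rcases hside x hx with h | h
  · exact hasCycleIn_of_triangle hk hA hB hAB' hBA' (hto _ hAc) (hto _ hBc) hx hy hz hxy hyz hzx
      h (hside y hy)
  · exact hasCycleIn_of_triangle hk hB hA hBA' hAB' (hto _ hBc) (hto _ hAc) hx hy hz hxy hyz hzx
      h (hside y hy).symm

/-- Successive deletion of vertices of small degree. -/
lemma exists_core {k : ℕ} (hk : 1 ≤ k) (N : ℕ) (S : Finset V)
    (hS : ¬ HasCycleIn G (2 * k + 1) S) :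
    ∃ S' ⊆ S, (#S' < N ∨ ∀ v ∈ S', #S' ≤ (2 + 24 * k) * #(nb G S' v) + 1) ∧
      (2 * ec G S S + 4 * tc G S : ℤ) - #S ^ 2 + 2 * (#S - #S') ≤
        2 * ec G S' S' + 4 * tc G S' - #S' ^ 2 := by
  induction hn : #S using Nat.strong_induction_on generalizing S with
  | _ n ih =>
    subst hn
    by_cases hmin : ∀ v ∈ S, #S ≤ (2 + 24 * k) * #(nb G S v) + 1
    · exact ⟨S, Subset.rfl, Or.inr hmin, by simp⟩
    push Not at hmin
    obtain ⟨v, hv, hdv⟩ := hmin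
    obtain ⟨S', hS', hor, hφ⟩ := ih _ (card_erase_lt_of_mem hv) (S.erase v)
      (fun h => hS (h.mono (erase_subset _ _))) rfl
    refine ⟨S', hS'.trans (erase_subset _ _), hor, ?_⟩
    have h1 := ec_le_erase (G := G) hv
    have h2 := tc_le_erase (G := G) hv
    have h3 := ec_nb_le hk hS hv
    have h4 : (#S : ℤ) = #(S.erase v) + 1 := by exact_mod_cast (card_erase_add_one hv).symm
    zify at h1 h2 h3 hdv
    rw [h4] at hdv ⊢
    nlinarith

end Structure

lemma exists_tc_eq_zero_of_min_degree {k : ℕ} (hk : 2 ≤ k) :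
    ∃ N : ℕ, ∀ (V : Type) (G : SimpleGraph V) (S : Finset V), N ≤ #S →
      ¬ HasCycleIn G (2 * k + 1) S → #S ^ 2 ≤ 2 * ec G S S + 4 * tc G S + 1 →
      (∀ v ∈ S, #S ≤ (2 + 24 * k) * #(nb G S v) + 1) → tc G S = 0 := by
  have hk0 : (2 : ℝ) ≤ k := by exact_mod_cast hk
  set θ : ℝ := 1 / (7 * (4 + 48 * k)) with hθdef
  have hθ : 0 < θ := by positivity
  have hθ' : θ ≤ 1 / 100 := one_div_le_one_div_of_le (by norm_num) (by linarith)
  set ε : ℝ := θ ^ 2 / 9 with hεdef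
  have hε : 0 < ε := by positivity
  have hε7 : 7 * ε ≤ θ := by nlinarith
  have hε9 : 9 * ε ≤ 1 / 100 := by nlinarith
  obtain ⟨N₁, hN₁⟩ := exists_tc_le (by omega : 1 ≤ k) hε
  obtain ⟨N₂, hN₂⟩ := exists_nat_gt (8 * k / ε)
  obtain ⟨N₃, hN₃⟩ := exists_nat_gt ((2 * k + 1) / θ)
  refine ⟨max N₁ (max N₂ (max N₃ 5)), fun V G S hN hS hφ hdeg => ?_⟩
  simp only [max_le_iff] at hN
  obtain ⟨h1, h2, h3, h5⟩ := hN
  have hm5 : (5 : ℝ) ≤ #S := by exact_mod_cast h5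
  have hm2 : 8 * k ≤ ε * #S := by
    have : 8 * k / ε ≤ #S := hN₂.le.trans (by exact_mod_cast h2)
    rw [div_le_iff₀ hε] at this
    linarith
  have hm3 : 2 * k + 1 ≤ θ * #S := by
    have : (2 * k + 1) / θ ≤ #S := hN₃.le.trans (by exact_mod_cast h3)
    rw [div_le_iff₀ hθ] at this
    linarith
  have hT := hN₁ _ h1 V G S le_rfl hS
  have hφ' : (#S : ℝ) ^ 2 ≤ 2 * ec G S S + 4 * tc G S + 1 := by exact_mod_cast hφ
  have hε1 : 1 ≤ ε * #S ^ 2 := by nlinarith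
  have hE : (#S : ℝ) ^ 2 / 2 - 3 * ε * #S ^ 2 ≤ ec G S S := by linarith
  have hsq : (0 : ℝ) < #S ^ 2 := by positivity
  have hE4 : (#S : ℝ) ^ 2 / 4 ≤ ec G S S := by nlinarith
  obtain ⟨a, ha, b, hb, hab⟩ : ∃ a ∈ S, ∃ b ∈ S,
      (1 - 7 * ε) * #S ≤ (#(nb G S a ∪ nb G S b) : ℝ) := by
    by_contra! hcon
    have hMM := two_mul_sq_ec_le (G := G) S ((1 - 7 * ε) * #S) fun a ha b hb _ => (hcon a ha b hb).le
    have e1 : (ec G S S : ℝ) * (ε * #S ^ 2) ≤ #S * tc G S := by nlinarith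
    have e2 : (#S : ℝ) * tc G S ≤ #S * (ε * #S ^ 2) := by gcongr
    have e3 : (ec G S S : ℝ) ≤ #S :=
      le_of_mul_le_mul_right (e1.trans e2) (by positivity)
    nlinarith
  obtain ⟨A₀, hA₀, B₀, hB₀, hC₀, hE₀, hdef⟩ :=
    exists_dense_pair (by omega) hS hm2 hE ha hb hab
  obtain ⟨A, hA, B, hB, hC, hAc, hBc, hAB, hBA⟩ := exists_good_pair hθ hθ' (by omega) hA₀ hB₀
    (hC₀.trans (by gcongr)) (by nlinarith) (hdef.trans (by rw [hεdef]; linarith))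
  refine tc_eq_zero_of_good_pair hk hS hθ hm3 hA hB hC hAc hBc hAB hBA fun v hv => ?_
  have hd : (#S : ℝ) ≤ (2 + 24 * k) * #(nb G S v) + 1 := by exact_mod_cast hdeg v hv
  have : 7 * θ * #S = #S / (4 + 48 * k) := by
    rw [hθdef]
    field_simp
  rw [this, div_le_iff₀ (by positivity)]
  linarith

/-- Odd-cycle-free sets with at least as many edges and triangles as a balanced complete
bipartite graph has edges are triangle-free. -/
lemma exists_tc_eq_zero {k : ℕ} (hk : 1 ≤ k) :
    ∃ N : ℕ, ∀ (V : Type) (G : SimpleGraph V) (S : Finset V), N ≤ #S →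
      ¬ HasCycleIn G (2 * k + 1) S → #S ^ 2 ≤ 2 * ec G S S + 4 * tc G S + 1 → tc G S = 0 := by
  rcases hk.eq_or_lt with rfl | hk2
  · exact ⟨0, fun V G S _ hS _ => tc_eq_zero_of_not_hasCycleIn_three hS⟩
  obtain ⟨N, hN⟩ := exists_tc_eq_zero_of_min_degree hk2
  refine ⟨N + N ^ 2 + 2 * N ^ 3 + 2, fun V G S hSN hS hφ => ?_⟩
  obtain ⟨S', hS', hor, hφ'⟩ := exists_core hk N S hS
  have hcard := card_le_card hS'
  zify at hφ hSN hcard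
  rcases lt_or_ge #S' N with hlt | hge
  · have h1 : ec G S' S' ≤ N ^ 2 := by
      refine (ec_le_mul _ _).trans ?_
      rw [sq]
      exact Nat.mul_le_mul hlt.le hlt.le
    have h2 : tc G S' ≤ N ^ 3 := by
      have : tc G S' ≤ #S' * (#S' * #S') := by
        rw [tc, ← smul_eq_mul]
        exact sum_le_card_nsmul _ _ _ fun v _ => (ec_le_mul _ _).trans
          (Nat.mul_le_mul (card_le_card (nb_subset _ _)) (card_le_card (nb_subset _ _)))
      refine this.trans ?_
      rw [pow_succ', sq]
      exact Nat.mul_le_mul hlt.le (Nat.mul_le_mul hlt.le hlt.le)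
    zify at h1 h2 hlt
    nlinarith
  · have hmin := hor.resolve_left (not_lt.2 hge)
    have h0 : tc G S' = 0 := by
      refine hN V G S' hge (fun h => hS (h.mono hS')) ?_ hmin
      zify
      linarith
    have h1 := two_mul_ec_le h0
    zify at h1
    have : S' = S := by
      refine eq_of_subset_of_card_le hS' ?_
      rw [h0] at hφ'
      push_cast at hφ'
      have : (#S : ℤ) - #S' < 1 := by linarith
      omega
    rwa [← this]

/-! ### Disjoint cycles -/

section Families

variable {V : Type*} {G : SimpleGraph V}

/-- `G` has `c` pairwise disjoint cycles of length `m` avoiding `F`. -/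
def HasCycleFamily (G : SimpleGraph V) (c m : ℕ) (F : Finset V) : Prop :=
  ∃ f : Fin c → Fin m → V,
    (∀ j, Function.Injective (f j)) ∧
    (∀ j, ∀ ⦃i i'⦄, (cycleGraph m).Adj i i' → G.Adj (f j i) (f j i')) ∧
    (Pairwise fun j j' => Disjoint (Set.range (f j)) (Set.range (f j'))) ∧
    ∀ j i, f j i ∉ F

lemma HasCycleFamily.hasDisjointCycles {c m : ℕ} {F : Finset V} (h : HasCycleFamily G c m F) :
    HasDisjointCycles G c m := by
  obtain ⟨f, h1, h2, h3, -⟩ := h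
  exact ⟨f, h1, h2, h3⟩

lemma hasCycleFamily_zero (m : ℕ) (F : Finset V) : HasCycleFamily G 0 m F :=
  ⟨fun j => j.elim0, fun j => j.elim0, fun j => j.elim0, fun j => j.elim0, fun j => j.elim0⟩

lemma HasCycleFamily.cons {c m : ℕ} {F : Finset V} {g : Fin m → V} (hg : Function.Injective g)
    (hadj : ∀ ⦃i i'⦄, (cycleGraph m).Adj i i' → G.Adj (g i) (g i')) (hgF : ∀ i, g i ∉ F)
    (h : HasCycleFamily G c m (F ∪ univ.image g)) : HasCycleFamily G (c + 1) m F := by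
  obtain ⟨f, h1, h2, h3, h4⟩ := h
  simp only [mem_union, mem_image, mem_univ, true_and, not_or, not_exists] at h4
  refine ⟨Fin.cons g f, ?_, ?_, ?_, ?_⟩
  · exact Fin.cases hg h1
  · exact Fin.cases hadj h2
  · have key : ∀ j, Disjoint (Set.range g) (Set.range (f j)) := by
      intro j
      rw [Set.disjoint_left]
      rintro _ ⟨i, rfl⟩ ⟨i', hi'⟩
      exact (h4 j i').2 i hi'.symm
    intro j j'
    refine Fin.cases ?_ (fun j => ?_) j <;> refine Fin.cases ?_ (fun j' => ?_) j'
    · exact fun h => (h rfl).elim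
    · exact fun _ => key j'
    · exact fun _ => (key j).symm
    · exact fun h => h3 (i := j) (j := j') fun e => h (congrArg Fin.succ e)
  · exact Fin.cases hgF fun j i => (h4 j i).1

variable [Fintype V]

/-- Few vertices meet all cycles of length `m` when there are few disjoint ones. -/
lemma exists_cycle_cover {m : ℕ} (c : ℕ) (F : Finset V) (h : ¬ HasCycleFamily G c m F) :
    ∃ W : Finset V, #W ≤ m * c ∧ ¬ HasCycleIn G m (F ∪ W)ᶜ := by
  induction c generalizing F with
  | zero => exact (h (hasCycleFamily_zero m F)).elim
  | succ c ih =>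
    by_cases hcyc : HasCycleIn G m Fᶜ
    · obtain ⟨g, h1, h2, h3⟩ := hcyc
      obtain ⟨W, hW, hW'⟩ := ih (F ∪ univ.image g) fun hf =>
        h (hf.cons h1 h2 fun i => mem_compl.1 (h3 i))
      refine ⟨univ.image g ∪ W, ?_, by rwa [← union_assoc]⟩
      have h4 := card_union_le (univ.image g) W
      have h5 : #(univ.image g) ≤ m := card_image_le.trans (by simp)
      rw [mul_add_one]
      omega
    · exact ⟨∅, by simp, by simpa using hcyc⟩

/-- Vertices with dense links give disjoint cycles. -/
lemma hasCycleFamily_of_dense_links {k q : ℕ} (hk : 1 ≤ k) (c : ℕ) (L F : Finset V)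
    (hL : #L = c) (hLF : Disjoint L F) (hq : #F + (2 * k + 1) * c ≤ q)
    (hdense : ∀ v ∈ L, (2 * k + q) * (2 * #(nb G univ v)) < ec G (nb G univ v) (nb G univ v)) :
    HasCycleFamily G c (2 * k + 1) F := by
  induction c generalizing L F with
  | zero => exact hasCycleFamily_zero _ _
  | succ c ih =>
    obtain ⟨r, rfl⟩ : ∃ r, k = r + 1 := ⟨k - 1, by omega⟩
    obtain ⟨v, hv⟩ := card_pos.1 (by omega : 0 < #L)
    have hLe := card_erase_of_mem hv
    have hFc := card_union_le F (L.erase v)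
    have hvF : v ∉ F := disjoint_left.1 hLF hv
    have hle : 2 * r + 1 + 1 + #(F ∪ L.erase v) ≤ 2 * (r + 1) + q := by
      have : c ≤ (2 * (r + 1) + 1) * c := Nat.le_mul_of_pos_left _ (by omega)
      rw [mul_add_one] at hq
      omega
    obtain ⟨g, h1, h2, h3⟩ := hasCycleIn_of_dense_link (G := G) (F := F ∪ L.erase v)
      (mem_univ v) (by simp [hvF]) (2 * r + 1)
      (lt_of_le_of_lt (Nat.mul_le_mul_right _ hle) (hdense v hv))
    simp only [mem_sdiff, mem_univ, mem_union, not_or, true_and] at h3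
    refine HasCycleFamily.cons h1 h2 (fun i => (h3 i).1) (ih (L.erase v) _ (by omega) ?_ ?_
      fun u hu => hdense u (mem_of_mem_erase hu))
    · rw [disjoint_union_right]
      refine ⟨hLF.mono_left (erase_subset _ _), ?_⟩
      rw [disjoint_right]
      intro u hu
      obtain ⟨i, -, rfl⟩ := mem_image.1 hu
      exact (h3 i).2
    · have h4 := card_union_le F (univ.image g)
      have h5 : #(univ.image g) ≤ 2 * (r + 1) + 1 :=
        card_image_le.trans (by rw [card_univ, Fintype.card_fin]; omega)
      rw [mul_add_one] at hq
      omega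

end Families

/-! ### Counting triangles relative to a vertex set -/

section Cliques

variable {V : Type*} {G : SimpleGraph V}

/-- The cliques of size `j` contained in `S`. -/
noncomputable def cliquesIn (G : SimpleGraph V) (j : ℕ) (S : Finset V) : Finset (Finset V) :=
  (S.powersetCard j).filter fun K => G.IsClique K

lemma two_mul_card_cliquesIn_two_le (S : Finset V) : 2 * #(cliquesIn G 2 S) ≤ ec G S S := by
  set P := S.sigma fun a => nb G S a
  have hP : #P = ec G S S := card_sigma _ _
  have hsub : ∀ K ∈ cliquesIn G 2 S,
      2 ≤ #(P.filter fun p : (_ : V) × V => ({p.1, p.2} : Finset V) = K) := by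
    intro K hK
    simp only [cliquesIn, mem_filter, mem_powersetCard] at hK
    obtain ⟨⟨hKS, hK2⟩, hcl⟩ := hK
    obtain ⟨x, y, hxy, rfl⟩ := card_eq_two.1 hK2
    have hadj : G.Adj x y := hcl (by simp) (by simp) hxy
    have hx : x ∈ S := hKS (by simp)
    have hy : y ∈ S := hKS (by simp)
    have hne : (⟨x, y⟩ : (_ : V) × V) ≠ ⟨y, x⟩ := fun h => hxy (congrArg Sigma.fst h)
    rw [← card_pair hne]
    refine card_le_card fun p hp => ?_
    rw [mem_insert, mem_singleton] at hp
    rcases hp with rfl | rfl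
    · simp [P, mem_nb, hx, hy, hadj]
    · simp [P, mem_nb, hx, hy, hadj.symm, pair_comm]
  rw [← hP, mul_comm, ← smul_eq_mul]
  refine (card_nsmul_le_sum _ _ _ hsub).trans ?_
  rw [sum_card_fiberwise_eq_card_filter]
  exact card_filter_le _ _

lemma card_cliquesIn_three_le (S : Finset V) : #(cliquesIn G 3 S) ≤ tc G S := by
  have hsub : cliquesIn G 3 S ⊆ S.biUnion fun v => (nb G S v).biUnion fun a =>
      (nb G (nb G S v) a).image fun u => {v, a, u} := by
    intro K hK
    simp only [cliquesIn, mem_filter, mem_powersetCard] at hK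
    obtain ⟨⟨hKS, hK3⟩, hcl⟩ := hK
    obtain ⟨x, y, z, hxy, hxz, hyz, rfl⟩ := card_eq_three.1 hK3
    simp only [mem_biUnion, mem_image, mem_nb]
    exact ⟨x, hKS (by simp), y, ⟨hKS (by simp), hcl (by simp) (by simp) hxy⟩, z,
      ⟨⟨hKS (by simp), hcl (by simp) (by simp) hxz⟩, hcl (by simp) (by simp) hyz⟩, rfl⟩
  exact (card_le_card hsub).trans (card_biUnion_le.trans (sum_le_sum fun v _ =>
    card_biUnion_le.trans (sum_le_sum fun a _ => card_image_le)))

variable [Fintype V]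

lemma triangleCount_eq : triangleCount G = #(cliquesIn G 3 univ) := by
  rw [triangleCount, ← Set.ncard_coe_finset]
  congr 1
  ext K
  simp [cliquesIn, mem_powersetCard, isNClique_iff, and_comm]

/-- An upper bound for the number of triangles by their intersection with `L`. -/
lemma two_mul_triangleCount_le (L : Finset V) :
    2 * triangleCount G ≤ 2 * (#L).choose 3 + 2 * ((#L).choose 2 * #Lᶜ) +
      #L * ec G Lᶜ Lᶜ + 2 * tc G Lᶜ := by
  have hsub : cliquesIn G 3 univ ⊆ (range 4).biUnion fun j =>
      (L.powersetCard j ×ˢ cliquesIn G (3 - j) Lᶜ).image fun p => p.1 ∪ p.2 := by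
    intro K hK
    simp only [cliquesIn, mem_filter, mem_powersetCard] at hK
    obtain ⟨⟨-, hK3⟩, hcl⟩ := hK
    have hcard := card_inter_add_card_sdiff K L
    simp only [mem_biUnion, mem_range, mem_image, mem_product, Prod.exists, mem_powersetCard,
      cliquesIn, mem_filter]
    refine ⟨#(K ∩ L), by omega, K ∩ L, K \ L, ⟨⟨inter_subset_right, rfl⟩, ⟨⟨?_, by omega⟩, ?_⟩⟩,
      ?_⟩
    · intro u hu
      exact mem_compl.2 (mem_sdiff.1 hu).2
    · exact hcl.subset (by exact_mod_cast sdiff_subset)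
    · rw [union_comm, sdiff_union_inter]
  have h1 : #(cliquesIn G 3 univ) ≤
      ∑ j ∈ range 4, (#L).choose j * #(cliquesIn G (3 - j) Lᶜ) := by
    refine (card_le_card hsub).trans (card_biUnion_le.trans (sum_le_sum fun j _ => ?_))
    refine card_image_le.trans ?_
    rw [card_product, card_powersetCard]
  have hc0 : #(cliquesIn G 0 Lᶜ) ≤ 1 := by
    refine (card_filter_le _ _).trans ?_
    simp
  have hc1 : #(cliquesIn G 1 Lᶜ) ≤ #Lᶜ := by
    refine (card_filter_le _ _).trans ?_
    simp
  have hc2 := two_mul_card_cliquesIn_two_le (G := G) Lᶜ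
  have hc3 := card_cliquesIn_three_le (G := G) Lᶜ
  simp only [sum_range_succ, range_zero, sum_empty, Nat.choose_zero_right, Nat.choose_one_right,
    Nat.sub_zero, Nat.sub_self, zero_add, one_mul, Nat.reduceSub] at h1
  rw [triangleCount_eq]
  have e1 := Nat.mul_le_mul_left ((#L).choose 3) hc0
  have e2 := Nat.mul_le_mul_left ((#L).choose 2) hc1
  have e3 := Nat.mul_le_mul_left #L hc2
  nlinarith

end Cliques

section Deletion

variable {V : Type*} {G : SimpleGraph V}

lemma tc_le_sdiff {K : ℕ} {S : Finset V} (hK : ∀ v ∈ S, ec G (nb G S v) (nb G S v) ≤ K)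
    (W : Finset V) : tc G S ≤ tc G (S \ W) + #W * (3 * K) := by
  induction W using Finset.induction_on with
  | empty => simp
  | insert v W hv ih =>
    rw [sdiff_insert, card_insert_of_notMem hv]
    by_cases hvS : v ∈ S \ W
    · have h1 := tc_le_erase (G := G) hvS
      have h2 : ec G (nb G (S \ W) v) (nb G (S \ W) v) ≤ K :=
        (ec_mono (nb_mono sdiff_subset v) (nb_mono sdiff_subset v)).trans
          (hK v (mem_sdiff.1 hvS).1)
      rw [add_one_mul]
      omega
    · rw [erase_eq_of_notMem hvS, add_one_mul]
      omega

lemma ec_le_sdiff (S W : Finset V) : ec G S S ≤ ec G (S \ W) (S \ W) + #W * (2 * #S) := by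
  induction W using Finset.induction_on with
  | empty => simp
  | insert v W hv ih =>
    rw [sdiff_insert, card_insert_of_notMem hv]
    by_cases hvS : v ∈ S \ W
    · have h1 := ec_le_erase (G := G) hvS
      have h2 := card_le_card ((nb_subset (G := G) (S \ W) v).trans sdiff_subset)
      rw [add_one_mul]
      omega
    · rw [erase_eq_of_notMem hvS, add_one_mul]
      omega

lemma ec_le_of_tc_le {S : Finset V} {n : ℕ} (hn : 1 ≤ n) (hS : #S ≤ n) {ε : ℝ} (hε : 0 < ε)
    (h : (tc G S : ℝ) ≤ ε * n ^ 2) : (ec G S S : ℝ) ≤ n ^ 2 / 2 + ε * n ^ 2 := by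
  by_contra! hcon
  have hn' : (1 : ℝ) ≤ n := by exact_mod_cast hn
  have hS' : (#S : ℝ) ≤ n := by exact_mod_cast hS
  have h1 : 2 * (ec G S S : ℝ) ^ 2 ≤ n * (n * ec G S S + ε * n ^ 2) :=
    (two_mul_sq_ec_le_card S).trans (by gcongr)
  have h2 : (0 : ℝ) < ε * n ^ 2 := by positivity
  have h3 : (n : ℝ) ^ 2 / 2 * (2 * (ε * n ^ 2)) < ec G S S * (2 * ec G S S - n ^ 2) := by
    apply mul_lt_mul'' <;> first | positivity | linarith
  have h4 : ε * (n : ℝ) ^ 3 ≤ ε * n ^ 4 := by gcongr; norm_num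
  nlinarith

end Deletion

/-! ### The structure of extremal graphs -/

section Structure

variable {V : Type*} {G : SimpleGraph V}

lemma not_adj_of_tc_eq_zero {S : Finset V} (h : tc G S = 0) {x y z : V} (hx : x ∈ S) (hy : y ∈ S)
    (hz : z ∈ S) (hxy : G.Adj x y) (hyz : G.Adj y z) : ¬ G.Adj z x := by
  intro hzx
  have h1 := sum_eq_zero_iff.1 h x hx
  have h2 := sum_eq_zero_iff.1 h1 y (mem_nb.2 ⟨hy, hxy⟩)
  rw [card_eq_zero] at h2
  exact notMem_empty z (h2 ▸ mem_nb.2 ⟨mem_nb.2 ⟨hz, hzx.symm⟩, hyz⟩)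

lemma tc_eq_zero_mono {S T : Finset V} (h : tc G S = 0) (hT : T ⊆ S) : tc G T = 0 :=
  tc_eq_zero fun _ hx _ hy _ hz h1 h2 => not_adj_of_tc_eq_zero h (hT hx) (hT hy) (hT hz) h1 h2

lemma ec_congr {H : SimpleGraph V} {A B : Finset V}
    (h : ∀ a ∈ A, ∀ b ∈ B, G.Adj a b ↔ H.Adj a b) : ec G A B = ec H A B := by
  refine sum_congr rfl fun a ha => congrArg card (filter_congr fun b hb => ?_)
  exact h a ha b hb

lemma ec_univ [Fintype V] [DecidableRel G.Adj] : ec G univ univ = 2 * #G.edgeFinset := by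
  rw [← sum_degrees_eq_twice_card_edges]
  refine sum_congr rfl fun v _ => ?_
  rw [← card_neighborFinset_eq_degree]
  congr 1
  ext u
  simp [mem_nb]

lemma tc_univ_eq_zero_iff [Fintype V] : tc G univ = 0 ↔ G.CliqueFree 3 := by
  constructor
  · intro h K hK
    obtain ⟨x, y, z, hxy, hxz, hyz, rfl⟩ := is3Clique_iff.1 hK
    exact not_adj_of_tc_eq_zero h (mem_univ x) (mem_univ y) (mem_univ z) hxy hyz hxz.symm
  · intro h
    refine tc_eq_zero fun x _ y _ z _ hxy hyz hzx => h {x, y, z} ?_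
    exact is3Clique_iff.2 ⟨x, y, z, hxy, hzx.symm, hyz, rfl⟩

lemma nonempty_iso_turanGraph_two [Fintype V] (h : tc G univ = 0)
    (hec : Fintype.card V ^ 2 ≤ 2 * ec G univ univ + 1) :
    Nonempty (G ≃g turanGraph (Fintype.card V) 2) := by
  refine IsTuranMaximal.nonempty_iso_turanGraph ⟨tc_univ_eq_zero_iff.1 h, fun H _ hH => ?_⟩
  have h1 := two_mul_ec_le (tc_univ_eq_zero_iff.2 hH)
  rw [ec_univ, card_univ] at h1
  rw [ec_univ] at hec
  omega

lemma ec_induce [Fintype V] (S : Finset V) :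
    ec (G.induce (S : Set V)) univ univ = ec G S S := by
  rw [ec, ec, ← sum_coe_sort S]
  refine sum_congr rfl fun a _ => ?_
  rw [← card_map (Function.Embedding.subtype _)]
  congr 1
  ext b
  simp [mem_nb, and_comm]

lemma tc_induce_eq_zero [Fintype V] {S : Finset V} (h : tc G S = 0) :
    tc (G.induce (S : Set V)) univ = 0 :=
  tc_eq_zero fun x _ y _ z _ h1 h2 => not_adj_of_tc_eq_zero h x.2 y.2 z.2 h1 h2

/-- In a triangle-free graph with the maximal number of edges no vertex is isolated. -/
lemma exists_adj_of_ec_ge {S : Finset V} (h : tc G S = 0) (hec : #S ^ 2 ≤ 2 * ec G S S + 1)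
    (hS : 2 ≤ #S) {y : V} (hy : y ∈ S) : ∃ z ∈ S, G.Adj y z := by
  by_contra! hcon
  have h1 := ec_le_erase (G := G) hy
  have h2 : nb G S y = ∅ := filter_eq_empty_iff.2 fun z hz => hcon z hz
  have h3 := two_mul_ec_le (tc_eq_zero_mono h (erase_subset y S))
  rw [card_erase_of_mem hy] at h3
  rw [h2, card_empty] at h1
  obtain ⟨s, hs⟩ : ∃ s, #S = s + 2 := ⟨#S - 2, by omega⟩
  rw [hs] at hec h3
  have : s + 2 - 1 = s + 1 := by omega
  rw [this] at h3
  nlinarith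

/-- The graph obtained from `G` by joining the vertices of `L` to everything. -/
def saturate (G : SimpleGraph V) (L : Finset V) : SimpleGraph V where
  Adj x y := x ≠ y ∧ (x ∈ L ∨ y ∈ L ∨ G.Adj x y)
  symm := ⟨fun x y h => ⟨h.1.symm, by have := G.adj_comm x y; tauto⟩⟩
  loopless := ⟨fun _ h => h.1 rfl⟩

variable [Fintype V]

/-- A graph with as many triangles as the bound for its saturation contains all edges at `L`. -/
lemma adj_of_triangleCount_ge {L : Finset V} (h : tc G Lᶜ = 0)
    (hec : #Lᶜ ^ 2 ≤ 2 * ec G Lᶜ Lᶜ + 1) (hL : 3 ≤ #Lᶜ)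
    (ht : 2 * (#L).choose 3 + 2 * ((#L).choose 2 * #Lᶜ) + #L * ec G Lᶜ Lᶜ ≤ 2 * triangleCount G)
    {x y : V} (hx : x ∈ L) (hxy : x ≠ y) : G.Adj x y := by
  have hle : G ≤ saturate G L := fun a b hab => ⟨hab.ne, .inr (.inr hab)⟩
  have hadj : ∀ a ∈ Lᶜ, ∀ b ∈ Lᶜ, G.Adj a b ↔ (saturate G L).Adj a b := by
    intro a ha b hb
    rw [mem_compl] at ha hb
    exact ⟨fun hab => hle hab, fun hab => by simpa [ha, hb] using hab.2⟩
  have htc : tc (saturate G L) Lᶜ = 0 := tc_eq_zero fun a ha b hb c hc h1 h2 h3 =>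
    not_adj_of_tc_eq_zero h ha hb hc ((hadj a ha b hb).2 h1) ((hadj b hb c hc).2 h2)
      ((hadj c hc a ha).2 h3)
  have hcount := two_mul_triangleCount_le (G := saturate G L) L
  rw [htc, ← ec_congr hadj] at hcount
  have hsub : cliquesIn G 3 univ ⊆ cliquesIn (saturate G L) 3 univ :=
    monotone_filter_right _ fun K _ hK => hK.mono hle
  have heq : cliquesIn G 3 univ = cliquesIn (saturate G L) 3 univ := by
    refine eq_of_subset_of_card_le hsub ?_
    rw [← triangleCount_eq, ← triangleCount_eq]
    omega
  obtain ⟨z, hzx, hzy, hyz⟩ : ∃ z, z ≠ x ∧ z ≠ y ∧ (saturate G L).Adj y z := by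
    by_cases hy : y ∈ L
    · obtain ⟨z, hz⟩ := card_pos.1 (by omega : 0 < #Lᶜ)
      rw [mem_compl] at hz
      have hzy : z ≠ y := fun e => hz (e ▸ hy)
      exact ⟨z, fun e => hz (e ▸ hx), hzy, hzy.symm, .inl hy⟩
    · obtain ⟨z, hz, hyz⟩ := exists_adj_of_ec_ge h hec (by omega) (mem_compl.2 hy)
      exact ⟨z, fun e => mem_compl.1 hz (e ▸ hx), hyz.ne.symm, hle hyz⟩
  have hK : ({x, y, z} : Finset V) ∈ cliquesIn (saturate G L) 3 univ := by
    have h3 : (saturate G L).IsNClique 3 {x, y, z} :=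
      is3Clique_iff.2 ⟨x, y, z, ⟨hxy, .inl hx⟩, ⟨hzx.symm, .inl hx⟩, hyz, rfl⟩
    exact mem_filter.2 ⟨mem_powersetCard.2 ⟨subset_univ _, h3.card_eq⟩, h3.isClique⟩
  rw [← heq] at hK
  exact (mem_filter.1 hK).2 (by simp) (by simp) hxy

/-- A vertex set joined to everything, over a Turán graph, is a join. -/
lemma nonempty_iso_extremalJoin {L : Finset V} {ℓ m : ℕ} (hL : #L = ℓ) (hm : #Lᶜ = m)
    (h : tc G Lᶜ = 0) (hec : #Lᶜ ^ 2 ≤ 2 * ec G Lᶜ Lᶜ + 1)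
    (hadj : ∀ x ∈ L, ∀ y, x ≠ y → G.Adj x y) : Nonempty (G ≃g extremalJoin ℓ m) := by
  have hcard : Fintype.card ((Lᶜ : Finset V) : Set V) = m :=
    (Fintype.card_of_subtype Lᶜ fun x => by simp).trans hm
  obtain ⟨φ⟩ := nonempty_iso_turanGraph_two (G := G.induce ((Lᶜ : Finset V) : Set V))
    (tc_induce_eq_zero h) (by rw [ec_induce, hcard, ← hm]; exact hec)
  rw [hcard] at φ
  let α : {x // x ∈ L} ≃ Fin ℓ := L.equivFinOfCardEq hL
  let β : {x // x ∉ L} ≃ Fin m :=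
    (Equiv.subtypeEquivRight fun x => by simp).trans φ.toEquiv
  let e : {x // x ∈ L} ⊕ {x // x ∉ L} ≃ V := Equiv.sumCompl (· ∈ L)
  have hβ : ∀ a b, (turanGraph m 2).Adj (β a) (β b) ↔ G.Adj a.1 b.1 := fun a b =>
    φ.map_rel_iff'
  refine ⟨RelIso.symm ⟨(Equiv.sumCongr α β).symm.trans e, ?_⟩⟩
  intro u v
  obtain ⟨u, rfl⟩ := (Equiv.sumCongr α β).surjective u
  obtain ⟨v, rfl⟩ := (Equiv.sumCongr α β).surjective v
  rw [Equiv.trans_apply, Equiv.trans_apply, Equiv.symm_apply_apply, Equiv.symm_apply_apply]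
  rcases u with u | u <;> rcases v with v | v
  · have h1 : G.Adj u.1 v.1 ↔ u ≠ v :=
      ⟨fun hh e => hh.ne (congrArg _ e), fun hh => hadj u u.2 v fun e => hh (Subtype.ext e)⟩
    simp [e, extremalJoin, joinGraph, h1]
    tauto
  · have h1 : G.Adj u.1 v.1 := hadj u u.2 v fun e => v.2 (e ▸ u.2)
    simp [e, extremalJoin, joinGraph, h1]
  · have h1 : G.Adj u.1 v.1 := (hadj v v.2 u fun e => u.2 (e ▸ v.2)).symm
    simp [e, extremalJoin, joinGraph, h1]
  · have h1 := hβ u v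
    have h2 : G.Adj u.1 v.1 → u ≠ v := fun hh e => hh.ne (congrArg _ e)
    have h3 := G.adj_comm u.1 v.1
    have h4 := hβ v u
    simp only [e, extremalJoin, joinGraph, fromRel_adj]
    simp [h1, h4]
    tauto

end Structure

/-! ### Vertices with dense links -/

/-- The numerical comparison of the triangle counts. -/
lemma lt_of_triangle_bounds {p q K n m D ε t e c : ℝ} (hp : 0 ≤ p) (hq : 0 ≤ q) (hK : 0 ≤ K)
    (hD : D = 2 * (p + 1) ^ 3 + 2 * (p + 1) ^ 2 + 2 * q * (p + 1) + 6 * q * K)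
    (hn : 4 * (D + (p + 1) ^ 2 + 2 * (p + 1)) + 1 ≤ n) (hm : n = m + (p + 1))
    (hε : (p + 2) * ε = 1 / 8) (he : e ≤ n ^ 2 / 2 + ε * n ^ 2) (hc : c ≤ ε * n ^ 2)
    (ht : 2 * t ≤ 2 * (p + 1) ^ 3 + 2 * ((p + 1) ^ 2 * n) + p * (e + q * (2 * n)) +
      2 * (c + q * (3 * (K * n)))) :
    4 * t + 3 * (p + 1) < (p + 1) * m ^ 2 := by
  have hD0 : 0 ≤ D := by rw [hD]; positivity
  have hn1 : 1 ≤ n := by nlinarith [sq_nonneg (p + 1)]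
  have hpε : (p + 2) * ε * n ^ 2 = n ^ 2 / 8 := by rw [hε]; ring
  have e1 : p * e ≤ p * (n ^ 2 / 2 + ε * n ^ 2) := by gcongr
  have e2 : 2 * (p + 1) ^ 3 ≤ 2 * (p + 1) ^ 3 * n := le_mul_of_one_le_right (by positivity) hn1
  have hqn : 0 ≤ q * n := by positivity
  have e3 : 2 * t ≤ p * n ^ 2 / 2 + n ^ 2 / 8 + D * n := by
    rw [hD]
    linarith
  have e4 : (p + 1) * (n ^ 2 - 2 * (p + 1) * n) ≤ (p + 1) * m ^ 2 := by
    have hm' : m = n - (p + 1) := by linarith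
    rw [hm']
    gcongr
    linarith [sq_nonneg (p + 1)]
  have e5 : p + 1 ≤ (p + 1) * n := le_mul_of_one_le_right (by positivity) hn1
  have e6 : (4 * (D + (p + 1) ^ 2 + 2 * (p + 1)) + 1) * n ≤ n * n := by gcongr
  have e7 : 0 ≤ D * n := by positivity
  have e8 : 0 ≤ (p + 1) ^ 2 * n := by positivity
  linarith

/-- With fewer than `ℓ` vertices of dense link there are too few triangles. -/
lemma exists_triangleCount_lt {ℓ k : ℕ} (hk : 1 ≤ k) (K : ℕ) :
    ∃ N, ∀ n, N ≤ n → ∀ (V : Type) [Fintype V] (G : SimpleGraph V), Fintype.card V = n →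
      ¬ HasDisjointCycles G (ℓ + 1) (2 * k + 1) → ∀ L : Finset V, #L < ℓ →
      (∀ v ∉ L, ec G (nb G univ v) (nb G univ v) ≤ K * n) →
      triangleCount G < ℓ * ((n - ℓ) ^ 2 / 4) := by
  have hε : (0 : ℝ) < 1 / (8 * (ℓ + 1)) := by positivity
  obtain ⟨N, hN⟩ := exists_tc_le hk hε
  set ε : ℝ := 1 / (8 * (ℓ + 1)) with hεdef
  set q := (2 * k + 1) * (ℓ + 1) with hq
  set D := 2 * ℓ ^ 3 + 2 * ℓ ^ 2 + 2 * q * ℓ + 6 * q * K with hD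
  refine ⟨N + 4 * (D + ℓ ^ 2 + 2 * ℓ) + ℓ + 1, ?_⟩
  intro n hn V _ G hV hG L hL hdense
  obtain ⟨W, hW, hcyc⟩ := exists_cycle_cover (ℓ + 1) ∅ fun h => hG h.hasDisjointCycles
  rw [empty_union] at hcyc
  have hcard : ∀ S : Finset V, #S ≤ n := fun S => hV ▸ card_le_univ S
  have htc0 := hN n (by omega) V G (Lᶜ \ W) (hcard _) fun h => hcyc (h.mono fun u hu =>
    mem_compl.2 (mem_sdiff.1 hu).2)
  have hec0 := ec_le_of_tc_le (by omega) (hcard _) hε htc0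
  have htc1 := tc_le_sdiff (G := G) (S := Lᶜ) (K := K * n) (fun v hv =>
    (ec_mono (nb_mono (subset_univ _) v) (nb_mono (subset_univ _) v)).trans
      (hdense v (mem_compl.1 hv))) W
  have htc2 : tc G Lᶜ ≤ tc G (Lᶜ \ W) + q * (3 * (K * n)) :=
    htc1.trans (by gcongr)
  have hec2 : ec G Lᶜ Lᶜ ≤ ec G (Lᶜ \ W) (Lᶜ \ W) + q * (2 * n) :=
    (ec_le_sdiff Lᶜ W).trans (by gcongr; exact hcard _)
  have hcount := two_mul_triangleCount_le (G := G) L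
  have hc3 : (#L).choose 3 ≤ ℓ ^ 3 := (Nat.choose_le_pow _ _).trans (by gcongr)
  have hc2 : (#L).choose 2 * #Lᶜ ≤ ℓ ^ 2 * n :=
    Nat.mul_le_mul ((Nat.choose_le_pow _ _).trans (by gcongr)) (hcard _)
  obtain ⟨p, rfl⟩ : ∃ p, ℓ = p + 1 := ⟨ℓ - 1, by omega⟩
  have hLec : #L * ec G Lᶜ Lᶜ ≤ p * (ec G (Lᶜ \ W) (Lᶜ \ W) + q * (2 * n)) :=
    Nat.mul_le_mul (by omega) hec2
  obtain ⟨m, hm⟩ : ∃ m, n = m + (p + 1) := ⟨n - (p + 1), by omega⟩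
  have hdiv : m ^ 2 ≤ 4 * (m ^ 2 / 4) + 3 := by omega
  have hsub : n - (p + 1) = m := by omega
  rw [hsub]
  have hcount' : 2 * triangleCount G ≤ 2 * (p + 1) ^ 3 + 2 * ((p + 1) ^ 2 * n) +
      p * (ec G (Lᶜ \ W) (Lᶜ \ W) + q * (2 * n)) +
      2 * (tc G (Lᶜ \ W) + q * (3 * (K * n))) := by omega
  by_contra! hcon
  have hlow : (p + 1) * m ^ 2 ≤ 4 * triangleCount G + 3 * (p + 1) := by nlinarith
  have hlow' : ((p : ℝ) + 1) * m ^ 2 ≤ 4 * triangleCount G + 3 * (p + 1) := by exact_mod_cast hlow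
  have hup : 2 * (triangleCount G : ℝ) ≤ 2 * (p + 1) ^ 3 + 2 * ((p + 1) ^ 2 * n) +
      p * (ec G (Lᶜ \ W) (Lᶜ \ W) + q * (2 * n)) +
      2 * (tc G (Lᶜ \ W) + q * (3 * (K * n))) := by exact_mod_cast hcount'
  have hD' : (D : ℝ) = 2 * (p + 1) ^ 3 + 2 * (p + 1) ^ 2 + 2 * q * (p + 1) + 6 * q * K := by
    rw [hD]; push_cast; ring
  have hn' : 4 * ((D : ℝ) + (p + 1) ^ 2 + 2 * (p + 1)) + 1 ≤ n := by
    have : 4 * (D + (p + 1) ^ 2 + 2 * (p + 1)) + 1 ≤ n := by omega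
    exact_mod_cast this
  have hm' : (n : ℝ) = m + (p + 1) := by rw [hm]; push_cast; ring
  refine not_lt_of_ge hlow' ?_
  refine lt_of_triangle_bounds p.cast_nonneg q.cast_nonneg K.cast_nonneg hD' hn' hm' ?_ hec0 htc0
    hup
  rw [hεdef]
  push_cast
  field_simp
  ring

/-- Disjoint from `ℓ` vertices with dense link there is no further cycle. -/
lemma not_hasCycleIn_compl {V : Type*} [Fintype V] {G : SimpleGraph V} {ℓ k q : ℕ} (hk : 1 ≤ k)
    (hG : ¬ HasDisjointCycles G (ℓ + 1) (2 * k + 1)) {L : Finset V} (hL : #L = ℓ)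
    (hq : (2 * k + 1) * (ℓ + 1) ≤ q)
    (hdense : ∀ v ∈ L, (2 * k + q) * (2 * #(nb G univ v)) < ec G (nb G univ v) (nb G univ v)) :
    ¬ HasCycleIn G (2 * k + 1) Lᶜ := by
  rintro ⟨g, h1, h2, h3⟩
  refine hG (HasCycleFamily.cons (F := ∅) h1 h2 (fun i => notMem_empty _) ?_).hasDisjointCycles
  refine hasCycleFamily_of_dense_links hk ℓ L _ hL ?_ ?_ hdense
  · rw [empty_union, disjoint_right]
    intro u hu
    obtain ⟨i, -, rfl⟩ := mem_image.1 hu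
    exact mem_compl.1 (h3 i)
  · have h5 : #(univ.image g) ≤ 2 * k + 1 :=
      card_image_le.trans (by rw [card_univ, Fintype.card_fin])
    rw [empty_union]
    rw [mul_add_one] at hq
    omega

lemma nonempty_iso_of_triangleCount_eq (ℓ k : ℕ) (hℓ : 1 ≤ ℓ) (hk : 1 ≤ k) :
    ∃ n₀ : ℕ, ∀ n : ℕ, n₀ ≤ n →
      ∀ (V : Type) [Fintype V] (G : SimpleGraph V), Fintype.card V = n →
        ¬ HasDisjointCycles G (ℓ + 1) (2 * k + 1) →
        triangleCount G =
          ℓ * ((n - ℓ) ^ 2 / 4) + (n - ℓ) * Nat.choose ℓ 2 + Nat.choose ℓ 3 →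
        Nonempty (G ≃g extremalJoin ℓ (n - ℓ)) := by
  set q := (2 * k + 1) * (ℓ + 1) with hq
  obtain ⟨N₁, hN₁⟩ := exists_triangleCount_lt (ℓ := ℓ) hk ((2 * k + q) * 2)
  obtain ⟨N₂, hN₂⟩ := exists_tc_eq_zero hk
  refine ⟨N₁ + N₂ + ℓ + 3, fun n hn V _ G hV hG ht => ?_⟩
  set L : Finset V := univ.filter fun v =>
    (2 * k + q) * 2 * n < ec G (nb G univ v) (nb G univ v) with hLdef
  have hdense : ∀ v ∈ L, (2 * k + q) * (2 * #(nb G univ v)) <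
      ec G (nb G univ v) (nb G univ v) := by
    intro v hv
    refine lt_of_le_of_lt ?_ (mem_filter.1 hv).2
    rw [mul_assoc]
    gcongr
    exact hV ▸ card_le_univ _
  have hLle : #L ≤ ℓ := by
    by_contra! hcon
    obtain ⟨L', hL', hcard⟩ := exists_subset_card_eq (Nat.succ_le_of_lt hcon)
    exact hG (hasCycleFamily_of_dense_links hk (ℓ + 1) L' ∅ hcard (disjoint_empty_right _)
      (by simp [hq]) fun v hv => hdense v (hL' hv)).hasDisjointCycles
  have hLeq : #L = ℓ := by
    by_contra hne
    have h1 := hN₁ n (by omega) V G hV hG L (by omega) fun v hv => by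
      simpa [hLdef] using hv
    omega
  have hm : #Lᶜ = n - ℓ := by rw [card_compl, hV, hLeq]
  have hcount := two_mul_triangleCount_le (G := G) L
  rw [hLeq, ht, hm] at hcount
  generalize hmn : n - ℓ = m at *
  have hle : 2 * (m ^ 2 / 4) ≤ ec G Lᶜ Lᶜ + 2 * tc G Lᶜ := by
    refine le_of_mul_le_mul_left ?_ (Nat.pos_of_ne_zero (by omega : ℓ ≠ 0))
    have h1 : tc G Lᶜ ≤ ℓ * tc G Lᶜ := Nat.le_mul_of_pos_left _ hℓ
    nlinarith
  have hmod : m ^ 2 ≤ 4 * (m ^ 2 / 4) + 1 := by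
    have : m ^ 2 % 4 = 0 ∨ m ^ 2 % 4 = 1 := by
      have h1 : m % 4 < 4 := Nat.mod_lt _ (by norm_num)
      rw [Nat.pow_mod]
      interval_cases m % 4 <;> simp
    omega
  have htc : tc G Lᶜ = 0 := hN₂ V G Lᶜ (by omega) (not_hasCycleIn_compl hk hG hLeq le_rfl hdense)
    (by rw [hm]; omega)
  rw [htc] at hle
  have hec : #Lᶜ ^ 2 ≤ 2 * ec G Lᶜ Lᶜ + 1 := by rw [hm]; omega
  have hmantel := two_mul_ec_le htc
  rw [hm] at hmantel
  have hupper : ec G Lᶜ Lᶜ = 2 * (m ^ 2 / 4) := by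
    have := ec_induce (G := G) Lᶜ
    rw [ec_univ] at this
    omega
  refine nonempty_iso_extremalJoin hLeq hm htc hec fun x hx y hxy =>
    adj_of_triangleCount_ge htc hec (by omega) ?_ hx hxy
  rw [ht, hLeq, hm, hupper]
  exact le_of_eq (by ring)

end OddCycleTriangles

/-- Uniqueness of the extremal graph: any `n`-vertex graph with no `ℓ+1` disjoint copies of
`C_{2k+1}` attaining `ℓ·⌊(n−ℓ)²/4⌋ + (n−ℓ)·C(ℓ,2) + C(ℓ,3)` triangles is isomorphic to
`K_ℓ ⋈ T_2(n−ℓ)`, for sufficiently large `n`. -/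
theorem stmt_1 (ℓ k : ℕ) (hℓ : 1 ≤ ℓ) (hk : 1 ≤ k) :
    ∃ n₀ : ℕ, ∀ n : ℕ, n₀ ≤ n →
      ∀ (V : Type) [Fintype V] (G : SimpleGraph V), Fintype.card V = n →
        ¬ HasDisjointCycles G (ℓ + 1) (2 * k + 1) →
        triangleCount G =
          ℓ * ((n - ℓ) ^ 2 / 4) + (n - ℓ) * Nat.choose ℓ 2 + Nat.choose ℓ 3 →
        Nonempty (G ≃g extremalJoin ℓ (n - ℓ)) := by
  exact OddCycleTriangles.nonempty_iso_of_triangleCount_eq ℓ k hℓ hk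
end

section
/- For all integers ℓ ≥ 1, k ≥ 1 and n ≥ ℓ, there exists an n-vertex graph containing no ℓ+1 pairwise vertex-disjoint copies of C_{2k+1} whose number of triangles is at least ℓ·⌊(n−ℓ)²/4⌋ + (n−ℓ)·C(ℓ,2) + C(ℓ,3). -/
open SimpleGraph

section Join

variable {α β : Type*} {G : SimpleGraph α} {H : SimpleGraph β}

@[simp]
lemma joinGraph_adj_inl_inl {a a' : α} :
    (joinGraph G H).Adj (Sum.inl a) (Sum.inl a') ↔ G.Adj a a' := by
  simpa [joinGraph, G.adj_comm a' a] using fun h : G.Adj a a' => h.ne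

@[simp]
lemma joinGraph_adj_inr_inr {b b' : β} :
    (joinGraph G H).Adj (Sum.inr b) (Sum.inr b') ↔ H.Adj b b' := by
  simpa [joinGraph, H.adj_comm b' b] using fun h : H.Adj b b' => h.ne

@[simp]
lemma joinGraph_adj_inl_inr {a : α} {b : β} :
    (joinGraph G H).Adj (Sum.inl a) (Sum.inr b) := by
  simp [joinGraph]

@[simp]
lemma joinGraph_adj_inr_inl {a : α} {b : β} :
    (joinGraph G H).Adj (Sum.inr b) (Sum.inl a) := by
  simp [joinGraph]

lemma SimpleGraph.IsNClique.disjSum {p q : ℕ} {s : Finset α} {t : Finset β}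
    (hs : G.IsNClique p s) (ht : H.IsNClique q t) :
    (joinGraph G H).IsNClique (p + q) (s.disjSum t) := by
  refine ⟨?_, by rw [Finset.card_disjSum, hs.card_eq, ht.card_eq]⟩
  rintro (x | x) hx (y | y) hy hxy
  · simpa using hs.isClique (by simpa using hx) (by simpa using hy) (by simpa using hxy)
  · simp
  · simp
  · simpa using ht.isClique (by simpa using hx) (by simpa using hy) (by simpa using hxy)

/-- Every odd cycle in the join of `G` with a bipartite graph uses a vertex of `G`, so the number
of disjoint odd cycles is at most the number of vertices of `G`. -/
lemma not_hasDisjointCycles_joinGraph [Fintype α] (hH : H.Colorable 2) {c k : ℕ} (hk : 1 ≤ k)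
    (hc : Fintype.card α < c) : ¬ HasDisjointCycles (joinGraph G H) c (2 * k + 1) := by
  rintro ⟨f, -, hadj, hdisj⟩
  have key : ∀ j, ∃ a, Sum.inl a ∈ Set.range (f j) := by
    intro j
    by_contra! hj
    have hr : ∀ i, ∃ b, f j i = Sum.inr b := by
      intro i
      rcases hi : f j i with a | b
      · exact absurd ⟨i, hi⟩ (hj a)
      · exact ⟨b, rfl⟩
    choose g hg using hr
    let φ : cycleGraph (2 * k + 1) →g H :=
      ⟨g, fun {i i'} h => by simpa [hg] using hadj j h⟩
    have hcol := (hH.of_hom φ).chromaticNumber_le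
    rw [chromaticNumber_cycleGraph_of_odd _ (by omega) ⟨k, rfl⟩] at hcol
    exact absurd hcol (by decide)
  choose a ha using key
  have hinj : Function.Injective a := by
    intro j j' h
    by_contra hne
    exact Set.disjoint_left.1 (hdisj hne) (ha j) (h ▸ ha j')
  have := Fintype.card_le_of_injective a hinj
  simp at this
  omega

end Join

/-- The triangles of `K_ℓ ⋈ K_{a,b}`, counted by the number of their vertices in `K_ℓ`. -/
lemma le_triangleCount_join_completeBipartite (ℓ a b : ℕ) :
    ℓ * (a * b) + (a + b) * ℓ.choose 2 + ℓ.choose 3 ≤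
      triangleCount (joinGraph (completeGraph (Fin ℓ))
        (completeBipartiteGraph (Fin a) (Fin b))) := by
  classical
  set K := joinGraph (completeGraph (Fin ℓ)) (completeBipartiteGraph (Fin a) (Fin b))
  have htop : ∀ s : Finset (Fin ℓ), (completeGraph (Fin ℓ)).IsNClique s.card s :=
    fun s => ⟨fun x _ y _ h => h, rfl⟩
  let T₁ : Finset (Finset (Fin ℓ ⊕ Fin a ⊕ Fin b)) :=
    (Finset.univ : Finset (Fin ℓ × Fin a × Fin b)).image
      fun p => Finset.disjSum {p.1} (Finset.disjSum {p.2.1} {p.2.2})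
  let T₂ : Finset (Finset (Fin ℓ ⊕ Fin a ⊕ Fin b)) :=
    ((Finset.univ : Finset (Fin a ⊕ Fin b)) ×ˢ
      (Finset.univ : Finset (Fin ℓ)).powersetCard 2).image fun p => p.2.disjSum {p.1}
  let T₃ : Finset (Finset (Fin ℓ ⊕ Fin a ⊕ Fin b)) :=
    ((Finset.univ : Finset (Fin ℓ)).powersetCard 3).image fun s => s.disjSum ∅
  have card₁ : T₁.card = ℓ * (a * b) := by
    rw [Finset.card_image_of_injective _ fun p q h => by
      simpa [Prod.ext_iff] using h]
    simp
  have card₂ : T₂.card = (a + b) * ℓ.choose 2 := by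
    rw [Finset.card_image_of_injective _ fun p q h => by
      simpa [Prod.ext_iff, and_comm] using h]
    simp
  have card₃ : T₃.card = ℓ.choose 3 := by
    rw [Finset.card_image_of_injective _ fun p q h => by simpa using h]
    simp
  have left₁ : ∀ t ∈ T₁, t.toLeft.card = 1 := by
    simp only [T₁, Finset.mem_image]
    rintro _ ⟨p, -, rfl⟩
    simp
  have left₂ : ∀ t ∈ T₂, t.toLeft.card = 2 := by
    simp only [T₂, Finset.mem_image, Finset.mem_product, Finset.mem_powersetCard]
    rintro _ ⟨p, hp, rfl⟩
    simpa using hp.2.2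
  have left₃ : ∀ t ∈ T₃, t.toLeft.card = 3 := by
    simp only [T₃, Finset.mem_image, Finset.mem_powersetCard]
    rintro _ ⟨s, hs, rfl⟩
    rw [Finset.toLeft_disjSum, hs.2]
  have disj₁₂ : Disjoint T₁ T₂ :=
    Finset.disjoint_left.2 fun t h h' => by have := left₁ t h; have := left₂ t h'; omega
  have disj₃ : Disjoint (T₁ ∪ T₂) T₃ := by
    refine Finset.disjoint_left.2 fun t h h' => ?_
    have := left₃ t h'
    rcases Finset.mem_union.1 h with h | h
    · have := left₁ t h; omega
    · have := left₂ t h; omega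
  have hsub : (↑(T₁ ∪ T₂ ∪ T₃) : Set (Finset (Fin ℓ ⊕ Fin a ⊕ Fin b))) ⊆ K.cliqueSet 3 := by
    intro t ht
    rw [mem_cliqueSet_iff]
    simp only [Finset.coe_union, Set.mem_union, Finset.mem_coe, or_assoc] at ht
    rcases ht with ht | ht | ht
    · obtain ⟨⟨x, y, z⟩, -, rfl⟩ := Finset.mem_image.1 ht
      refine (htop {x}).disjSum (q := 2) ⟨?_, by simp⟩
      rintro (u | u) hu (v | v) hv huv <;> simp_all
    · obtain ⟨⟨v, s⟩, hs, rfl⟩ := Finset.mem_image.1 ht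
      have hs' : s.card = 2 := (Finset.mem_powersetCard.1 (Finset.mem_product.1 hs).2).2
      exact (hs' ▸ htop s).disjSum (q := 1) (by simp)
    · obtain ⟨s, hs, rfl⟩ := Finset.mem_image.1 ht
      have hs' : s.card = 3 := (Finset.mem_powersetCard.1 hs).2
      exact (hs' ▸ htop s).disjSum (q := 0) (by simp)
  calc ℓ * (a * b) + (a + b) * ℓ.choose 2 + ℓ.choose 3
      = (T₁ ∪ T₂ ∪ T₃).card := by
        rw [Finset.card_union_of_disjoint disj₃, Finset.card_union_of_disjoint disj₁₂,
          card₁, card₂, card₃]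
    _ ≤ triangleCount K := by
        rw [triangleCount, ← Set.ncard_coe_finset]
        exact Set.ncard_le_ncard hsub (Set.toFinite _)

lemma triangleCount_map_equiv {V W : Type*} (G : SimpleGraph V) (e : V ≃ W) :
    triangleCount (G.map e) = triangleCount G := by
  rw [triangleCount, cliqueSet_map_of_equiv]
  exact Set.ncard_image_of_injective _ (Finset.map_injective _)

lemma HasDisjointCycles.of_iso {V W : Type*} {G : SimpleGraph V} {H : SimpleGraph W} {c m : ℕ}
    (e : G ≃g H) (h : HasDisjointCycles G c m) : HasDisjointCycles H c m := by
  obtain ⟨f, hinj, hadj, hdisj⟩ := h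
  refine ⟨fun j i => e (f j i), fun j => e.injective.comp (hinj j),
    fun j i i' h => e.map_adj_iff.2 (hadj j h), fun j j' hne => ?_⟩
  have := (Set.disjoint_image_iff e.injective).2 (hdisj hne)
  rwa [← Set.range_comp, ← Set.range_comp] at this

lemma Nat.half_mul_sub_half (m : ℕ) : m / 2 * (m - m / 2) = m ^ 2 / 4 := by
  obtain ⟨r, rfl | rfl⟩ := Nat.even_or_odd' m
  · rw [show 2 * r / 2 = r by omega, show 2 * r - r = r by omega,
      show (2 * r) ^ 2 = r * r * 4 by ring, Nat.mul_div_cancel _ (by norm_num)]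
  · rw [show (2 * r + 1) / 2 = r by omega, show 2 * r + 1 - r = r + 1 by omega,
      show (2 * r + 1) ^ 2 = 1 + 4 * (r * (r + 1)) by ring, Nat.add_mul_div_left _ _ (by norm_num)]
    simp

/-- For all `ℓ, k ≥ 1` and `n ≥ ℓ` there is an `n`-vertex graph with no `ℓ+1` pairwise
vertex-disjoint copies of `C_{2k+1}` having at least
`ℓ·⌊(n−ℓ)²/4⌋ + (n−ℓ)·C(ℓ,2) + C(ℓ,3)` triangles. -/
theorem stmt_4 (ℓ k n : ℕ) (hℓ : 1 ≤ ℓ) (hk : 1 ≤ k) (hn : ℓ ≤ n) :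
    ∃ G : SimpleGraph (Fin n),
      ¬ HasDisjointCycles G (ℓ + 1) (2 * k + 1) ∧
      ℓ * ((n - ℓ) ^ 2 / 4) + (n - ℓ) * Nat.choose ℓ 2 + Nat.choose ℓ 3 ≤
        triangleCount G := by
  set m := n - ℓ with hm
  let K := joinGraph (completeGraph (Fin ℓ))
    (completeBipartiteGraph (Fin (m / 2)) (Fin (m - m / 2)))
  let e : Fin ℓ ⊕ Fin (m / 2) ⊕ Fin (m - m / 2) ≃ Fin n :=
    Fintype.equivFinOfCardEq (by simp; omega)
  refine ⟨K.map e, fun h => ?_, ?_⟩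
  · exact not_hasDisjointCycles_joinGraph
      (by simpa using (CompleteBipartiteGraph.bicoloring _ _).colorable) hk (by simp)
      (h.of_iso (Iso.map e K).symm)
  · rw [triangleCount_map_equiv, ← Nat.half_mul_sub_half]
    have := le_triangleCount_join_completeBipartite ℓ (m / 2) (m - m / 2)
    rwa [show m / 2 + (m - m / 2) = m by omega] at this
end
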